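/- Walfisz's bound in dimension four: P₄(x) = O( x·(log x)^{2/3} ) as x → ∞. -/

import Mathlib

open Real Filter Asymptotics

/-- The number of integer lattice points in the closed origin-centered ball of radius `√x`
in `ℝ⁴`. -/
noncomputable def latticeA4 (x : ℝ) : ℕ :=
  {v : Fin 4 → ℤ | ∑ i, ((v i : ℝ)) ^ 2 ≤ x}.ncard

/-- The lattice point discrepancy of the ball in `ℝ⁴`. -/
noncomputable def latticeP4 (x : ℝ) : ℝ :=
  (latticeA4 x : ℝ) - (Real.pi ^ 2 / 2) * x ^ 2

namespace Walfisz

/-- The vector of the first `k` power sums of a tuple. -/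
def powerSums (k : ℕ) {ι R : Type*} [Fintype ι] [CommRing R] (x : ι → R) : Fin k → R :=
  fun j => ∑ i, x i ^ (j + 1 : ℕ)

lemma esymm_eq_of_powerSums_eq {R : Type*} [CommRing R] {k : ℕ} {x y : Fin k → R}
    (hu : ∀ j : ℕ, 1 ≤ j → j ≤ k → IsUnit (j : R))
    (h : powerSums k x = powerSums k y) (n : ℕ) (hn : n ≤ k) :
    MvPolynomial.aeval x (MvPolynomial.esymm (Fin k) R n) =
      MvPolynomial.aeval y (MvPolynomial.esymm (Fin k) R n) := by
  induction n using Nat.strong_induction_on with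
  | _ n ih =>
    rcases Nat.eq_zero_or_pos n with rfl | hpos
    · simp
    · have key : ∀ z : Fin k → R, (n : R) * MvPolynomial.aeval z (MvPolynomial.esymm (Fin k) R n) =
          (-1) ^ (n + 1) * ∑ a ∈ Finset.HasAntidiagonal.antidiagonal n with a.1 < n,
            (-1) ^ a.1 * MvPolynomial.aeval z (MvPolynomial.esymm (Fin k) R a.1) *
              ∑ i, z i ^ a.2 := by
        intro z
        have := congrArg (MvPolynomial.aeval z) (MvPolynomial.mul_esymm_eq_sum (Fin k) R n)
        simpa [MvPolynomial.psum, map_sum, map_mul, map_pow] using this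
      apply (hu n hpos hn).mul_left_cancel
      rw [key x, key y]
      congr 1
      apply Finset.sum_congr rfl
      intro a ha
      rw [Finset.mem_filter, Finset.HasAntidiagonal.mem_antidiagonal] at ha
      rw [ih a.1 ha.2 (by omega)]
      congr 1
      have h2 := congrFun h ⟨a.2 - 1, by omega⟩
      simp only [powerSums] at h2
      rwa [Nat.sub_add_cancel (by omega)] at h2

lemma prod_sub_eq_of_powerSums_eq {R : Type*} [CommRing R] {k : ℕ} {x y : Fin k → R}
    (hu : ∀ j : ℕ, 1 ≤ j → j ≤ k → IsUnit (j : R))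
    (h : powerSums k x = powerSums k y) (t : R) :
    ∏ i, (t - x i) = ∏ i, (t - y i) := by
  have key : ∀ z : Fin k → R, ∏ i, (t - z i) = ∑ j ∈ Finset.range (k + 1),
      (-1) ^ j * (MvPolynomial.aeval z (MvPolynomial.esymm (Fin k) R j) * t ^ (k - j)) := by
    intro z
    have := congrArg (Polynomial.eval t)
      (Multiset.prod_X_sub_X_eq_sum_esymm (Multiset.map z Finset.univ.val))
    rw [Polynomial.eval_multiset_prod] at this
    simp only [Multiset.map_map, Function.comp_def, Polynomial.eval_sub, Polynomial.eval_X,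
      Polynomial.eval_C, Polynomial.eval_finsetSum, Polynomial.eval_mul, Polynomial.eval_pow,
      Polynomial.eval_neg, Polynomial.eval_one, Multiset.card_map, Finset.card_val,
      Finset.card_univ, Fintype.card_fin] at this
    simp only [MvPolynomial.aeval_esymm_eq_multiset_esymm]
    exact this
  rw [key x, key y]
  apply Finset.sum_congr rfl
  intro j hj
  rw [esymm_eq_of_powerSums_eq hu h j (by simpa [Nat.lt_succ_iff] using hj)]

lemma isUnit_natCast_zmod {p k : ℕ} (hp : p.Prime) {j : ℕ} (h1 : 1 ≤ j) (h2 : j < p) :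
    IsUnit (j : ZMod (p ^ k)) := by
  rw [ZMod.isUnit_iff_coprime]
  exact Nat.Coprime.pow_right k ((Nat.Prime.coprime_iff_not_dvd hp).2 (Nat.not_dvd_of_pos_of_lt h1 h2)).symm

lemma sum_univ_fin_sub (k : ℕ) : ∑ j : Fin k, (k - (j + 1 : ℕ)) = k * (k - 1) / 2 := by
  rw [Fin.sum_univ_eq_sum_range (fun j => k - (j + 1)) k, ← Finset.sum_range_id k,
    ← Finset.sum_range_reflect]
  apply Finset.sum_congr rfl
  intro j hj
  rw [Finset.mem_range] at hj
  omega

/-- Points of a box of side at most `p ^ k` whose coordinates are distinct modulo `p` and whose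
power sums agree modulo `p ^ k`: there are at most `k ^ k` of them. -/
lemma card_le_of_powerSums_eq {p k X : ℕ} (hp : p.Prime) (hk : k < p) (hX : X ≤ p ^ k) {b : ℤ}
    {S : Finset (Fin k → ℤ)} (hS : ∀ x ∈ S, ∀ i, b ≤ x i ∧ x i < b + X)
    (hd : ∀ x ∈ S, ∀ i i', i ≠ i' → ¬ (p : ℤ) ∣ x i - x i')
    (hc : ∀ x ∈ S, ∀ y ∈ S, powerSums k (fun i => (x i : ZMod (p ^ k))) =
      powerSums k (fun i => (y i : ZMod (p ^ k)))) :
    S.card ≤ k ^ k := by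
  classical
  rcases S.eq_empty_or_nonempty with rfl | ⟨x₀, hx₀⟩
  · simp
  have hsub : S ⊆ Fintype.piFinset (fun _ : Fin k => Finset.univ.image x₀) := by
    intro x hx
    rw [Fintype.mem_piFinset]
    intro m
    rw [Finset.mem_image]
    have h0 := prod_sub_eq_of_powerSums_eq (k := k)
      (fun j h1 h2 => isUnit_natCast_zmod (k := k) hp h1 (by omega)) (hc x hx x₀ hx₀)
      ((x m : ZMod (p ^ k)))
    rw [Finset.prod_eq_zero (Finset.mem_univ m) (sub_self _)] at h0
    have h1 : ((p : ℤ) ^ k) ∣ ∏ i, (x m - x₀ i) := by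
      have : ((∏ i, (x m - x₀ i) : ℤ) : ZMod (p ^ k)) = 0 := by
        push_cast
        exact h0.symm
      rw [ZMod.intCast_zmod_eq_zero_iff_dvd] at this
      exact_mod_cast this
    have hpp : Prime (p : ℤ) := Nat.prime_iff_prime_int.1 hp
    have hk0 : k ≠ 0 := by
      rintro rfl
      exact m.elim0
    obtain ⟨i, -, hi⟩ := (hpp.dvd_finsetProd_iff _).1 ((dvd_pow_self _ hk0).trans h1)
    refine ⟨i, Finset.mem_univ i, ?_⟩
    rw [← Finset.mul_prod_erase _ _ (Finset.mem_univ i)] at h1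
    have hcop : IsCoprime ((p : ℤ) ^ k) (∏ l ∈ Finset.univ.erase i, (x m - x₀ l)) := by
      apply IsCoprime.pow_left
      apply IsCoprime.prod_right
      intro l hl
      rw [Prime.coprime_iff_not_dvd hpp]
      intro hdl
      apply hd x₀ hx₀ l i (Finset.ne_of_mem_erase hl)
      have := dvd_sub hi hdl
      rwa [sub_sub_sub_cancel_left] at this
    have h2 := hcop.dvd_of_dvd_mul_right h1
    have h3 := hS x hx m
    have h4 := hS x₀ hx₀ i
    have h5 : (X : ℤ) ≤ (p : ℤ) ^ k := by exact_mod_cast hX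
    have h6 : x m - x₀ i = 0 := by
      apply Int.eq_zero_of_abs_lt_dvd h2
      rw [abs_lt]
      constructor <;> linarith
    linarith
  calc S.card ≤ _ := Finset.card_le_card hsub
    _ = (Finset.univ.image x₀).card ^ k := by simp [Fintype.card_piFinset]
    _ ≤ k ^ k := Nat.pow_le_pow_left (Finset.card_image_le.trans (by simp)) k

/-- Linnik's lemma. -/
lemma card_le_of_powerSums_modEq {p k X : ℕ} (hp : p.Prime) (hk : k < p) (hX : X ≤ p ^ k) {b : ℤ}
    {S : Finset (Fin k → ℤ)} (hS : ∀ x ∈ S, ∀ i, b ≤ x i ∧ x i < b + X)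
    (hd : ∀ x ∈ S, ∀ i i', i ≠ i' → ¬ (p : ℤ) ∣ x i - x i') (c : Fin k → ℤ)
    (hc : ∀ x ∈ S, ∀ j : Fin k, (p : ℤ) ^ (j + 1 : ℕ) ∣ powerSums k x j - c j) :
    S.card ≤ k ^ k * p ^ (k * (k - 1) / 2) := by
  classical
  have : ∀ j : Fin k, NeZero (p ^ (k - (j + 1 : ℕ))) := fun j => ⟨pow_ne_zero _ hp.ne_zero⟩
  let f : (Fin k → ℤ) → ((j : Fin k) → ZMod (p ^ (k - (j + 1 : ℕ)))) := fun x j =>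
    (((powerSums k x j - c j) / (p : ℤ) ^ (j + 1 : ℕ) : ℤ) : ZMod _)
  have hcard : (Finset.univ : Finset ((j : Fin k) → ZMod (p ^ (k - (j + 1 : ℕ))))).card =
      p ^ (k * (k - 1) / 2) := by
    rw [Finset.card_univ, Fintype.card_pi]
    simp only [ZMod.card]
    rw [Finset.prod_pow_eq_pow_sum, sum_univ_fin_sub]
  rw [← hcard]
  apply Finset.card_le_mul_card_image_of_maps_to (f := f) (fun _ _ => Finset.mem_univ _)
  intro z _
  apply card_le_of_powerSums_eq hp hk hX (b := b)
  · intro x hx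
    exact hS x (Finset.mem_filter.1 hx).1
  · intro x hx
    exact hd x (Finset.mem_filter.1 hx).1
  · intro x hx y hy
    rw [Finset.mem_filter] at hx hy
    funext j
    obtain ⟨u, hu⟩ := hc x hx.1 j
    obtain ⟨v, hv⟩ := hc y hy.1 j
    have hxy := congrFun (hx.2.trans hy.2.symm) j
    have hpne : (p : ℤ) ^ (j + 1 : ℕ) ≠ 0 := pow_ne_zero _ (by exact_mod_cast hp.ne_zero)
    simp only [f] at hxy
    rw [hu, hv, Int.mul_ediv_cancel_left _ hpne, Int.mul_ediv_cancel_left _ hpne,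
      ZMod.intCast_eq_intCast_iff_dvd_sub] at hxy
    have hfin : ((powerSums k x j : ℤ) : ZMod (p ^ k)) = ((powerSums k y j : ℤ) : ZMod (p ^ k)) := by
      rw [ZMod.intCast_eq_intCast_iff_dvd_sub]
      have e1 : powerSums k y j - powerSums k x j = (p : ℤ) ^ (j + 1 : ℕ) * (v - u) := by
        linear_combination hv - hu
      rw [e1]
      have e2 : ((p ^ k : ℕ) : ℤ) = (p : ℤ) ^ (j + 1 : ℕ) * ((p ^ (k - (j + 1 : ℕ)) : ℕ) : ℤ) := by
        push_cast
        rw [← pow_add]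
        congr 1
        have := j.2
        omega
      rw [e2]
      exact mul_dvd_mul_left _ hxy
    simpa [powerSums] using hfin

/-- The character of `(ZMod N)^k` attached to an integer vector. -/
noncomputable def chr (N : ℕ) [NeZero N] {k : ℕ} (v : Fin k → ℤ) (α : Fin k → ZMod N) : ℂ :=
  ∏ j, ZMod.stdAddChar (α j * (v j : ZMod N))

section chr

variable {N : ℕ} [NeZero N] {k : ℕ}

lemma chr_add (v w : Fin k → ℤ) (α : Fin k → ZMod N) :
    chr N (v + w) α = chr N v α * chr N w α := by
  simp only [chr, Pi.add_apply, Int.cast_add, mul_add, AddChar.map_add_eq_mul,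
    Finset.prod_mul_distrib]

lemma chr_zero (α : Fin k → ZMod N) : chr N 0 α = 1 := by
  simp [chr]

lemma norm_chr (v : Fin k → ℤ) (α : Fin k → ZMod N) : ‖chr N v α‖ = 1 := by
  rw [chr, norm_prod]
  exact Finset.prod_eq_one fun j _ => by rw [ZMod.stdAddChar_apply, Circle.norm_coe]

lemma star_chr (v : Fin k → ℤ) (α : Fin k → ZMod N) :
    (starRingEnd ℂ) (chr N v α) = chr N (-v) α := by
  have h1 : chr N (-v) α * chr N v α = 1 := by
    rw [← chr_add, neg_add_cancel, chr_zero]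
  have h2 : (starRingEnd ℂ) (chr N v α) * chr N v α = 1 := by
    rw [mul_comm, Complex.mul_conj, Complex.normSq_eq_norm_sq, norm_chr]
    simp
  have h3 : chr N v α ≠ 0 := by
    rw [← norm_ne_zero_iff, norm_chr]
    exact one_ne_zero
  exact mul_right_cancel₀ h3 (h2.trans h1.symm)

lemma chr_sum {ι : Type*} (s : Finset ι) (v : ι → Fin k → ℤ) (α : Fin k → ZMod N) :
    chr N (∑ i ∈ s, v i) α = ∏ i ∈ s, chr N (v i) α := by
  classical
  induction s using Finset.induction_on with
  | empty => simp [chr_zero]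
  | insert a s ha ih => rw [Finset.sum_insert ha, Finset.prod_insert ha, chr_add, ih]

open Classical in
lemma sum_chr (v : Fin k → ℤ) :
    ∑ α : Fin k → ZMod N, chr N v α = if ∀ j, (N : ℤ) ∣ v j then (N : ℂ) ^ k else 0 := by
  have h := Finset.prod_univ_sum (fun _ : Fin k => (Finset.univ : Finset (ZMod N)))
    (fun j a => (ZMod.stdAddChar (a * (v j : ZMod N)) : ℂ))
  rw [Fintype.piFinset_univ] at h
  have h' : ∑ α : Fin k → ZMod N, chr N v α =
      ∏ j, ∑ a : ZMod N, (ZMod.stdAddChar (a * (v j : ZMod N)) : ℂ) := h.symm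
  rw [h']
  simp only [AddChar.sum_mulShift _ (ZMod.isPrimitive_stdAddChar N), ZMod.card,
    ZMod.intCast_zmod_eq_zero_iff_dvd]
  split_ifs with hd
  · simp [hd]
  · push Not at hd
    obtain ⟨j, hj⟩ := hd
    apply Finset.prod_eq_zero (Finset.mem_univ j)
    simp [hj]

/-- The exponential sum with frequencies `φ a`, `a ∈ S`. -/
noncomputable def expSum (N : ℕ) [NeZero N] {k : ℕ} {β : Type*} (S : Finset β)
    (φ : β → Fin k → ℤ) (α : Fin k → ZMod N) : ℂ :=
  ∑ a ∈ S, chr N (φ a) α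

open Classical in
/-- Orthogonality: a mean value of exponential sums counts solutions of a system of equations. -/
lemma sum_expSum_mul_star {β γ : Type*} (S : Finset β) (T : Finset γ) (φ : β → Fin k → ℤ)
    (ψ : γ → Fin k → ℤ) {B : ℕ} (hN : 2 * B < N) (hφ : ∀ a ∈ S, ∀ j, |φ a j| ≤ B)
    (hψ : ∀ b ∈ T, ∀ j, |ψ b j| ≤ B) :
    ∑ α, expSum N S φ α * (starRingEnd ℂ) (expSum N T ψ α) =
      (N : ℂ) ^ k * (((S ×ˢ T).filter (fun ab => φ ab.1 = ψ ab.2)).card : ℂ) := by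
  simp only [expSum, map_sum, star_chr, Finset.sum_mul_sum, ← chr_add]
  simp only [← Finset.sum_product']
  rw [Finset.sum_product_right, Finset.card_filter, Nat.cast_sum, Finset.mul_sum]
  apply Finset.sum_congr rfl
  rintro ⟨a, b⟩ hab
  rw [Finset.mem_product] at hab
  dsimp only
  rw [sum_chr]
  have : (∀ j, (N : ℤ) ∣ (φ a + -ψ b) j) ↔ φ a = ψ b := by
    constructor
    · intro h
      funext j
      have h1 := abs_le.1 (hφ a hab.1 j)
      have h2 := abs_le.1 (hψ b hab.2 j)
      have h3 : (φ a + -ψ b) j = 0 := by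
        apply Int.eq_zero_of_abs_lt_dvd (h j)
        simp only [Pi.add_apply, Pi.neg_apply]
        rw [abs_lt]
        constructor <;> omega
      simp only [Pi.add_apply, Pi.neg_apply] at h3
      linarith
    · intro h j
      simp [h]
  simp only [this]
  split_ifs <;> simp

open Classical in
lemma sum_expSum_sq {β : Type*} (S : Finset β) (φ : β → Fin k → ℤ) {B : ℕ} (hN : 2 * B < N)
    (hφ : ∀ a ∈ S, ∀ j, |φ a j| ≤ B) :
    ∑ α, ‖expSum N S φ α‖ ^ 2 =
      (N : ℝ) ^ k * (((S ×ˢ S).filter (fun ab => φ ab.1 = φ ab.2)).card : ℝ) := by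
  have h := sum_expSum_mul_star S S φ φ hN hφ hφ
  simp only [Complex.mul_conj, Complex.normSq_eq_norm_sq] at h
  exact_mod_cast h

open Classical in
lemma card_le_sum_norm {β γ : Type*} (S : Finset β) (T : Finset γ) (φ : β → Fin k → ℤ)
    (ψ : γ → Fin k → ℤ) {B : ℕ} (hN : 2 * B < N) (hφ : ∀ a ∈ S, ∀ j, |φ a j| ≤ B)
    (hψ : ∀ b ∈ T, ∀ j, |ψ b j| ≤ B) :
    (N : ℝ) ^ k * (((S ×ˢ T).filter (fun ab => φ ab.1 = ψ ab.2)).card : ℝ) ≤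
      ∑ α, ‖expSum N S φ α‖ * ‖expSum N T ψ α‖ := by
  have h := sum_expSum_mul_star S T φ ψ hN hφ hψ
  have h2 : (N : ℝ) ^ k * (((S ×ˢ T).filter (fun ab => φ ab.1 = ψ ab.2)).card : ℝ) =
      ‖∑ α, expSum N S φ α * (starRingEnd ℂ) (expSum N T ψ α)‖ := by
    rw [h]
    simp
  rw [h2]
  apply (norm_sum_le _ _).trans_eq
  simp

lemma exists_bound {β : Type*} (S : Finset β) (φ : β → Fin k → ℤ) :
    ∃ B : ℕ, ∀ a ∈ S, ∀ j, |φ a j| ≤ B := by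
  refine ⟨∑ a ∈ S, ∑ j, (φ a j).natAbs, fun a ha j => ?_⟩
  rw [Int.abs_eq_natAbs]
  have h1 := Finset.single_le_sum (f := fun a => ∑ j, (φ a j).natAbs) (fun _ _ => Nat.zero_le _) ha
  have h2 := Finset.single_le_sum (f := fun j => (φ a j).natAbs) (fun _ _ => Nat.zero_le _)
    (Finset.mem_univ j)
  exact_mod_cast h2.trans h1

lemma expSum_add {β γ : Type*} (S : Finset β) (T : Finset γ) (φ : β → Fin k → ℤ)
    (ψ : γ → Fin k → ℤ) (α : Fin k → ZMod N) :
    expSum N (S ×ˢ T) (fun ab => φ ab.1 + ψ ab.2) α = expSum N S φ α * expSum N T ψ α := by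
  simp only [expSum, Finset.sum_mul_sum, ← chr_add]
  rw [← Finset.sum_product']

end chr

open Classical in
/-- The number of coincidences with a prescribed difference is maximal for difference zero. -/
lemma card_shift_le {k : ℕ} {β : Type*} (S : Finset β) (φ : β → Fin k → ℤ) (w : Fin k → ℤ) :
    ((S ×ˢ S).filter (fun ab => φ ab.1 = φ ab.2 + w)).card ≤
      ((S ×ˢ S).filter (fun ab => φ ab.1 = φ ab.2)).card := by
  obtain ⟨B₁, hB₁⟩ := exists_bound S φ
  obtain ⟨B₂, hB₂⟩ := exists_bound S (fun a => φ a + w)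
  set N := 2 * (B₁ + B₂) + 1 with hN
  have : NeZero N := ⟨by omega⟩
  have h1 := card_le_sum_norm (N := N) (B := B₁ + B₂) S S φ (fun a => φ a + w) (by omega)
    (fun a ha j => (hB₁ a ha j).trans (by push_cast; omega))
    (fun a ha j => (hB₂ a ha j).trans (by push_cast; omega))
  have h2 := sum_expSum_sq (N := N) (B := B₁ + B₂) S φ (by omega)
    (fun a ha j => (hB₁ a ha j).trans (by push_cast; omega))
  have h3 : ∀ α, ‖expSum N S (fun a => φ a + w) α‖ = ‖expSum N S φ α‖ := by
    intro α
    simp only [expSum, chr_add, ← Finset.sum_mul, norm_mul, norm_chr, mul_one]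
  simp only [h3, ← pow_two] at h1
  rw [h2] at h1
  have h4 : (0 : ℝ) < (N : ℝ) ^ k := by positivity
  exact_mod_cast le_of_mul_le_mul_left h1 h4

/-- The moment curve. -/
def momentCurve (k : ℕ) (x : ℤ) : Fin k → ℤ := fun j => x ^ (j + 1 : ℕ)

lemma powerSums_eq_sum (k : ℕ) {ι : Type*} [Fintype ι] (x : ι → ℤ) :
    powerSums k x = ∑ i, momentCurve k (x i) := by
  funext j
  simp [powerSums, momentCurve]

lemma expSum_piFinset {N : ℕ} [NeZero N] {k s : ℕ} (t : Fin s → Finset ℤ) (α : Fin k → ZMod N) :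
    expSum N (Fintype.piFinset t) (powerSums k) α = ∏ i, expSum N (t i) (momentCurve k) α := by
  simp only [expSum]
  rw [Finset.prod_univ_sum]
  apply Finset.sum_congr rfl
  intro x _
  rw [powerSums_eq_sum, chr_sum]

/-- `s`-tuples with entries in `A`. -/
def tuples (s : ℕ) (A : Finset ℤ) : Finset (Fin s → ℤ) := Fintype.piFinset fun _ => A

lemma expSum_tuples {N : ℕ} [NeZero N] {k s : ℕ} (A : Finset ℤ) (α : Fin k → ZMod N) :
    expSum N (tuples s A) (powerSums k) α = expSum N A (momentCurve k) α ^ s := by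
  rw [tuples, expSum_piFinset]
  simp

lemma card_tuples (s : ℕ) (A : Finset ℤ) : (tuples s A).card = A.card ^ s := by
  simp [tuples]

open Classical in
/-- The number of solutions of the Vinogradov system of degree `k` in `2 s` variables from `A`. -/
noncomputable def vino (k s : ℕ) (A : Finset ℤ) : ℕ :=
  ((tuples s A ×ˢ tuples s A).filter (fun xy => powerSums k xy.1 = powerSums k xy.2)).card

lemma vino_le (k s : ℕ) (A : Finset ℤ) : vino k s A ≤ A.card ^ (2 * s) := by
  classical
  calc vino k s A ≤ (tuples s A ×ˢ tuples s A).card := Finset.card_filter_le _ _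
    _ = A.card ^ (2 * s) := by rw [Finset.card_product, card_tuples]; ring

lemma sum_norm_pow_eq_vino {k s B N : ℕ} [NeZero N] {A : Finset ℤ} (hN : 2 * B < N)
    (hB : ∀ x ∈ tuples s A, ∀ j, |powerSums k x j| ≤ B) :
    ∑ α, ‖expSum N A (momentCurve k) α‖ ^ (2 * s) = (N : ℝ) ^ k * vino k s A := by
  have h := sum_expSum_sq (tuples s A) (powerSums k) hN hB
  simp only [expSum_tuples, norm_pow, ← pow_mul] at h
  rw [mul_comm s 2] at h
  unfold vino
  convert h

lemma tuples_mono {s : ℕ} {A B : Finset ℤ} (h : A ⊆ B) : tuples s A ⊆ tuples s B :=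
  Fintype.piFinset_subset _ _ fun _ => h

lemma powerSums_translate {k : ℕ} {ι : Type*} [Fintype ι] {x y : ι → ℤ}
    (h : powerSums k x = powerSums k y) (a : ℤ) :
    powerSums k (fun i => x i - a) = powerSums k (fun i => y i - a) := by
  funext j
  simp only [powerSums, sub_eq_add_neg, add_pow]
  rw [Finset.sum_comm, Finset.sum_comm (s := Finset.univ (α := ι))]
  apply Finset.sum_congr rfl
  intro l hl
  rw [← Finset.sum_mul, ← Finset.sum_mul, ← Finset.sum_mul, ← Finset.sum_mul]
  congr 2
  rcases Nat.eq_zero_or_pos l with rfl | hpos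
  · simp
  · rw [Finset.mem_range] at hl
    have := congrFun h ⟨l - 1, by omega⟩
    simp only [powerSums] at this
    rwa [Nat.sub_add_cancel (by omega)] at this

lemma powerSums_elim {k m n : ℕ} (x : Fin m → ℤ) (u : Fin n → ℤ) :
    powerSums k (Sum.elim x u) = powerSums k x + powerSums k u := by
  funext j
  simp [powerSums]

/-- The elements of `[0, X)` in a residue class. -/
noncomputable def residueClass (X p a : ℕ) : Finset ℤ :=
  (Finset.Ico (0 : ℤ) X).filter (fun x => x % (p : ℤ) = a)

lemma vino_residueClass_le {k s X p a Y : ℕ} (hp : 0 < p) (hY : X ≤ p * Y) :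
    vino k s (residueClass X p a) ≤ vino k s (Finset.Ico (0 : ℤ) Y) := by
  classical
  have hp' : (0 : ℤ) < p := by exact_mod_cast hp
  have hmem : ∀ x ∈ tuples s (residueClass X p a), ∀ i, 0 ≤ x i ∧ x i < X ∧ x i % p = a := by
    intro x hx i
    simp only [tuples, Fintype.mem_piFinset, residueClass, Finset.mem_filter, Finset.mem_Ico] at hx
    exact ⟨(hx i).1.1, (hx i).1.2, (hx i).2⟩
  have hdiv : ∀ x ∈ tuples s (residueClass X p a), ∀ i, x i - a = p * (x i / p) := by
    intro x hx i
    have := (hmem x hx i).2.2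
    have h2 := Int.mul_ediv_add_emod (x i) p
    linarith
  have hin : ∀ x ∈ tuples s (residueClass X p a), (fun i => x i / (p : ℤ)) ∈
      tuples s (Finset.Ico (0 : ℤ) Y) := by
    intro x hx
    simp only [tuples, Fintype.mem_piFinset, Finset.mem_Ico]
    intro i
    refine ⟨Int.ediv_nonneg (hmem x hx i).1 hp'.le, ?_⟩
    apply Int.ediv_lt_of_lt_mul hp'
    have h1 := (hmem x hx i).2.1
    have h2 : (X : ℤ) ≤ p * Y := by exact_mod_cast hY
    linarith
  apply Finset.card_le_card_of_injOn
    (fun xy => (fun i => xy.1 i / (p : ℤ), fun i => xy.2 i / (p : ℤ)))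
  · rintro ⟨x, y⟩ hxy
    simp only [Finset.coe_filter, Finset.mem_product, Set.mem_ofPred_eq] at hxy ⊢
    refine ⟨⟨hin x hxy.1.1, hin y hxy.1.2⟩, ?_⟩
    have h1 := powerSums_translate hxy.2 a
    funext j
    have h2 := congrFun h1 j
    simp only [powerSums, hdiv x hxy.1.1, hdiv y hxy.1.2, mul_pow, ← Finset.mul_sum] at h2
    exact mul_left_cancel₀ (pow_ne_zero _ hp'.ne') h2
  · rintro ⟨x, y⟩ hxy ⟨x', y'⟩ hxy' heq
    simp only [Finset.coe_filter, Finset.mem_product, Set.mem_ofPred_eq] at hxy hxy'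
    simp only [Prod.mk.injEq] at heq ⊢
    constructor
    · funext i
      have h1 := hdiv x hxy.1.1 i
      have h2 := hdiv x' hxy'.1.1 i
      have h3 := congrFun heq.1 i
      rw [h3] at h1
      linarith
    · funext i
      have h1 := hdiv y hxy.1.2 i
      have h2 := hdiv y' hxy'.1.2 i
      have h3 := congrFun heq.2 i
      rw [h3] at h1
      linarith

open Classical in
/-- Tuples whose entries are distinct modulo `p`. -/
noncomputable def distinctTuples (k p : ℕ) (A : Finset ℤ) : Finset (Fin k → ℤ) :=
  (tuples k A).filter (fun x => ∀ i i', i < i' → ¬ (p : ℤ) ∣ x i - x i')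

open Classical in
lemma card_distinct_system_le {k m X p a Y : ℕ} (hp : p.Prime) (hk : k < p) (hX : X ≤ p ^ k)
    (hY : X ≤ p * Y) :
    (((distinctTuples k p (Finset.Ico (0 : ℤ) X) ×ˢ tuples m (residueClass X p a)) ×ˢ
      (distinctTuples k p (Finset.Ico (0 : ℤ) X) ×ˢ tuples m (residueClass X p a))).filter
      (fun z => powerSums k z.1.1 + powerSums k z.1.2 = powerSums k z.2.1 + powerSums k z.2.2)).card
    ≤ vino k m (Finset.Ico (0 : ℤ) Y) * (k ^ k * p ^ (k * (k - 1) / 2) * X ^ k) := by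
  set D := distinctTuples k p (Finset.Ico (0 : ℤ) X) with hD
  set U := tuples m (residueClass X p a) with hU
  let T : Finset ((Fin k → ℤ) × (Fin k → ℤ)) := (D ×ˢ D).filter (fun xy =>
    ∀ j : Fin k, (p : ℤ) ^ (j + 1 : ℕ) ∣
      powerSums k (fun i => xy.1 i - (a : ℤ)) j - powerSums k (fun i => xy.2 i - (a : ℤ)) j)
  have hDmem : ∀ x ∈ D, (∀ i, 0 ≤ x i ∧ x i < X) ∧ ∀ i i', i ≠ i' → ¬ (p : ℤ) ∣ x i - x i' := by
    intro x hx
    rw [hD, distinctTuples, Finset.mem_filter, tuples, Fintype.mem_piFinset] at hx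
    refine ⟨fun i => Finset.mem_Ico.1 (hx.1 i), fun i i' hii => ?_⟩
    rcases lt_or_gt_of_ne hii with h | h
    · exact hx.2 i i' h
    · rw [dvd_sub_comm]
      exact hx.2 i' i h
  have hT : T.card ≤ k ^ k * p ^ (k * (k - 1) / 2) * X ^ k := by
    have h1 : T.card ≤ k ^ k * p ^ (k * (k - 1) / 2) * D.card := by
      apply Finset.card_le_mul_card_image_of_maps_to (f := Prod.snd)
      · intro xy hxy
        exact (Finset.mem_product.1 (Finset.mem_filter.1 hxy).1).2
      · intro y hy
        have hinj : Set.InjOn (fun xy : (Fin k → ℤ) × (Fin k → ℤ) => fun i => xy.1 i - (a : ℤ))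
            (T.filter (fun xy => xy.2 = y)) := by
          rintro ⟨x, z⟩ hx ⟨x', z'⟩ hx' h
          simp only [Finset.coe_filter, Set.mem_ofPred_eq] at hx hx'
          rw [Prod.mk.injEq]
          refine ⟨?_, hx.2.trans hx'.2.symm⟩
          funext i
          have := congrFun h i
          simpa using this
        rw [← Finset.card_image_of_injOn hinj]
        apply card_le_of_powerSums_modEq hp hk hX (b := -(a : ℤ))
          (c := powerSums k (fun i => y i - (a : ℤ)))
        · intro x hx i
          rw [Finset.mem_image] at hx
          obtain ⟨⟨x', z⟩, hx', rfl⟩ := hx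
          have := (hDmem x' (Finset.mem_product.1
            (Finset.mem_filter.1 (Finset.mem_filter.1 hx').1).1).1).1 i
          constructor <;> simp only <;> linarith
        · intro x hx i i' hii
          rw [Finset.mem_image] at hx
          obtain ⟨⟨x', z⟩, hx', rfl⟩ := hx
          have := (hDmem x' (Finset.mem_product.1
            (Finset.mem_filter.1 (Finset.mem_filter.1 hx').1).1).1).2 i i' hii
          simpa using this
        · intro x hx j
          rw [Finset.mem_image] at hx
          obtain ⟨⟨x', z⟩, hx', rfl⟩ := hx
          rw [Finset.mem_filter] at hx'
          have h3 := (Finset.mem_filter.1 hx'.1).2 j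
          have h4 : z = y := hx'.2
          subst h4
          exact h3
    refine h1.trans (Nat.mul_le_mul_left _ ?_)
    calc D.card ≤ (tuples k (Finset.Ico (0 : ℤ) X)).card := Finset.card_filter_le _ _
      _ = X ^ k := by rw [card_tuples]; simp
  refine le_trans ?_ (Nat.mul_le_mul_left _ hT)
  apply Finset.card_le_mul_card_image_of_maps_to (f := fun z => (z.1.1, z.2.1))
  · rintro ⟨⟨x, u⟩, ⟨y, v⟩⟩ hz
    simp only [Finset.mem_filter, Finset.mem_product] at hz
    simp only [T, Finset.mem_filter, Finset.mem_product]
    refine ⟨⟨hz.1.1.1, hz.1.2.1⟩, fun j => ?_⟩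
    have h1 := hz.2
    rw [← powerSums_elim, ← powerSums_elim] at h1
    have h2 := congrFun (powerSums_translate h1 a) j
    have h3 : ∀ u ∈ U, (p : ℤ) ^ (j + 1 : ℕ) ∣ powerSums k (fun i => u i - (a : ℤ)) j := by
      intro u hu
      apply Finset.dvd_sum
      intro i _
      apply pow_dvd_pow_of_dvd
      rw [hU, tuples, Fintype.mem_piFinset] at hu
      have := (Finset.mem_filter.1 (hu i)).2
      rw [← this]
      exact Int.dvd_self_sub_emod
    have h4 : ∀ (x : Fin k → ℤ) (u : Fin m → ℤ), powerSums k (fun i => Sum.elim x u i - (a : ℤ)) j =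
        powerSums k (fun i => x i - (a : ℤ)) j + powerSums k (fun i => u i - (a : ℤ)) j := by
      intro x u
      simp [powerSums]
    rw [h4, h4] at h2
    have h5 := dvd_sub (h3 v hz.1.2.2) (h3 u hz.1.1.2)
    have h6 : powerSums k (fun i => x i - (a : ℤ)) j - powerSums k (fun i => y i - (a : ℤ)) j =
        powerSums k (fun i => v i - (a : ℤ)) j - powerSums k (fun i => u i - (a : ℤ)) j := by
      linarith
    exact h6 ▸ h5
  · rintro ⟨x, y⟩ _
    refine le_trans ?_ ((card_shift_le U (powerSums k) (powerSums k y - powerSums k x)).trans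
      (vino_residueClass_le (k := k) (s := m) (a := a) hp.pos hY))
    apply Finset.card_le_card_of_injOn (fun z => (z.1.2, z.2.2))
    · rintro ⟨⟨x', u⟩, ⟨y', v⟩⟩ hz
      simp only [Finset.coe_filter, Finset.mem_filter, Finset.mem_product, Set.mem_ofPred_eq,
        Prod.mk.injEq] at hz ⊢
      obtain ⟨⟨⟨⟨h1, h2⟩, h3, h4⟩, h5⟩, rfl, rfl⟩ := hz
      refine ⟨⟨h2, h4⟩, ?_⟩
      funext j
      have := congrFun h5 j
      simp only [Pi.add_apply, Pi.sub_apply] at this ⊢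
      linarith
    · rintro ⟨⟨x', u⟩, ⟨y', v⟩⟩ hz ⟨⟨x'', u'⟩, ⟨y'', v'⟩⟩ hz' h
      simp only [Finset.coe_filter, Finset.mem_filter, Set.mem_ofPred_eq, Prod.mk.injEq] at hz hz' h ⊢
      exact ⟨⟨hz.2.1.trans hz'.2.1.symm, h.1⟩, hz.2.2.trans hz'.2.2.symm, h.2⟩

lemma residueClass_subset (X p a : ℕ) : residueClass X p a ⊆ Finset.Ico (0 : ℤ) X :=
  Finset.filter_subset _ _

lemma expSum_eq_sum_residueClass {N : ℕ} [NeZero N] {k X p : ℕ} (hp : 0 < p)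
    (α : Fin k → ZMod N) :
    expSum N (Finset.Ico (0 : ℤ) X) (momentCurve k) α =
      ∑ a ∈ Finset.range p, expSum N (residueClass X p a) (momentCurve k) α := by
  have hp' : (0 : ℤ) < p := by exact_mod_cast hp
  simp only [expSum]
  rw [← Finset.sum_fiberwise_of_maps_to (g := fun x : ℤ => (x % (p : ℤ)).toNat)
    (t := Finset.range p)]
  · apply Finset.sum_congr rfl
    intro a _
    apply Finset.sum_congr _ fun _ _ => rfl
    ext x
    simp only [residueClass, Finset.mem_filter]
    have := Int.emod_nonneg x hp'.ne'
    constructor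
    · rintro ⟨h1, h2⟩
      exact ⟨h1, by omega⟩
    · rintro ⟨h1, h2⟩
      exact ⟨h1, by omega⟩
  · intro x _
    have h1 := Int.emod_nonneg x hp'.ne'
    have h2 := Int.emod_lt_of_pos x hp'
    rw [Finset.mem_range]
    omega

open Classical in
/-- Tuples whose entries of index `i` and `i'` are congruent modulo `p`. -/
noncomputable def congrTuples (k p : ℕ) (A : Finset ℤ) (i i' : Fin k) : Finset (Fin k → ℤ) :=
  (tuples k A).filter (fun x => (p : ℤ) ∣ x i - x i')

lemma norm_expSum_congrTuples_le {N : ℕ} [NeZero N] {k X p : ℕ} (hp : 0 < p) {i i' : Fin k}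
    (hii : i < i') (α : Fin k → ZMod N) :
    ‖expSum N (congrTuples k p (Finset.Ico (0 : ℤ) X) i i') (powerSums k) α‖ ≤
      (∑ a ∈ Finset.range p, ‖expSum N (residueClass X p a) (momentCurve k) α‖ ^ 2) *
        ‖expSum N (Finset.Ico (0 : ℤ) X) (momentCurve k) α‖ ^ (k - 2) := by
  classical
  have hp' : (0 : ℤ) < p := by exact_mod_cast hp
  let t : ℕ → Fin k → Finset ℤ := fun a l =>
    if l = i ∨ l = i' then residueClass X p a else Finset.Ico (0 : ℤ) X
  have h1 : expSum N (congrTuples k p (Finset.Ico (0 : ℤ) X) i i') (powerSums k) α =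
      ∑ a ∈ Finset.range p, expSum N (Fintype.piFinset (t a)) (powerSums k) α := by
    simp only [expSum]
    rw [← Finset.sum_fiberwise_of_maps_to (g := fun x : Fin k → ℤ => (x i % (p : ℤ)).toNat)
      (t := Finset.range p)]
    · apply Finset.sum_congr rfl
      intro a _
      apply Finset.sum_congr _ fun _ _ => rfl
      ext x
      simp only [congrTuples, tuples, Finset.mem_filter, Fintype.mem_piFinset, t]
      have hx := Int.emod_nonneg (x i) hp'.ne'
      constructor
      · rintro ⟨⟨h1, h2⟩, h3⟩ l
        have h4 : x i % p = a := by omega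
        have h5 : x i' % p = x i % p := Int.modEq_iff_dvd.2 h2
        split_ifs with hl
        · rw [residueClass, Finset.mem_filter]
          rcases hl with rfl | rfl
          · exact ⟨h1 _, h4⟩
          · exact ⟨h1 _, h5.trans h4⟩
        · exact h1 l
      · intro h
        have h1 := h i
        have h2 := h i'
        simp only [true_or, or_true, if_true, residueClass, Finset.mem_filter] at h1 h2
        refine ⟨⟨fun l => ?_, ?_⟩, by omega⟩
        · have := h l
          split_ifs at this
          · exact residueClass_subset _ _ _ this
          · exact this
        · exact Int.modEq_iff_dvd.1 (h2.2.trans h1.2.symm)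
    · intro x _
      have h1 := Int.emod_nonneg (x i) hp'.ne'
      have h2 := Int.emod_lt_of_pos (x i) hp'
      rw [Finset.mem_range]
      omega
  rw [h1, Finset.sum_mul]
  apply (norm_sum_le _ _).trans (Finset.sum_le_sum fun a _ => ?_)
  rw [expSum_piFinset, norm_prod]
  have h2 : ∀ l, ‖expSum N (t a l) (momentCurve k) α‖ = if l = i ∨ l = i' then
      ‖expSum N (residueClass X p a) (momentCurve k) α‖ else
      ‖expSum N (Finset.Ico (0 : ℤ) X) (momentCurve k) α‖ := by
    intro l
    simp only [t]
    split_ifs <;> rfl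
  simp only [h2]
  rw [Finset.prod_ite, Finset.prod_const, Finset.prod_const]
  have h3 : (Finset.univ.filter (fun l => l = i ∨ l = i')).card = 2 := by
    have : Finset.univ.filter (fun l => l = i ∨ l = i') = {i, i'} := by
      ext l
      simp
    rw [this, Finset.card_pair hii.ne]
  have h4 := Finset.card_filter_add_card_filter_not (s := (Finset.univ : Finset (Fin k)))
    (fun l => l = i ∨ l = i')
  rw [h3, Finset.card_univ, Fintype.card_fin] at h4
  rw [h3]
  have h5 : (Finset.univ.filter (fun l => ¬ (l = i ∨ l = i'))).card = k - 2 := by omega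
  rw [h5]

lemma mul_pow_le_add_pow {a b : ℝ} (ha : 0 ≤ a) (hb : 0 ≤ b) (n : ℕ) :
    a * b ^ n ≤ a ^ (n + 1) + b ^ (n + 1) := by
  rcases le_total a b with h | h
  · calc a * b ^ n ≤ b * b ^ n := by gcongr
      _ = b ^ (n + 1) := by ring
      _ ≤ _ := by linarith [pow_nonneg ha (n + 1)]
  · calc a * b ^ n ≤ a * a ^ n := by gcongr
      _ = a ^ (n + 1) := by ring
      _ ≤ _ := by linarith [pow_nonneg hb (n + 1)]

open Classical in
lemma card_system_le_add {k m p : ℕ} (A : Finset ℤ) :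
    (((tuples k A ×ˢ tuples m A) ×ˢ tuples (k + m) A).filter
      (fun z => powerSums k z.1.1 + powerSums k z.1.2 = powerSums k z.2)).card ≤
    (((distinctTuples k p A ×ˢ tuples m A) ×ˢ tuples (k + m) A).filter
      (fun z => powerSums k z.1.1 + powerSums k z.1.2 = powerSums k z.2)).card +
    ∑ ii ∈ Finset.univ.filter (fun ii : Fin k × Fin k => ii.1 < ii.2),
      (((congrTuples k p A ii.1 ii.2 ×ˢ tuples m A) ×ˢ tuples (k + m) A).filter
      (fun z => powerSums k z.1.1 + powerSums k z.1.2 = powerSums k z.2)).card := by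
  refine le_trans (Finset.card_le_card ?_) ((Finset.card_union_le _ _).trans
    (Nat.add_le_add_left Finset.card_biUnion_le _))
  rintro ⟨⟨x, u⟩, y⟩ hz
  simp only [Finset.mem_filter, Finset.mem_product] at hz
  simp only [Finset.mem_union, Finset.mem_biUnion, Finset.mem_filter, Finset.mem_product,
    distinctTuples, congrTuples, Finset.mem_univ, true_and]
  by_cases h : ∀ i i', i < i' → ¬ (p : ℤ) ∣ x i - x i'
  · exact Or.inl ⟨⟨⟨⟨hz.1.1.1, h⟩, hz.1.1.2⟩, hz.1.2⟩, hz.2⟩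
  · push Not at h
    obtain ⟨i, i', hii, hd⟩ := h
    exact Or.inr ⟨(i, i'), hii, ⟨⟨⟨hz.1.1.1, hd⟩, hz.1.1.2⟩, hz.1.2⟩, hz.2⟩

lemma vino_le_add_sum {N : ℕ} [NeZero N] {k m p X B : ℕ} (hp : 0 < p) (hN : 2 * B < N)
    (h1 : ∀ z ∈ tuples k (Finset.Ico (0 : ℤ) X) ×ˢ tuples m (Finset.Ico (0 : ℤ) X), ∀ j,
      |(powerSums k z.1 + powerSums k z.2) j| ≤ B)
    (h2 : ∀ x ∈ tuples (k + m) (Finset.Ico (0 : ℤ) X), ∀ j, |powerSums k x j| ≤ B) :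
    (N : ℝ) ^ k * vino k (k + m) (Finset.Ico (0 : ℤ) X) ≤
      ∑ α : Fin k → ZMod N,
        (‖expSum N (distinctTuples k p (Finset.Ico (0 : ℤ) X)) (powerSums k) α‖ *
            ‖expSum N (Finset.Ico (0 : ℤ) X) (momentCurve k) α‖ ^ m *
            ‖expSum N (Finset.Ico (0 : ℤ) X) (momentCurve k) α‖ ^ (k + m) +
          (k : ℝ) ^ 2 * (∑ a ∈ Finset.range p,
            ‖expSum N (residueClass X p a) (momentCurve k) α‖ ^ 2) *
            (‖expSum N (Finset.Ico (0 : ℤ) X) (momentCurve k) α‖ ^ 2) ^ (k + m - 1)) := by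
  classical
  set A := Finset.Ico (0 : ℤ) X with hA
  set F : (Fin k → ZMod N) → ℂ := fun α => expSum N A (momentCurve k) α with hF
  have e1 : (N : ℝ) ^ k * vino k (k + m) A = (N : ℝ) ^ k *
      (((tuples k A ×ˢ tuples m A) ×ˢ tuples (k + m) A).filter
      (fun z => powerSums k z.1.1 + powerSums k z.1.2 = powerSums k z.2)).card := by
    have h3 := sum_norm_pow_eq_vino hN h2
    have h4 := sum_expSum_mul_star (tuples k A ×ˢ tuples m A) (tuples (k + m) A)
      (fun z => powerSums k z.1 + powerSums k z.2) (powerSums k) hN h1 h2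
    simp only [expSum_add, expSum_tuples, ← pow_add, Complex.mul_conj,
      Complex.normSq_eq_norm_sq, norm_pow, ← pow_mul, mul_comm (k + m) 2] at h4
    rw [← h3]
    exact_mod_cast h4
  have hle : ∀ S ⊆ tuples k A, (N : ℝ) ^ k *
      (((S ×ˢ tuples m A) ×ˢ tuples (k + m) A).filter
      (fun z => powerSums k z.1.1 + powerSums k z.1.2 = powerSums k z.2)).card ≤
      ∑ α, ‖expSum N S (powerSums k) α‖ * ‖F α‖ ^ m * ‖F α‖ ^ (k + m) := by
    intro S hS
    have h3 := card_le_sum_norm (S ×ˢ tuples m A) (tuples (k + m) A)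
      (fun z => powerSums k z.1 + powerSums k z.2) (powerSums k) hN
      (fun z hz => h1 z (Finset.product_subset_product_left hS hz)) h2
    simpa only [expSum_add, expSum_tuples, norm_mul, norm_pow] using h3
  rw [e1]
  have h3 : ((((tuples k A ×ˢ tuples m A) ×ˢ tuples (k + m) A).filter
      (fun z => powerSums k z.1.1 + powerSums k z.1.2 = powerSums k z.2)).card : ℝ) ≤ _ :=
    Nat.cast_le.2 (card_system_le_add (p := p) A)
  push_cast at h3
  refine (mul_le_mul_of_nonneg_left h3 (by positivity)).trans ?_
  rw [mul_add, Finset.sum_add_distrib]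
  refine add_le_add (hle _ (Finset.filter_subset _ _)) ?_
  rw [Finset.mul_sum]
  have hpair : ∀ ii ∈ Finset.univ.filter (fun ii : Fin k × Fin k => ii.1 < ii.2),
      (N : ℝ) ^ k * (((congrTuples k p A ii.1 ii.2 ×ˢ tuples m A) ×ˢ tuples (k + m) A).filter
      (fun z => powerSums k z.1.1 + powerSums k z.1.2 = powerSums k z.2)).card ≤
      ∑ α, (∑ a ∈ Finset.range p, ‖expSum N (residueClass X p a) (momentCurve k) α‖ ^ 2) *
        (‖F α‖ ^ 2) ^ (k + m - 1) := by
    rintro ⟨i, i'⟩ hii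
    simp only [Finset.mem_filter, Finset.mem_univ, true_and] at hii
    refine (hle _ (Finset.filter_subset _ _)).trans (Finset.sum_le_sum fun α _ => ?_)
    have h5 : (‖F α‖ ^ 2) ^ (k + m - 1) = ‖F α‖ ^ (k - 2) * ‖F α‖ ^ m * ‖F α‖ ^ (k + m) := by
      rw [← pow_mul, ← pow_add, ← pow_add]
      congr 1
      have := i'.2
      have : i.1 < i'.1 := hii
      omega
    rw [h5, ← mul_assoc, ← mul_assoc]
    gcongr
    exact norm_expSum_congrTuples_le hp hii α
  refine (Finset.sum_le_sum hpair).trans ?_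
  rw [Finset.sum_const, nsmul_eq_mul, Finset.mul_sum]
  apply Finset.sum_le_sum fun α _ => ?_
  rw [← mul_assoc]
  gcongr
  calc ((Finset.univ.filter (fun ii : Fin k × Fin k => ii.1 < ii.2)).card : ℝ)
      ≤ ((Finset.univ : Finset (Fin k × Fin k)).card : ℝ) :=
        Nat.cast_le.2 (Finset.card_filter_le _ _)
    _ = (k : ℝ) ^ 2 := by simp [pow_two]

lemma holder_pointwise {k m p : ℕ} (hm : 1 ≤ m) {g F : ℝ} {f : ℕ → ℝ} (hF0 : 0 ≤ F)
    (hf : ∀ a, 0 ≤ f a) (hF : F ≤ ∑ a ∈ Finset.range p, f a) :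
    g * F ^ m * F ^ (k + m) +
      (k : ℝ) ^ 2 * (∑ a ∈ Finset.range p, f a ^ 2) * (F ^ 2) ^ (k + m - 1) ≤
      (p : ℝ) ^ (2 * m - 1) * ∑ a ∈ Finset.range p, g ^ 2 * f a ^ (2 * m) +
      1 / 2 * (F ^ 2) ^ (k + m) + 1 / 4 * (4 * (k : ℝ) ^ 2) ^ (k + m) *
      ((p : ℝ) ^ (k + m - 1) * ∑ a ∈ Finset.range p, f a ^ (2 * (k + m))) := by
  have e1 : g * F ^ m * F ^ (k + m) ≤
      (g * F ^ m) ^ 2 + 1 / 4 * (F ^ (k + m)) ^ 2 := by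
    nlinarith [sq_nonneg (g * F ^ m - 1 / 2 * F ^ (k + m))]
  have e2 : (g * F ^ m) ^ 2 ≤
      (p : ℝ) ^ (2 * m - 1) * ∑ a ∈ Finset.range p, g ^ 2 * f a ^ (2 * m) := by
    have h3 := pow_sum_le_card_mul_sum_pow (s := Finset.range p) (f := f)
      (fun _ _ => hf _) (2 * m - 1)
    rw [Nat.sub_add_cancel (by omega), Finset.card_range] at h3
    have h4 : F ^ (2 * m) ≤ _ := (pow_le_pow_left₀ hF0 hF _).trans h3
    calc (g * F ^ m) ^ 2 = g ^ 2 * F ^ (2 * m) := by ring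
      _ ≤ g ^ 2 * _ := mul_le_mul_of_nonneg_left h4 (by positivity)
      _ = _ := by rw [← Finset.mul_sum]; ring
  have e3 : 4 * (k : ℝ) ^ 2 * (∑ a ∈ Finset.range p, f a ^ 2) * (F ^ 2) ^ (k + m - 1) ≤
      (4 * (k : ℝ) ^ 2 * (∑ a ∈ Finset.range p, f a ^ 2)) ^ (k + m) +
      (F ^ 2) ^ (k + m) := by
    have := mul_pow_le_add_pow (a := 4 * (k : ℝ) ^ 2 * (∑ a ∈ Finset.range p, f a ^ 2))
      (b := F ^ 2) (by positivity) (by positivity) (k + m - 1)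
    rwa [Nat.sub_add_cancel (by omega)] at this
  have e4 : (∑ a ∈ Finset.range p, f a ^ 2) ^ (k + m) ≤
      (p : ℝ) ^ (k + m - 1) * ∑ a ∈ Finset.range p, f a ^ (2 * (k + m)) := by
    have h3 := pow_sum_le_card_mul_sum_pow (s := Finset.range p) (f := fun a => f a ^ 2)
      (fun _ _ => sq_nonneg _) (k + m - 1)
    rw [Nat.sub_add_cancel (by omega), Finset.card_range] at h3
    simpa only [← pow_mul] using h3
  rw [mul_pow] at e3
  have e5 := mul_le_mul_of_nonneg_left e4 (show (0 : ℝ) ≤ (4 * (k : ℝ) ^ 2) ^ (k + m) by positivity)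
  have e6 : (F ^ (k + m)) ^ 2 = (F ^ 2) ^ (k + m) := by ring
  rw [e6] at e1
  linarith

/-- The recursive inequality of the `p`-adic form of Vinogradov's method. -/
lemma vino_step {k m p X Y : ℕ} (hm : 1 ≤ m) (hp : p.Prime) (hk : k < p) (hX : X ≤ p ^ k)
    (hY : X ≤ p * Y) :
    (vino k (k + m) (Finset.Ico (0 : ℤ) X) : ℝ) ≤
      2 * (p : ℝ) ^ (2 * m) * (X : ℝ) ^ k * (k : ℝ) ^ k * (p : ℝ) ^ (k * (k - 1) / 2) *
        vino k m (Finset.Ico (0 : ℤ) Y) +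
      (4 * (k : ℝ) ^ 2 * p) ^ (k + m) * vino k (k + m) (Finset.Ico (0 : ℤ) Y) := by
  classical
  set A := Finset.Ico (0 : ℤ) X with hA
  obtain ⟨B₁, hB₁⟩ := exists_bound (tuples k A ×ˢ tuples m A)
    (fun z => powerSums k z.1 + powerSums k z.2)
  obtain ⟨B₂, hB₂⟩ := exists_bound (tuples (k + m) A) (powerSums k)
  set B := B₁ + B₂ with hB
  set N := 2 * B + 1 with hN
  have : NeZero N := ⟨by omega⟩
  have hNB : 2 * B < N := by omega
  have h1 : ∀ z ∈ tuples k A ×ˢ tuples m A, ∀ j, |(powerSums k z.1 + powerSums k z.2) j| ≤ B :=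
    fun z hz j => (hB₁ z hz j).trans (by push_cast [hB]; omega)
  have h2 : ∀ x ∈ tuples (k + m) A, ∀ j, |powerSums k x j| ≤ B :=
    fun z hz j => (hB₂ z hz j).trans (by push_cast [hB]; omega)
  have hmain := vino_le_add_sum (p := p) hp.pos hNB h1 h2
  set F : (Fin k → ZMod N) → ℂ := fun α => expSum N A (momentCurve k) α with hF
  set G : (Fin k → ZMod N) → ℂ := fun α => expSum N (distinctTuples k p A) (powerSums k) α with hG
  set f : ℕ → (Fin k → ZMod N) → ℂ := fun a α => expSum N (residueClass X p a) (momentCurve k) α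
    with hf
  set J : ℝ := (vino k (k + m) A : ℝ) with hJ
  have hpR : (0 : ℝ) < p := by exact_mod_cast hp.pos
  have hFf : ∀ α, ‖F α‖ ≤ ∑ a ∈ Finset.range p, ‖f a α‖ := by
    intro α
    simp only [hF, hA, expSum_eq_sum_residueClass hp.pos]
    exact norm_sum_le _ _
  have hmoment : ∑ α, (‖F α‖ ^ 2) ^ (k + m) = (N : ℝ) ^ k * J := by
    rw [hJ, ← sum_norm_pow_eq_vino hNB h2]
    simp only [pow_mul, hF]
  have hpoint := fun α => holder_pointwise (k := k) (m := m) (p := p) hm (g := ‖G α‖) (F := ‖F α‖)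
    (f := fun a => ‖f a α‖) (norm_nonneg _) (fun _ => norm_nonneg _) (hFf α)
  have hgood : ∀ a ∈ Finset.range p, ∑ α, ‖G α‖ ^ 2 * ‖f a α‖ ^ (2 * m) ≤ (N : ℝ) ^ k *
      (vino k m (Finset.Ico (0 : ℤ) Y) * ((k : ℝ) ^ k * (p : ℝ) ^ (k * (k - 1) / 2) * (X : ℝ) ^ k)) := by
    intro a _
    have h3 := sum_expSum_sq (N := N) (distinctTuples k p A ×ˢ tuples m (residueClass X p a))
      (fun z => powerSums k z.1 + powerSums k z.2) hNB
      (fun z hz => h1 z (Finset.product_subset_product (Finset.filter_subset _ _)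
        (tuples_mono (residueClass_subset _ _ _)) hz))
    simp only [expSum_add, expSum_tuples, norm_mul, norm_pow, mul_pow, ← pow_mul, mul_comm m 2] at h3
    rw [h3]
    gcongr
    exact_mod_cast card_distinct_system_le (m := m) (a := a) hp hk hX hY
  have hbad : ∀ a ∈ Finset.range p, ∑ α, ‖f a α‖ ^ (2 * (k + m)) ≤ (N : ℝ) ^ k *
      vino k (k + m) (Finset.Ico (0 : ℤ) Y) := by
    intro a _
    rw [sum_norm_pow_eq_vino hNB
      (fun x hx => h2 x (tuples_mono (residueClass_subset _ _ _) hx))]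
    gcongr
    exact vino_residueClass_le hp.pos hY
  have s1 : ∑ a ∈ Finset.range p, ∑ α, ‖G α‖ ^ 2 * ‖f a α‖ ^ (2 * m) =
      ∑ α, ∑ a ∈ Finset.range p, ‖G α‖ ^ 2 * ‖f a α‖ ^ (2 * m) := Finset.sum_comm
  have s2 : ∑ a ∈ Finset.range p, ∑ α, ‖f a α‖ ^ (2 * (k + m)) =
      ∑ α, ∑ a ∈ Finset.range p, ‖f a α‖ ^ (2 * (k + m)) := Finset.sum_comm
  have htot := hmain.trans (Finset.sum_le_sum fun α _ => hpoint α)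
  clear_value F G f J
  rw [Finset.sum_add_distrib, Finset.sum_add_distrib, ← Finset.mul_sum, ← Finset.mul_sum,
    ← Finset.mul_sum, ← Finset.mul_sum, hmoment, ← s1, ← s2] at htot
  have hg := Finset.sum_le_sum hgood
  have hb := Finset.sum_le_sum hbad
  rw [Finset.sum_const, Finset.card_range, nsmul_eq_mul] at hg hb
  have hNk : (0 : ℝ) < (N : ℝ) ^ k := by positivity
  have hg' := mul_le_mul_of_nonneg_left hg (show (0 : ℝ) ≤ (p : ℝ) ^ (2 * m - 1) by positivity)
  have hb' := mul_le_mul_of_nonneg_left hb (show (0 : ℝ) ≤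
    1 / 4 * (4 * (k : ℝ) ^ 2) ^ (k + m) * (p : ℝ) ^ (k + m - 1) by positivity)
  have p1 : (p : ℝ) ^ (2 * m) = (p : ℝ) ^ (2 * m - 1) * p := by
    rw [← pow_succ, Nat.sub_add_cancel (by omega)]
  have p2 : (p : ℝ) ^ (k + m) = (p : ℝ) ^ (k + m - 1) * p := by
    rw [← pow_succ, Nat.sub_add_cancel (by omega)]
  rw [mul_pow, p1, p2]
  have hV : (0 : ℝ) ≤ (4 * (k : ℝ) ^ 2) ^ (k + m) * ((p : ℝ) ^ (k + m - 1) * p) *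
    vino k (k + m) (Finset.Ico (0 : ℤ) Y) := by positivity
  apply le_of_mul_le_mul_left _ hNk
  have hV' := mul_nonneg hNk.le hV
  linarith

/-- A prime of size `X ^ (1 / k)`, together with the length of the residue classes modulo it. -/
lemma exists_prime_scale {k M X : ℕ} (hk : 2 ≤ k) (hM : 5 ≤ M) (hX : M ^ k < X) :
    ∃ p Y : ℕ, p.Prime ∧ M < p ∧ X ≤ p ^ k ∧ p ^ k ≤ 4 ^ k * X ∧ X ≤ p * Y ∧ p * Y ≤ 2 * X ∧
      1 ≤ Y ∧ Y < X := by
  have hex : ∃ n, X ≤ n ^ k := ⟨X, Nat.le_self_pow (by omega) X⟩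
  classical
  set n := Nat.find hex with hn
  have hn1 : X ≤ n ^ k := Nat.find_spec hex
  have hMn : M < n := by
    by_contra h
    have := Nat.pow_le_pow_left (not_lt.1 h) k
    omega
  have hn2 : (n - 1) ^ k < X := not_le.1 (Nat.find_min hex (by omega))
  obtain ⟨p, hp, hnp, hp2⟩ := Nat.exists_prime_lt_and_le_two_mul n (by omega)
  have hX0 : 0 < X := by omega
  have hp4 : p ≤ 4 * (n - 1) := by omega
  have hpX : p ≤ X := by
    have h1 : (n - 1) ^ 2 ≤ (n - 1) ^ k := Nat.pow_le_pow_right (by omega) hk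
    have h2 : 4 * (n - 1) ≤ (n - 1) ^ 2 := by rw [pow_two]; gcongr; omega
    omega
  have hY : p * ((X - 1) / p) ≤ X - 1 := Nat.mul_div_le _ _
  refine ⟨p, (X - 1) / p + 1, hp, by omega, hn1.trans (Nat.pow_le_pow_left hnp.le k), ?_, ?_, ?_,
    Nat.le_add_left _ _, ?_⟩
  · calc p ^ k ≤ (4 * (n - 1)) ^ k := Nat.pow_le_pow_left hp4 k
      _ = 4 ^ k * (n - 1) ^ k := mul_pow _ _ _
      _ ≤ 4 ^ k * X := by gcongr
  · have := Nat.lt_mul_div_succ (X - 1) hp.pos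
    omega
  · rw [mul_add]; omega
  · have h3 : 3 * ((X - 1) / p) ≤ p * ((X - 1) / p) := Nat.mul_le_mul_right _ (by omega)
    omega

lemma bad_factor_le {k s p : ℕ} {Δ : ℝ} (hk : 1 ≤ k) (hs : 1 ≤ s) (hp : 1024 * k ^ 4 < p)
    (hΔ' : Δ ≤ s / 2) :
    (4 * (k : ℝ) ^ 2 * p) ^ s * 2 ^ (2 * s) * (p : ℝ) ^ (-(2 * (s : ℝ) - Δ)) ≤ 1 / 2 := by
  have hp0 : (0 : ℝ) < p := by exact_mod_cast (by omega : 0 < p)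
  have hM0 : (1 : ℝ) ≤ ((1024 * k ^ 4 : ℕ) : ℝ) := by
    have := Nat.pow_pos (n := 4) (show 0 < k by omega)
    exact_mod_cast (by omega : 1 ≤ 1024 * k ^ 4)
  have h3 : (p : ℝ) ^ s * (p : ℝ) ^ (-(2 * (s : ℝ) - Δ)) = ((p : ℝ) ^ (s - Δ))⁻¹ := by
    rw [← rpow_neg hp0.le, ← rpow_natCast, ← rpow_add hp0]
    congr 1
    ring
  have h4 : (32 * (k : ℝ) ^ 2) ^ s ≤ (p : ℝ) ^ (s - Δ) := by
    calc (32 * (k : ℝ) ^ 2) ^ s = ((1024 * k ^ 4 : ℕ) : ℝ) ^ ((s : ℝ) / 2) := by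
          rw [show ((1024 * k ^ 4 : ℕ) : ℝ) = (32 * (k : ℝ) ^ 2) ^ (2 : ℝ) by
            rw [rpow_two]; push_cast; ring, ← rpow_mul (by positivity), ← rpow_natCast]
          congr 1
          ring
      _ ≤ ((1024 * k ^ 4 : ℕ) : ℝ) ^ (s - Δ) := rpow_le_rpow_of_exponent_le hM0 (by linarith)
      _ ≤ (p : ℝ) ^ (s - Δ) := rpow_le_rpow (by positivity) (by exact_mod_cast hp.le)
          (by linarith)
  calc (4 * (k : ℝ) ^ 2 * p) ^ s * 2 ^ (2 * s) * (p : ℝ) ^ (-(2 * (s : ℝ) - Δ))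
      = (16 * (k : ℝ) ^ 2) ^ s * ((p : ℝ) ^ s * (p : ℝ) ^ (-(2 * (s : ℝ) - Δ))) := by
        rw [pow_mul, mul_pow _ (p : ℝ), show 16 * (k : ℝ) ^ 2 = 4 * (k : ℝ) ^ 2 * 2 ^ 2 by ring,
          mul_pow _ ((2 : ℝ) ^ 2)]
        ring
    _ = (16 * (k : ℝ) ^ 2) ^ s * ((p : ℝ) ^ (s - Δ))⁻¹ := by rw [h3]
    _ ≤ (16 * (k : ℝ) ^ 2) ^ s * ((32 * (k : ℝ) ^ 2) ^ s)⁻¹ := by gcongr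
    _ = (1 / 2) ^ s := by
        rw [← inv_pow, ← mul_pow]
        congr 1
        field_simp
        norm_num
    _ ≤ 1 / 2 := pow_le_of_le_one (by norm_num) (by norm_num) (by omega)

lemma good_factor_le {k m p X : ℕ} {Δ : ℝ} (hk : 1 ≤ k) (hp : 0 < p) (hX : 0 < X)
    (hpX : p ^ k ≤ 4 ^ k * X) (hΔ0 : 0 ≤ Δ) (hΔ1 : Δ ≤ k * (k + 1) / 2) :
    ((X : ℝ) ^ k * (X : ℝ) ^ (2 * (m : ℝ) - Δ)) * ((p : ℝ) ^ (2 * m) *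
      (p : ℝ) ^ (k * (k - 1) / 2) * (p : ℝ) ^ (-(2 * (m : ℝ) - Δ))) ≤
      4 ^ (k ^ 2) * (X : ℝ) ^ (2 * ((k : ℝ) + m) - (Δ + (k * (k + 1) / 2 - Δ) / k)) := by
  have hp0 : (0 : ℝ) < p := by exact_mod_cast hp
  have hX0 : (0 : ℝ) < X := by exact_mod_cast hX
  have hkR : (1 : ℝ) ≤ k := by exact_mod_cast hk
  have hE0 : 0 ≤ (k : ℝ) * (k - 1) / 2 + Δ := by nlinarith [hkR]
  have hE : (p : ℝ) ^ (2 * m) * (p : ℝ) ^ (k * (k - 1) / 2) * (p : ℝ) ^ (-(2 * (m : ℝ) - Δ)) =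
      (p : ℝ) ^ ((k : ℝ) * (k - 1) / 2 + Δ) := by
    have h5 : ((k * (k - 1) / 2 : ℕ) : ℝ) = (k : ℝ) * (k - 1) / 2 := by
      rw [Nat.cast_div (Nat.even_mul_pred_self k).two_dvd (by norm_num), Nat.cast_mul,
        Nat.cast_sub (by omega)]
      simp
    rw [← rpow_natCast, ← rpow_natCast, ← rpow_add hp0, ← rpow_add hp0, h5]
    congr 1
    push_cast
    ring
  have h6 : (p : ℝ) ^ ((k : ℝ) * (k - 1) / 2 + Δ) ≤ 4 ^ (k ^ 2) *
      (X : ℝ) ^ (((k : ℝ) * (k - 1) / 2 + Δ) / k) := by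
    have h7 : (p : ℝ) ^ k ≤ 4 ^ k * X := by exact_mod_cast hpX
    have h8 : (p : ℝ) ^ ((k : ℝ) * (k - 1) / 2 + Δ) =
        ((p : ℝ) ^ k) ^ (((k : ℝ) * (k - 1) / 2 + Δ) / k) := by
      rw [← rpow_natCast, ← rpow_mul hp0.le]
      congr 1
      field_simp
    rw [h8]
    refine (rpow_le_rpow (by positivity) h7 (by positivity)).trans ?_
    rw [mul_rpow (by positivity) hX0.le]
    gcongr
    rw [← rpow_natCast, ← rpow_natCast, ← rpow_mul (by norm_num)]
    refine rpow_le_rpow_of_exponent_le (by norm_num) ?_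
    push_cast
    have : (k : ℝ) * (((k : ℝ) * (k - 1) / 2 + Δ) / k) = (k : ℝ) * (k - 1) / 2 + Δ := by
      field_simp
    rw [this]
    nlinarith [hkR]
  have h9 : (X : ℝ) ^ k * (X : ℝ) ^ (2 * (m : ℝ) - Δ) *
      (X : ℝ) ^ (((k : ℝ) * (k - 1) / 2 + Δ) / k) = (X : ℝ) ^ (2 * ((k : ℝ) + m) - (Δ + (k * (k + 1) / 2 - Δ) / k)) := by
    rw [← rpow_natCast, ← rpow_add hX0, ← rpow_add hX0]
    congr 1
    field_simp
    ring
  rw [← h9, hE, mul_comm ((4 : ℝ) ^ _), mul_assoc _ _ ((4 : ℝ) ^ _), mul_comm _ ((4 : ℝ) ^ _)]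
  gcongr

lemma vino_bound_step {k m : ℕ} (hk : 2 ≤ k) (hm1 : 2 * k ^ 2 ≤ m) (hm2 : m ≤ 10 * k ^ 2)
    {Δ C : ℝ} (hΔ0 : 0 ≤ Δ) (hΔ1 : Δ ≤ k * (k + 1) / 2)
    (hC : ((1024 * k ^ 4 : ℕ) : ℝ) ^ k ^ 3 ≤ C)
    (h : ∀ X : ℕ, 1 ≤ X → (vino k m (Finset.Ico (0 : ℤ) X) : ℝ) ≤ C * (X : ℝ) ^ (2 * m - Δ))
    {X : ℕ} (hX : 1 ≤ X) :
    (vino k (k + m) (Finset.Ico (0 : ℤ) X) : ℝ) ≤ C * (4 * (k : ℝ) ^ k * 2 ^ (22 * k ^ 2)) *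
      (X : ℝ) ^ (2 * ((k + m : ℕ) : ℝ) - (Δ + (k * (k + 1) / 2 - Δ) / k)) := by
  set M : ℕ := 1024 * k ^ 4 with hM
  set R : ℝ := 4 * (k : ℝ) ^ k * 2 ^ (22 * k ^ 2) with hR
  set Δ' : ℝ := Δ + (k * (k + 1) / 2 - Δ) / k with hΔ'
  set s : ℕ := k + m with hs
  have hkR : (2 : ℝ) ≤ k := by exact_mod_cast hk
  have hsR : (s : ℝ) = k + m := by rw [hs]; push_cast; ring
  have hmR : 2 * (k : ℝ) ^ 2 ≤ m := by exact_mod_cast hm1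
  have hmR2 : (m : ℝ) ≤ 10 * (k : ℝ) ^ 2 := by exact_mod_cast hm2
  have hη : 0 ≤ ((k : ℝ) * (k + 1) / 2 - Δ) := by linarith
  have hη' : ((k : ℝ) * (k + 1) / 2 - Δ) / k ≤ ((k : ℝ) * (k + 1) / 2 - Δ) :=
    div_le_self hη (by linarith)
  have hηk : 0 ≤ ((k : ℝ) * (k + 1) / 2 - Δ) / k := div_nonneg hη (by linarith)
  have hΔ'0 : 0 ≤ Δ' := by linarith
  have hΔ'1 : Δ' ≤ (k : ℝ) ^ 2 := by nlinarith
  have hM0 : (1 : ℝ) ≤ M := by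
    have : 1 ≤ M := by have := Nat.pow_pos (n := 4) (show 0 < k by omega); omega
    exact_mod_cast this
  have hC1 : 1 ≤ C := (one_le_pow₀ hM0).trans hC
  have hR1 : 1 ≤ R := by
    have h1 : (1 : ℝ) ≤ (k : ℝ) ^ k := one_le_pow₀ (by linarith)
    have h2 : (1 : ℝ) ≤ 2 ^ (22 * k ^ 2) := one_le_pow₀ (by norm_num)
    nlinarith [mul_le_mul h1 h2 (by norm_num) (by positivity)]
  induction X using Nat.strong_induction_on with
  | _ X ih =>
  have hX1 : (1 : ℝ) ≤ X := by exact_mod_cast hX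
  have hX0 : (0 : ℝ) < X := by linarith
  rcases le_or_gt X (M ^ k) with hsmall | hlarge
  · have h1 : (vino k s (Finset.Ico (0 : ℤ) X) : ℝ) ≤ (X : ℝ) ^ (2 * s) := by
      have := vino_le k s (Finset.Ico (0 : ℤ) X)
      simp only [Int.card_Ico, sub_zero, Int.toNat_natCast] at this
      exact_mod_cast this
    refine h1.trans ?_
    have h2 : (X : ℝ) ^ (2 * s) = (X : ℝ) ^ Δ' * (X : ℝ) ^ (2 * (s : ℝ) - Δ') := by
      rw [← rpow_add hX0, ← rpow_natCast]
      congr 1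
      push_cast
      ring
    rw [h2]
    refine mul_le_mul_of_nonneg_right ?_ (by positivity)
    calc (X : ℝ) ^ Δ' ≤ (X : ℝ) ^ ((k ^ 2 : ℕ) : ℝ) :=
          rpow_le_rpow_of_exponent_le hX1 (by push_cast; exact hΔ'1)
      _ = (X : ℝ) ^ (k ^ 2) := rpow_natCast _ _
      _ ≤ ((M : ℝ) ^ k) ^ (k ^ 2) := by
          gcongr
          exact_mod_cast hsmall
      _ = (M : ℝ) ^ k ^ 3 := by rw [← pow_mul]; congr 1; ring
      _ ≤ C := hC
      _ ≤ C * R := le_mul_of_one_le_right (by linarith) hR1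
  · have hM5 : 5 ≤ M := by have := Nat.pow_pos (n := 4) (show 0 < k by omega); omega
    obtain ⟨p, Y, hp, hMp, hXp, hpX, hXY, hYX, hY1, hYlt⟩ := exists_prime_scale hk hM5 hlarge
    have hkp : k < p := by
      have := Nat.le_self_pow (n := 4) (by omega) k
      omega
    have hp0 : (0 : ℝ) < p := by exact_mod_cast hp.pos
    have hstep := vino_step (k := k) (m := m) (by nlinarith) hp hkp hXp hXY
    rw [← hs] at hstep
    have hY : (Y : ℝ) ≤ 2 * X / p := by
      rw [le_div_iff₀ hp0]
      have : ((p * Y : ℕ) : ℝ) ≤ ((2 * X : ℕ) : ℝ) := Nat.cast_le.2 hYX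
      push_cast at this
      linarith
    have hYpow : ∀ {e : ℝ} {f : ℕ}, 0 ≤ e → e ≤ f →
        (Y : ℝ) ^ e ≤ 2 ^ f * (X : ℝ) ^ e * (p : ℝ) ^ (-e) := by
      intro e f he hef
      calc (Y : ℝ) ^ e ≤ (2 * X / p) ^ e := rpow_le_rpow (by positivity) hY he
        _ = 2 ^ e * (X : ℝ) ^ e * (p : ℝ) ^ (-e) := by
            rw [div_rpow (by positivity) hp0.le, mul_rpow (by norm_num) hX0.le, rpow_neg hp0.le]
            rfl
        _ ≤ _ := by
            gcongr
            rw [← rpow_natCast]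
            exact rpow_le_rpow_of_exponent_le (by norm_num) hef
    have hbad : (4 * (k : ℝ) ^ 2 * p) ^ s * vino k s (Finset.Ico (0 : ℤ) Y) ≤
        1 / 2 * (C * R * (X : ℝ) ^ (2 * (s : ℝ) - Δ')) := by
      have h1 := (ih Y hYlt hY1).trans (mul_le_mul_of_nonneg_left
        (hYpow (e := 2 * (s : ℝ) - Δ') (f := 2 * s) (by nlinarith) (by push_cast; linarith))
        (show 0 ≤ C * R by positivity))
      refine (mul_le_mul_of_nonneg_left h1 (by positivity)).trans ?_
      have h2 : (4 * (k : ℝ) ^ 2 * p) ^ s * 2 ^ (2 * s) * (p : ℝ) ^ (-(2 * (s : ℝ) - Δ')) ≤ 1 / 2 := by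
        exact bad_factor_le (by omega) (by omega) hMp (by nlinarith)
      calc _ = ((4 * (k : ℝ) ^ 2 * p) ^ s * 2 ^ (2 * s) * (p : ℝ) ^ (-(2 * (s : ℝ) - Δ'))) *
            (C * R * (X : ℝ) ^ (2 * (s : ℝ) - Δ')) := by ring
        _ ≤ _ := mul_le_mul_of_nonneg_right h2 (by positivity)
    have hgood : 2 * (p : ℝ) ^ (2 * m) * (X : ℝ) ^ k * (k : ℝ) ^ k * (p : ℝ) ^ (k * (k - 1) / 2) *
        vino k m (Finset.Ico (0 : ℤ) Y) ≤ 1 / 2 * (C * R * (X : ℝ) ^ (2 * (s : ℝ) - Δ')) := by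
      have h1 := (h Y hY1).trans (mul_le_mul_of_nonneg_left
        (hYpow (e := 2 * (m : ℝ) - Δ) (f := 2 * m) (by nlinarith) (by push_cast; linarith))
        (show 0 ≤ C by positivity))
      refine (mul_le_mul_of_nonneg_left h1 (by positivity)).trans ?_
      have h9 := good_factor_le (m := m) (by omega) hp.pos (by omega) hpX hΔ0 hΔ1
      rw [show 2 * ((k : ℝ) + m) - (Δ + (k * (k + 1) / 2 - Δ) / k) = 2 * (s : ℝ) - Δ' by
        rw [hΔ', hsR]] at h9
      have h10 : (2 : ℝ) ^ (2 * m) * 4 ^ k ^ 2 ≤ 2 ^ (22 * k ^ 2) := by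
        rw [show (4 : ℝ) = 2 ^ 2 by norm_num, ← pow_mul, ← pow_add]
        exact pow_le_pow_right₀ (by norm_num) (by omega)
      calc _ = 2 * (k : ℝ) ^ k * C * 2 ^ (2 * m) * (((X : ℝ) ^ k * (X : ℝ) ^ (2 * (m : ℝ) - Δ)) *
            ((p : ℝ) ^ (2 * m) * (p : ℝ) ^ (k * (k - 1) / 2) * (p : ℝ) ^ (-(2 * (m : ℝ) - Δ)))) := by
              ring
        _ ≤ 2 * (k : ℝ) ^ k * C * 2 ^ (2 * m) *
            (4 ^ (k ^ 2) * (X : ℝ) ^ (2 * (s : ℝ) - Δ')) := by gcongr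
        _ = 2 * (k : ℝ) ^ k * C * (2 ^ (2 * m) * 4 ^ (k ^ 2)) * (X : ℝ) ^ (2 * (s : ℝ) - Δ') := by
              ring
        _ ≤ 2 * (k : ℝ) ^ k * C * 2 ^ (22 * k ^ 2) * (X : ℝ) ^ (2 * (s : ℝ) - Δ') := by gcongr
        _ = _ := by rw [hR]; ring
    linarith

/-- Vinogradov's mean value theorem, in the form produced by the `p`-adic iteration. -/
lemma vino_bound {k : ℕ} (hk : 2 ≤ k) {l : ℕ} (hl : l ≤ 8 * k) {X : ℕ} (hX : 1 ≤ X) :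
    (vino k (2 * k ^ 2 + k * l) (Finset.Ico (0 : ℤ) X) : ℝ) ≤
      ((1024 * k ^ 4 : ℕ) : ℝ) ^ k ^ 3 * (4 * (k : ℝ) ^ k * 2 ^ (22 * k ^ 2)) ^ l *
      (X : ℝ) ^ (2 * ((2 * k ^ 2 + k * l : ℕ) : ℝ) -
        (k : ℝ) * (k + 1) / 2 * (1 - (1 - 1 / (k : ℝ)) ^ l)) := by
  have hkR : (2 : ℝ) ≤ k := by exact_mod_cast hk
  have hq0 : (0 : ℝ) ≤ 1 - 1 / k := by
    rw [sub_nonneg, div_le_one (by linarith)]; linarith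
  have hq1 : 1 - 1 / (k : ℝ) ≤ 1 := by
    have : (0 : ℝ) ≤ 1 / k := by positivity
    linarith
  induction l generalizing X with
  | zero =>
    have h1 := vino_le k (2 * k ^ 2) (Finset.Ico (0 : ℤ) X)
    simp only [Int.card_Ico, sub_zero, Int.toNat_natCast] at h1
    simp only [mul_zero, add_zero, pow_zero, mul_one, sub_self, sub_zero]
    have h2 : (vino k (2 * k ^ 2) (Finset.Ico (0 : ℤ) X) : ℝ) ≤ (X : ℝ) ^ (2 * (2 * k ^ 2)) := by
      exact_mod_cast h1
    rw [show 2 * ((2 * k ^ 2 : ℕ) : ℝ) = ((2 * (2 * k ^ 2) : ℕ) : ℝ) by push_cast; ring,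
      rpow_natCast]
    refine h2.trans (le_mul_of_one_le_left (by positivity) (one_le_pow₀ ?_))
    have := Nat.pow_pos (n := 4) (show 0 < k by omega)
    exact_mod_cast (by omega : 1 ≤ 1024 * k ^ 4)
  | succ l ih =>
    have hR1 : 1 ≤ 4 * (k : ℝ) ^ k * 2 ^ (22 * k ^ 2) := by
      have h1 : (1 : ℝ) ≤ (k : ℝ) ^ k := one_le_pow₀ (by linarith)
      have h2 : (1 : ℝ) ≤ 2 ^ (22 * k ^ 2) := one_le_pow₀ (by norm_num)
      nlinarith [mul_le_mul h1 h2 (by norm_num) (by positivity)]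
    have hl0 : (0 : ℝ) ≤ (1 - 1 / (k : ℝ)) ^ l := by positivity
    have hl1 : (1 - 1 / (k : ℝ)) ^ l ≤ 1 := pow_le_one₀ hq0 hq1
    have hK : (0 : ℝ) ≤ (k : ℝ) * (k + 1) / 2 := by positivity
    have h1 := vino_bound_step (k := k) (m := 2 * k ^ 2 + k * l) hk (by omega) (by nlinarith)
      (Δ := (k : ℝ) * (k + 1) / 2 * (1 - (1 - 1 / (k : ℝ)) ^ l))
      (C := ((1024 * k ^ 4 : ℕ) : ℝ) ^ k ^ 3 * (4 * (k : ℝ) ^ k * 2 ^ (22 * k ^ 2)) ^ l)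
      (mul_nonneg hK (by linarith)) (by nlinarith)
      (le_mul_of_one_le_right (by positivity) (one_le_pow₀ hR1))
      (fun Y hY => ih (by omega) hY) hX
    have h2 : k + (2 * k ^ 2 + k * l) = 2 * k ^ 2 + k * (l + 1) := by ring
    rw [h2, mul_assoc, mul_assoc, ← mul_assoc (_ ^ l), ← pow_succ, ← mul_assoc] at h1
    convert h1 using 4
    rw [pow_succ]
    ring

lemma log_natCast_le {n : ℕ} : Real.log n ≤ n := log_le_self (Nat.cast_nonneg n)

/-- Vinogradov's mean value theorem with `10 k ^ 2` variables. -/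
lemma vino_mean_value {k : ℕ} (hk : 2 ≤ k) {X : ℕ} (hX : 1 ≤ X) :
    (vino k (10 * k ^ 2) (Finset.Ico (0 : ℤ) X) : ℝ) ≤ exp (256 * (k : ℝ) ^ 4) *
      (X : ℝ) ^ (2 * ((10 * k ^ 2 : ℕ) : ℝ) - (k : ℝ) * (k + 1) / 2 * (1 - exp (-8))) := by
  have hkR : (2 : ℝ) ≤ k := by exact_mod_cast hk
  have h := vino_bound hk (le_refl (8 * k)) hX
  rw [show 2 * k ^ 2 + k * (8 * k) = 10 * k ^ 2 by ring] at h
  refine h.trans ?_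
  have hX1 : (1 : ℝ) ≤ X := by exact_mod_cast hX
  gcongr
  · have hlk : Real.log k ≤ k := log_natCast_le
    have hl2 : Real.log 2 ≤ 1 := by linarith [log_two_lt_d9]
    have e1 : ((1024 * k ^ 4 : ℕ) : ℝ) ^ k ^ 3 * (4 * (k : ℝ) ^ k * 2 ^ (22 * k ^ 2)) ^ (8 * k) =
        exp (k ^ 3 * (10 * Real.log 2 + 4 * Real.log k) +
          8 * k * (2 * Real.log 2 + k * Real.log k + 22 * k ^ 2 * Real.log 2)) := by
      have a1 : ((1024 * k ^ 4 : ℕ) : ℝ) = exp (10 * Real.log 2 + 4 * Real.log k) := by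
        rw [exp_add, show 10 * Real.log 2 = ((10 : ℕ) : ℝ) * Real.log 2 by norm_num,
          show 4 * Real.log (k : ℝ) = ((4 : ℕ) : ℝ) * Real.log k by norm_num, exp_nat_mul,
          exp_nat_mul, exp_log (by norm_num), exp_log (by linarith)]
        push_cast
        norm_num
      have a2 : 4 * (k : ℝ) ^ k * 2 ^ (22 * k ^ 2) =
          exp (2 * Real.log 2 + k * Real.log k + 22 * k ^ 2 * Real.log 2) := by
        rw [exp_add, exp_add, show 2 * Real.log 2 = ((2 : ℕ) : ℝ) * Real.log 2 by norm_num,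
          show 22 * (k : ℝ) ^ 2 * Real.log 2 = ((22 * k ^ 2 : ℕ) : ℝ) * Real.log 2 by
            push_cast; ring, exp_nat_mul,
          exp_nat_mul, exp_nat_mul, exp_log (by norm_num), exp_log (by linarith)]
        norm_num
      rw [a1, a2, ← exp_nat_mul, ← exp_nat_mul, ← exp_add]
      push_cast
      ring_nf
    rw [e1, exp_le_exp]
    have b1 : 0 ≤ Real.log k := log_nonneg (by linarith)
    have b2 : (k : ℝ) ^ 3 * (10 * Real.log 2 + 4 * Real.log k) ≤ (k : ℝ) ^ 3 * (10 * 1 + 4 * k) := by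
      gcongr
    have b3 : 8 * k * (2 * Real.log 2 + k * Real.log k + 22 * k ^ 2 * Real.log 2) ≤
        8 * (k : ℝ) * (2 * 1 + k * k + 22 * k ^ 2 * 1) := by
      gcongr
    have b4 : (2 : ℝ) * k ^ 3 ≤ k ^ 4 := by
      have : 0 ≤ (k : ℝ) ^ 3 := by positivity
      nlinarith
    have b5 : (2 : ℝ) * k ≤ k ^ 2 := by nlinarith
    have b6 : (2 : ℝ) * k ^ 2 ≤ k ^ 3 := by nlinarith [sq_nonneg (k : ℝ)]
    nlinarith
  · have : (1 - 1 / (k : ℝ)) ^ (8 * k) ≤ exp (-8) := by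
      have h1 : (1 - 1 / (k : ℝ)) ≤ exp (-(1 / k)) := by linarith [add_one_le_exp (-(1 / (k : ℝ)))]
      have h2 : (0 : ℝ) ≤ 1 - 1 / k := by
        rw [sub_nonneg, div_le_one (by linarith)]; linarith
      refine (pow_le_pow_left₀ h2 h1 _).trans_eq ?_
      rw [← exp_nat_mul]
      congr 1
      push_cast
      field_simp
    linarith

/-- The additive character `exp (2 π i x)` of the real line. -/
noncomputable def ee (x : ℝ) : ℂ := Complex.exp ((2 * π * x : ℝ) * Complex.I)

lemma ee_add (x y : ℝ) : ee (x + y) = ee x * ee y := by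
  rw [ee, ee, ee, ← Complex.exp_add]
  congr 1
  push_cast
  ring

@[simp] lemma ee_zero : ee 0 = 1 := by simp [ee]

@[simp] lemma norm_ee (x : ℝ) : ‖ee x‖ = 1 := Complex.norm_exp_ofReal_mul_I _

lemma ee_neg (x : ℝ) : ee (-x) = (starRingEnd ℂ) (ee x) := by
  rw [ee, ee, ← Complex.exp_conj, map_mul, Complex.conj_ofReal, Complex.conj_I]
  congr 1
  push_cast
  ring

lemma ee_sum {ι : Type*} (t : Finset ι) (f : ι → ℝ) : ee (∑ i ∈ t, f i) = ∏ i ∈ t, ee (f i) := by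
  classical
  induction t using Finset.induction_on with
  | empty => simp
  | insert i t hi ih => rw [Finset.sum_insert hi, Finset.prod_insert hi, ee_add, ih]

lemma norm_ee_sub_one_eq (x : ℝ) : ‖ee x - 1‖ = 2 * |sin (π * x)| := by
  have h := Complex.norm_exp_I_mul_ofReal_sub_one (2 * π * x)
  rw [mul_comm Complex.I] at h
  rw [ee, h, norm_mul, Real.norm_eq_abs, Real.norm_eq_abs, abs_two]
  congr 3
  ring

lemma norm_ee_sub_one_le (x : ℝ) : ‖ee x - 1‖ ≤ 2 * π * |x| := by
  rw [norm_ee_sub_one_eq, mul_assoc]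
  gcongr
  refine abs_sin_le_abs.trans ?_
  rw [abs_mul, abs_of_pos pi_pos]

lemma four_mul_abs_le_norm_ee_sub_one {x : ℝ} (hx : |x| ≤ 1 / 2) : 4 * |x| ≤ ‖ee x - 1‖ := by
  rw [norm_ee_sub_one_eq]
  have h := mul_le_sin (x := π * |x|) (by positivity) (by nlinarith [pi_pos])
  have h2 : 2 / π * (π * |x|) = 2 * |x| := by field_simp
  have h3 : sin (π * |x|) ≤ |sin (π * x)| := by
    rcases abs_cases x with ⟨h, _⟩ | ⟨h, _⟩
    · rw [h]; exact le_abs_self _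
    · rw [h, mul_neg, sin_neg]; exact neg_le_abs _
  linarith

/-- The moments of an exponential sum are sums over tuples. -/
lemma norm_sum_ee_pow {k s : ℕ} (A : Finset ℤ) (β : Fin k → ℝ) :
    ((‖∑ b ∈ A, ee (∑ j, β j * momentCurve k b j)‖ ^ (2 * s) : ℝ) : ℂ) =
      ∑ t ∈ tuples s A ×ˢ tuples s A,
        ee (∑ j, β j * ((powerSums k t.1 - powerSums k t.2) j : ℤ)) := by
  have h1 : (∑ b ∈ A, ee (∑ j, β j * momentCurve k b j)) ^ s =
      ∑ x ∈ tuples s A, ee (∑ j, β j * (powerSums k x j : ℤ)) := by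
    have h2 := Finset.prod_univ_sum (fun _ : Fin s => A)
      (fun _ b => ee (∑ j, β j * momentCurve k b j))
    rw [Finset.prod_const, Finset.card_univ, Fintype.card_fin] at h2
    rw [h2]
    apply Finset.sum_congr rfl
    intro x _
    rw [← ee_sum, Finset.sum_comm]
    congr 1
    apply Finset.sum_congr rfl
    intro j _
    rw [powerSums_eq_sum, Finset.sum_apply, Int.cast_sum, Finset.mul_sum]
  rw [pow_mul, ← Complex.normSq_eq_norm_sq, Complex.ofReal_pow, ← Complex.mul_conj, mul_pow, ← map_pow,
    h1, map_sum, Finset.sum_mul_sum, Finset.sum_product]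
  apply Finset.sum_congr rfl
  intro x _
  apply Finset.sum_congr rfl
  intro y _
  rw [← ee_neg, ← ee_add, ← Finset.sum_neg_distrib, ← Finset.sum_add_distrib]
  congr 1
  apply Finset.sum_congr rfl
  intro j _
  simp only [Pi.sub_apply, Int.cast_sub]
  ring

lemma sum_norm_pow_le_dual {k s : ℕ} {γ : Type*} (U : Finset γ) (ψ : γ → Fin k → ℤ)
    (A : Finset ℤ) (α : Fin k → ℝ) :
    ∑ u ∈ U, ‖∑ b ∈ A, ee (∑ j, α j * (ψ u j * momentCurve k b j))‖ ^ (2 * s) ≤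
      ∑ t ∈ tuples s A ×ˢ tuples s A,
        ‖∑ u ∈ U, ee (∑ j, α j * (ψ u j * ((powerSums k t.1 - powerSums k t.2) j : ℤ)))‖ := by
  have h1 : ((∑ u ∈ U, ‖∑ b ∈ A, ee (∑ j, α j * (ψ u j * momentCurve k b j))‖ ^ (2 * s) : ℝ) : ℂ) =
      ∑ t ∈ tuples s A ×ˢ tuples s A,
        ∑ u ∈ U, ee (∑ j, α j * (ψ u j * ((powerSums k t.1 - powerSums k t.2) j : ℤ))) := by
    rw [Finset.sum_comm, Complex.ofReal_sum]
    apply Finset.sum_congr rfl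
    intro u _
    simp only [← mul_assoc]
    exact norm_sum_ee_pow A (fun j => α j * ψ u j)
  rw [← norm_of_nonneg (Finset.sum_nonneg fun u _ => pow_nonneg (norm_nonneg _) _ :
    (0 : ℝ) ≤ ∑ u ∈ U, ‖∑ b ∈ A, ee (∑ j, α j * (ψ u j * momentCurve k b j))‖ ^ (2 * s)),
    ← Complex.norm_real, h1]
  exact norm_sum_le _ _

lemma sum_tuples_le {k s : ℕ} (A : Finset ℤ) (box : Finset (Fin k → ℤ))
    (hbox : ∀ t ∈ tuples s A ×ˢ tuples s A, powerSums k t.1 - powerSums k t.2 ∈ box)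
    {f : (Fin k → ℤ) → ℝ} (hf : ∀ v, 0 ≤ f v) :
    ∑ t ∈ tuples s A ×ˢ tuples s A, f (powerSums k t.1 - powerSums k t.2) ≤
      vino k s A * ∑ v ∈ box, f v := by
  classical
  rw [← Finset.sum_fiberwise_of_maps_to hbox, Finset.mul_sum]
  apply Finset.sum_le_sum
  intro w _
  rw [Finset.sum_congr rfl (g := fun _ => f w) (fun t ht => by rw [(Finset.mem_filter.1 ht).2]),
    Finset.sum_const, nsmul_eq_mul]
  refine mul_le_mul_of_nonneg_right ?_ (hf w)
  have h := card_shift_le (tuples s A) (powerSums k) w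
  unfold vino
  refine Nat.cast_le.2 (le_trans (le_of_eq ?_) (h.trans (le_of_eq ?_)))
  · congr 1
    ext t
    simp only [Finset.mem_filter, and_congr_right_iff]
    intro _
    rw [sub_eq_iff_eq_add']
  · congr

/-- The one-variable factor in the bilinear form of Vinogradov's method. -/
noncomputable def zSum (α : ℝ) (P : ℕ) : ℝ :=
  ∑ w ∈ Finset.Icc (-(P : ℤ)) P, ‖∑ v ∈ Finset.Icc (-(P : ℤ)) P, ee (α * (v * w))‖

lemma zSum_nonneg (α : ℝ) (P : ℕ) : 0 ≤ zSum α P := Finset.sum_nonneg fun _ _ => norm_nonneg _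

lemma sum_box_eq_prod_zSum {k : ℕ} (α : Fin k → ℝ) (P : Fin k → ℕ) :
    ∑ w ∈ Fintype.piFinset (fun j => Finset.Icc (-(P j : ℤ)) (P j)),
      ‖∑ v ∈ Fintype.piFinset (fun j => Finset.Icc (-(P j : ℤ)) (P j)),
        ee (∑ j, α j * (v j * w j))‖ = ∏ j, zSum (α j) (P j) := by
  simp only [zSum]
  rw [Finset.prod_univ_sum]
  apply Finset.sum_congr rfl
  intro w _
  rw [← norm_prod, Finset.prod_univ_sum]
  simp only [ee_sum]

/-- The bilinear estimate: Hölder's inequality twice and the mean value theorem. -/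
lemma norm_bilinear_pow_le {k s Q : ℕ} (hs : 1 ≤ s) (α : Fin k → ℝ) :
    ‖∑ a ∈ Finset.Ico (0 : ℤ) Q, ∑ b ∈ Finset.Ico (0 : ℤ) Q,
      ee (∑ j, α j * (momentCurve k a j * momentCurve k b j))‖ ^ (4 * s ^ 2) ≤
      (Q : ℝ) ^ (8 * s ^ 2 - 4 * s) * (vino k s (Finset.Ico (0 : ℤ) Q) : ℝ) ^ 2 *
        ∏ j : Fin k, zSum (α j) (s * Q ^ (j + 1 : ℕ)) := by
  set A := Finset.Ico (0 : ℤ) Q with hA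
  have hAc : A.card = Q := by simp [hA]
  set J : ℝ := (vino k s A : ℝ) with hJ
  set T := tuples s A ×ˢ tuples s A with hT
  have hTc : (T.card : ℝ) = (Q : ℝ) ^ (2 * s) := by
    rw [hT, Finset.card_product, card_tuples, hAc]
    push_cast
    ring
  set box := Fintype.piFinset (fun j : Fin k => Finset.Icc (-((s * Q ^ (j + 1 : ℕ) : ℕ) : ℤ))
    ((s * Q ^ (j + 1 : ℕ) : ℕ) : ℤ)) with hbox
  have hb : ∀ t ∈ T, powerSums k t.1 - powerSums k t.2 ∈ box := by
    have h1 : ∀ x ∈ tuples s A, ∀ j : Fin k, 0 ≤ powerSums k x j ∧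
        powerSums k x j ≤ ((s * Q ^ (j + 1 : ℕ) : ℕ) : ℤ) := by
      intro x hx j
      have hx' : ∀ i, 0 ≤ x i ∧ x i ≤ Q := fun i => by
        have := Fintype.mem_piFinset.1 hx i
        rw [hA, Finset.mem_Ico] at this
        exact ⟨this.1, this.2.le⟩
      refine ⟨Finset.sum_nonneg fun i _ => pow_nonneg (hx' i).1 _, ?_⟩
      refine (Finset.sum_le_card_nsmul _ _ _ fun i _ => pow_le_pow_left₀ (hx' i).1 (hx' i).2 _).trans ?_
      simp
    intro t ht
    rw [hT, Finset.mem_product] at ht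
    refine Fintype.mem_piFinset.2 fun j => Finset.mem_Icc.2 ?_
    have h2 := h1 _ ht.1 j
    have h3 := h1 _ ht.2 j
    simp only [Pi.sub_apply]
    omega
  set S : (Fin k → ℤ) → ℂ := fun v => ∑ a ∈ A, ee (∑ j, α j * (v j * momentCurve k a j)) with hS
  have hHolder : ‖∑ a ∈ A, ∑ b ∈ A, ee (∑ j, α j * (momentCurve k a j * momentCurve k b j))‖ ^ (2 * s) ≤
      (Q : ℝ) ^ (2 * s - 1) * ∑ t ∈ T, ‖S (powerSums k t.1 - powerSums k t.2)‖ := by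
    refine (pow_le_pow_left₀ (norm_nonneg _) (norm_sum_le _ _) _).trans ?_
    have h1 := pow_sum_le_card_mul_sum_pow (s := A) (f := fun a =>
      ‖∑ b ∈ A, ee (∑ j, α j * (momentCurve k a j * momentCurve k b j))‖)
      (fun _ _ => norm_nonneg _) (2 * s - 1)
    rw [Nat.sub_add_cancel (by omega), hAc] at h1
    refine h1.trans (mul_le_mul_of_nonneg_left ?_ (by positivity))
    refine (sum_norm_pow_le_dual (s := s) A (momentCurve k) A α).trans (le_of_eq ?_)
    apply Finset.sum_congr rfl
    intro t _
    simp only [hS, mul_comm]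
  have hMoment : (∑ t ∈ T, ‖S (powerSums k t.1 - powerSums k t.2)‖) ^ (2 * s) ≤
      ((Q : ℝ) ^ (2 * s)) ^ (2 * s - 1) * (J * (J * ∏ j : Fin k, zSum (α j) (s * Q ^ (j + 1 : ℕ)))) := by
    have h1 := pow_sum_le_card_mul_sum_pow (s := T) (f := fun t =>
      ‖S (powerSums k t.1 - powerSums k t.2)‖) (fun _ _ => norm_nonneg _) (2 * s - 1)
    rw [Nat.sub_add_cancel (by omega), hTc] at h1
    refine h1.trans (mul_le_mul_of_nonneg_left ?_ (by positivity))
    refine (sum_tuples_le A box hb (f := fun v => ‖S v‖ ^ (2 * s)) (fun v => by positivity)).trans ?_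
    refine mul_le_mul_of_nonneg_left ?_ (by positivity)
    refine (sum_norm_pow_le_dual (s := s) box (fun v => v) A α).trans ?_
    refine (sum_tuples_le A box hb (f := fun w => ‖∑ v ∈ box, ee (∑ j, α j * (v j * w j))‖)
      (fun v => norm_nonneg _)).trans ?_
    exact mul_le_mul_of_nonneg_left (le_of_eq (sum_box_eq_prod_zSum α _)) (by positivity)
  have e1 : 4 * s ^ 2 = (2 * s) * (2 * s) := by ring
  rw [e1, pow_mul]
  refine (pow_le_pow_left₀ (by positivity) hHolder _).trans ?_
  rw [mul_pow]
  refine (mul_le_mul_of_nonneg_left hMoment (by positivity)).trans (le_of_eq ?_)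
  have e2 : (Q : ℝ) ^ (8 * s ^ 2 - 4 * s) = ((Q : ℝ) ^ (2 * s - 1)) ^ (2 * s) *
      ((Q : ℝ) ^ (2 * s)) ^ (2 * s - 1) := by
    rw [← pow_mul, ← pow_mul, ← pow_add]
    congr 1
    obtain ⟨r, rfl⟩ := Nat.exists_eq_add_of_le hs
    have : 2 * (1 + r) - 1 = 2 * r + 1 := by omega
    rw [this]
    have : 8 * (1 + r) ^ 2 - 4 * (1 + r) = 8 * r ^ 2 + 12 * r + 4 := by
      rw [Nat.sub_eq_iff_eq_add (by nlinarith)]; ring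
    rw [this]
    ring
  rw [e2]
  ring

lemma zSum_le_sq (α : ℝ) (P : ℕ) : zSum α P ≤ (2 * (P : ℝ) + 1) ^ 2 := by
  have hc : ((Finset.Icc (-(P : ℤ)) P).card : ℝ) = 2 * P + 1 := by
    rw [Int.card_Icc]
    have : ((P : ℤ) + 1 - -P).toNat = 2 * P + 1 := by omega
    rw [this]
    push_cast
    ring
  refine (Finset.sum_le_card_nsmul _ _ (2 * (P : ℝ) + 1) fun w _ => ?_).trans ?_
  · refine (norm_sum_le _ _).trans ?_
    simp only [norm_ee, Finset.sum_const, nsmul_eq_mul, mul_one, hc, le_refl]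
  · rw [nsmul_eq_mul, hc, pow_two]

lemma norm_sum_ee_Icc_le (P : ℕ) {x : ℝ} (hx0 : x ≠ 0) (hx : |x| ≤ 1 / 2) :
    ‖∑ v ∈ Finset.Icc (-(P : ℤ)) P, ee (x * v)‖ ≤ 1 / (2 * |x|) := by
  have hpos : 0 < |x| := abs_pos.2 hx0
  have h1 : (∑ v ∈ Finset.Icc (-(P : ℤ)) P, ee (x * v)) * (ee x - 1) =
      ee (x * (P + 1)) - ee (-(x * P)) := by
    induction P with
    | zero => simp
    | succ P ih =>
      have h2 : Finset.Icc (-((P + 1 : ℕ) : ℤ)) ((P + 1 : ℕ) : ℤ) =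
          insert (-((P + 1 : ℕ) : ℤ)) (insert ((P + 1 : ℕ) : ℤ) (Finset.Icc (-(P : ℤ)) P)) := by
        ext z
        simp only [Finset.mem_Icc, Finset.mem_insert]
        omega
      rw [h2, Finset.sum_insert (by simp; omega), Finset.sum_insert (by simp), add_mul, add_mul, ih]
      push_cast
      simp only [mul_sub, ← ee_add, mul_one]
      rw [show x * -((P : ℝ) + 1) + x = -(x * P) by ring,
        show x * ((P : ℝ) + 1) + x = x * (P + 1 + 1) by ring,
        show x * -((P : ℝ) + 1) = -(x * (P + 1)) by ring]
      ring
  have h2 := congrArg norm h1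
  rw [norm_mul] at h2
  have h3 : ‖ee (x * (P + 1)) - ee (-(x * P))‖ ≤ 2 := by
    refine (norm_sub_le _ _).trans ?_
    simp only [norm_ee]
    norm_num
  have h4 := four_mul_abs_le_norm_ee_sub_one hx
  rw [le_div_iff₀ (by positivity)]
  have h5 := mul_le_mul_of_nonneg_left h4 (norm_nonneg (∑ v ∈ Finset.Icc (-(P : ℤ)) P, ee (x * v)))
  linarith

lemma zSum_le {α : ℝ} {P : ℕ} (hα : α ≠ 0) (h : |α| * P ≤ 1 / 2) :
    zSum α P ≤ 2 * P + 1 + (1 + Real.log P) / |α| := by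
  have hpos : 0 < |α| := abs_pos.2 hα
  have hbound : ∀ w : ℤ, w ≠ 0 → |w| ≤ P →
      ‖∑ v ∈ Finset.Icc (-(P : ℤ)) P, ee (α * (v * w))‖ ≤ 1 / (2 * |α|) * (1 / |(w : ℝ)|) := by
    intro w hw hwP
    have hwR : (w : ℝ) ≠ 0 := Int.cast_ne_zero.2 hw
    have hwP' : |(w : ℝ)| ≤ P := by exact_mod_cast hwP
    have h1 := norm_sum_ee_Icc_le P (x := α * w) (mul_ne_zero hα hwR) (by
      rw [abs_mul]
      exact (mul_le_mul_of_nonneg_left hwP' hpos.le).trans h)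
    have h2 : ∀ v : ℤ, α * (v * w) = α * w * v := fun v => by ring
    simp only [h2]
    refine h1.trans (le_of_eq ?_)
    rw [abs_mul]
    have := abs_pos.2 hwR
    field_simp
  have h0 : ‖∑ v ∈ Finset.Icc (-(P : ℤ)) P, ee (α * (v * (0 : ℤ)))‖ = 2 * P + 1 := by
    simp only [Int.cast_zero, mul_zero, ee_zero, Finset.sum_const, Int.card_Icc, nsmul_eq_mul, mul_one]
    have : ((P : ℤ) + 1 - -P).toNat = 2 * P + 1 := by omega
    rw [this, Complex.norm_natCast]
    push_cast
    ring
  have hgen : ∀ R : ℕ, R ≤ P → ∑ w ∈ Finset.Icc (-(R : ℤ)) R,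
      ‖∑ v ∈ Finset.Icc (-(P : ℤ)) P, ee (α * (v * w))‖ ≤ 2 * P + 1 + (harmonic R : ℝ) / |α| := by
    intro R
    induction R with
    | zero => intro _; simpa using h0.le
    | succ R ih =>
      intro hR
      have h2 : Finset.Icc (-((R + 1 : ℕ) : ℤ)) ((R + 1 : ℕ) : ℤ) =
          insert (-((R + 1 : ℕ) : ℤ)) (insert ((R + 1 : ℕ) : ℤ) (Finset.Icc (-(R : ℤ)) R)) := by
        ext z
        simp only [Finset.mem_Icc, Finset.mem_insert]
        omega
      rw [h2, Finset.sum_insert (by simp; omega), Finset.sum_insert (by simp)]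
      have h3 := hbound (-((R + 1 : ℕ) : ℤ)) (by omega) (by rw [abs_neg, Nat.abs_cast]; exact_mod_cast hR)
      have h4 := hbound ((R + 1 : ℕ) : ℤ) (by omega) (by rw [Nat.abs_cast]; exact_mod_cast hR)
      have h5 := ih (by omega)
      have e1 : |(((-((R + 1 : ℕ) : ℤ)) : ℤ) : ℝ)| = R + 1 := by
        rw [Int.cast_neg, abs_neg, Int.cast_natCast, Nat.abs_cast]; push_cast; ring
      have e2 : |((((R + 1 : ℕ) : ℤ)) : ℝ)| = R + 1 := by
        rw [Int.cast_natCast, Nat.abs_cast]; push_cast; ring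
      rw [e1] at h3
      rw [e2] at h4
      have e3 : (harmonic (R + 1) : ℝ) / |α| = harmonic R / |α| +
          (1 / (2 * |α|) * (1 / ((R : ℝ) + 1)) + 1 / (2 * |α|) * (1 / ((R : ℝ) + 1))) := by
        rw [harmonic_succ]
        push_cast
        field_simp
        ring
      rw [e3]
      linarith
  refine (hgen P le_rfl).trans ?_
  have := harmonic_le_one_add_log P
  gcongr

lemma zSum_window_le {t r s j : ℕ} {α : ℝ} (ht : 1 ≤ t) (hr : 2 ^ 34 ≤ r)
    (hs : s = 10 * (6 * t + 5) ^ 2) (hj1 : 2 * t + 2 ≤ j) (hj2 : j ≤ 3 * t + 1)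
    (hα1 : |α| * (r : ℝ) ^ (20 * (j - t - 1)) ≤ 1)
    (hα2 : 1 ≤ |α| * (2 ^ (8 * t) * (r : ℝ) ^ (20 * (j - t)))) :
    zSum α (s * (r ^ 8) ^ j) ≤ (2 * ((s * (r ^ 8) ^ j : ℕ) : ℝ) + 1) ^ 2 * ((r : ℝ) ^ (2 * t))⁻¹ := by
  have hrR : (2 : ℝ) ^ 34 ≤ r := by exact_mod_cast hr
  have hr1 : (1 : ℝ) ≤ r := le_trans (by norm_num) hrR
  have hr0 : (0 : ℝ) < r := by linarith
  have hα : 0 < |α| := by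
    rcases (abs_nonneg α).eq_or_lt with h | h
    · rw [← h] at hα2; norm_num at hα2
    · exact h
  have htR : (1 : ℝ) ≤ t := by exact_mod_cast ht
  have hsR : (s : ℝ) = 10 * (6 * t + 5) ^ 2 := by rw [hs]; push_cast; ring
  have hs1 : 1210 * (t : ℝ) ≤ s := by rw [hsR]; nlinarith
  have ht2 : (t : ℝ) ≤ (r : ℝ) ^ t := by
    have h1 : (t : ℝ) ≤ 2 ^ t := by exact_mod_cast Nat.lt_two_pow_self.le
    exact h1.trans (pow_le_pow_left₀ (by norm_num) (by linarith) _)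
  have hs2 : 2 * (s : ℝ) ≤ (r : ℝ) ^ (4 * t + 4) := by
    calc 2 * (s : ℝ) ≤ 2420 * (t * t) := by rw [hsR]; nlinarith
      _ ≤ (r : ℝ) ^ 4 * ((r : ℝ) ^ t * (r : ℝ) ^ t) := by
          gcongr
          exact le_trans (by linarith) (le_self_pow₀ hr1 (by norm_num))
      _ = (r : ℝ) ^ (2 * t + 4) := by ring
      _ ≤ _ := pow_le_pow_right₀ hr1 (by omega)
  set P : ℕ := s * (r ^ 8) ^ j with hP
  have hPR : (P : ℝ) = s * (r : ℝ) ^ (8 * j) := by rw [hP]; push_cast; rw [pow_mul]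
  have hαP : |α| * P ≤ 1 / 2 := by
    have h1 : 2 * ((s : ℝ) * (r : ℝ) ^ (8 * j)) ≤ (r : ℝ) ^ (20 * (j - t - 1)) := by
      calc 2 * ((s : ℝ) * (r : ℝ) ^ (8 * j)) = (2 * s) * (r : ℝ) ^ (8 * j) := by ring
        _ ≤ (r : ℝ) ^ (4 * t + 4) * (r : ℝ) ^ (8 * j) := by gcongr
        _ = (r : ℝ) ^ (4 * t + 4 + 8 * j) := by rw [← pow_add]
        _ ≤ _ := pow_le_pow_right₀ hr1 (by omega)
    rw [hPR]
    nlinarith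
  have hα0 : α ≠ 0 := abs_pos.1 hα
  refine (zSum_le hα0 hαP).trans ?_
  have hrt : (0 : ℝ) < (r : ℝ) ^ (2 * t) := by positivity
  rw [← div_eq_mul_inv, le_div_iff₀ hrt]
  have hs3 : (1 : ℝ) ≤ s := by linarith
  have hP1 : (r : ℝ) ^ (2 * t) ≤ P := by
    rw [hPR]
    calc (r : ℝ) ^ (2 * t) ≤ 1 * (r : ℝ) ^ (8 * j) := by
          rw [one_mul]; exact pow_le_pow_right₀ hr1 (by omega)
      _ ≤ _ := by gcongr
  have hlog : 1 + Real.log P ≤ (s : ℝ) ^ 2 * r := by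
    have hls : Real.log s ≤ s := log_le_self (by linarith)
    have hlr : Real.log r ≤ r := log_le_self hr0.le
    have hj : (j : ℝ) ≤ 4 * t := by
      have : j ≤ 4 * t := by omega
      exact_mod_cast this
    rw [hPR, log_mul (by linarith) (by positivity), log_pow]
    push_cast
    have h1 : 8 * (j : ℝ) * Real.log r ≤ 8 * (4 * t) * r := by gcongr
    have h2 : 32 * (t : ℝ) * r ≤ s * r := by gcongr; linarith
    have h4 : (1210 : ℝ) * (s * r) ≤ s * (s * r) := by gcongr; linarith
    have h3 : (s : ℝ) ≤ s * r := le_mul_of_one_le_right (by linarith) hr1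
    nlinarith
  have hinv : (1 + Real.log P) / |α| ≤
      (s : ℝ) ^ 2 * r * (2 ^ (8 * t) * (r : ℝ) ^ (20 * (j - t))) := by
    rw [div_le_iff₀ hα]
    have h0 : 0 ≤ (s : ℝ) ^ 2 * r := by positivity
    nlinarith
  have h2 : (s : ℝ) ^ 2 * r * (2 ^ (8 * t) * (r : ℝ) ^ (20 * (j - t))) * (r : ℝ) ^ (2 * t) ≤
      (P : ℝ) ^ 2 := by
    have h3 : (2 : ℝ) ^ (8 * t) ≤ (r : ℝ) ^ t := by
      rw [pow_mul]
      exact pow_le_pow_left₀ (by norm_num) (le_trans (by norm_num) hrR) _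
    calc _ ≤ (s : ℝ) ^ 2 * r * ((r : ℝ) ^ t * (r : ℝ) ^ (20 * (j - t))) * (r : ℝ) ^ (2 * t) := by
          gcongr
      _ = (s : ℝ) ^ 2 * (r : ℝ) ^ (1 + t + 20 * (j - t) + 2 * t) := by
          simp only [pow_add, pow_one]; ring
      _ ≤ (s : ℝ) ^ 2 * (r : ℝ) ^ (8 * j * 2) := by
          gcongr
          omega
      _ = (P : ℝ) ^ 2 := by rw [hPR, mul_pow, ← pow_mul]
  have h4 := mul_le_mul_of_nonneg_right hinv hrt.le
  have h5 : (2 * (P : ℝ) + 1) * (r : ℝ) ^ (2 * t) ≤ (2 * P + 1) * P := by gcongr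
  nlinarith [mul_pos hrt hrt]

lemma prod_zSum_le {t r k s : ℕ} (ht : 1 ≤ t) (hr : 2 ^ 34 ≤ r) (hk : k = 6 * t + 5)
    (hs : s = 10 * k ^ 2) (α : ℕ → ℝ)
    (hα1 : ∀ j, 2 * t + 2 ≤ j → j ≤ 3 * t + 1 → |α j| * (r : ℝ) ^ (20 * (j - t - 1)) ≤ 1)
    (hα2 : ∀ j, 2 * t + 2 ≤ j → j ≤ 3 * t + 1 →
      1 ≤ |α j| * (2 ^ (8 * t) * (r : ℝ) ^ (20 * (j - t)))) :
    ∏ j : Fin k, zSum (α (j + 1)) (s * (r ^ 8) ^ (j + 1 : ℕ)) ≤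
      (3 * (s : ℝ)) ^ (2 * k) * ((r : ℝ) ^ 8) ^ (k * (k + 1)) * ((r : ℝ) ^ (2 * t ^ 2))⁻¹ := by
  rw [Fin.prod_univ_eq_prod_range (fun j => zSum (α (j + 1)) (s * (r ^ 8) ^ (j + 1))) k]
  have hs1 : 1 ≤ s := by have := Nat.pow_pos (n := 2) (show 0 < k by omega); omega
  have hr1 : 1 ≤ r := le_trans (by norm_num) hr
  have hfac : ∀ j ∈ Finset.range k, zSum (α (j + 1)) (s * (r ^ 8) ^ (j + 1)) ≤
      (3 * (s : ℝ)) ^ 2 * ((r : ℝ) ^ 8) ^ (2 * (j + 1)) *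
        (if j ∈ Finset.Ico (2 * t + 1) (3 * t + 1) then ((r : ℝ) ^ (2 * t))⁻¹ else 1) := by
    intro j _
    have hP : (2 * ((s * (r ^ 8) ^ (j + 1) : ℕ) : ℝ) + 1) ^ 2 ≤
        (3 * (s : ℝ)) ^ 2 * ((r : ℝ) ^ 8) ^ (2 * (j + 1)) := by
      have h1 : (1 : ℝ) ≤ ((s * (r ^ 8) ^ (j + 1) : ℕ) : ℝ) := by
        exact_mod_cast Nat.mul_pos hs1 (by positivity)
      calc _ ≤ (3 * ((s * (r ^ 8) ^ (j + 1) : ℕ) : ℝ)) ^ 2 := by gcongr; linarith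
        _ = _ := by push_cast; ring
    split_ifs with hj
    · rw [Finset.mem_Ico] at hj
      refine (zSum_window_le ht hr (by rw [hs, hk]) (by omega) (by omega)
        (hα1 _ (by omega) (by omega)) (hα2 _ (by omega) (by omega))).trans ?_
      gcongr
    · rw [mul_one]
      exact (zSum_le_sq _ _).trans hP
  refine (Finset.prod_le_prod (fun j _ => zSum_nonneg _ _) hfac).trans (le_of_eq ?_)
  rw [Finset.prod_mul_distrib, Finset.prod_mul_distrib, Finset.prod_const, Finset.card_range,
    Finset.prod_pow_eq_pow_sum, ← pow_mul, Finset.prod_ite_mem]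
  have e1 : ∑ j ∈ Finset.range k, 2 * (j + 1) = k * (k + 1) := by
    clear * -
    induction k with
    | zero => simp
    | succ k ih => rw [Finset.sum_range_succ, ih]; ring
  have e2 : Finset.range k ∩ Finset.Ico (2 * t + 1) (3 * t + 1) =
      Finset.Ico (2 * t + 1) (3 * t + 1) := by
    apply Finset.inter_eq_right.2
    intro j hj
    rw [Finset.mem_Ico] at hj
    rw [Finset.mem_range]
    omega
  rw [e1, e2, Finset.prod_const, Nat.card_Ico, inv_pow, ← pow_mul]
  rw [show 3 * t + 1 - (2 * t + 1) = t by omega, ← pow_mul, show 2 * t * t = 2 * t ^ 2 by ring]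

lemma exp_neg_eight_le : exp (-8) ≤ 1 / 1056 := by
  rw [exp_neg, one_div]
  apply inv_anti₀ (by norm_num)
  have h1 : exp 8 = exp 1 ^ 8 := by rw [← exp_nat_mul]; norm_num
  have h2 : (2.5 : ℝ) ≤ exp 1 := by linarith [exp_one_gt_d9]
  rw [h1]
  exact le_trans (by norm_num) (pow_le_pow_left₀ (by norm_num) h2 8)

lemma norm_bilinear_le {t r k : ℕ} (ht : 1 ≤ t) (hr : 2 ^ 34 ≤ r) (hk : k = 6 * t + 5)
    (α : ℕ → ℝ)
    (hα1 : ∀ j, 2 * t + 2 ≤ j → j ≤ 3 * t + 1 → |α j| * (r : ℝ) ^ (20 * (j - t - 1)) ≤ 1)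
    (hα2 : ∀ j, 2 * t + 2 ≤ j → j ≤ 3 * t + 1 →
      1 ≤ |α j| * (2 ^ (8 * t) * (r : ℝ) ^ (20 * (j - t)))) :
    ‖∑ a ∈ Finset.Ico (0 : ℤ) (r ^ 8 : ℕ), ∑ b ∈ Finset.Ico (0 : ℤ) (r ^ 8 : ℕ),
      ee (∑ j : Fin k, α (j + 1) * (momentCurve k a j * momentCurve k b j))‖ ≤
      exp 2 * ((r : ℝ) ^ 8) ^ 2 * (r : ℝ) ^ (-(1 / (5856400 * (t : ℝ) ^ 2))) := by
  obtain ⟨s, hs⟩ : ∃ s, s = 10 * k ^ 2 := ⟨_, rfl⟩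
  have hk2 : 2 ≤ k := by omega
  have hs1 : 1 ≤ s := by have := Nat.pow_pos (n := 2) (show 0 < k by omega); omega
  have hr1 : (1 : ℝ) ≤ r := by exact_mod_cast le_trans (by norm_num) hr
  have hr0 : (0 : ℝ) < r := by linarith
  have hkR : (2 : ℝ) ≤ k := by exact_mod_cast hk2
  have htR : (1 : ℝ) ≤ t := by exact_mod_cast ht
  have hk11 : (k : ℝ) ≤ 11 * t := by rw [hk]; push_cast; linarith
  have hsR : (s : ℝ) = 10 * (k : ℝ) ^ 2 := by rw [hs]; push_cast; ring
  obtain ⟨Q, hQ⟩ : ∃ Q : ℝ, Q = (r : ℝ) ^ 8 := ⟨_, rfl⟩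
  have hQ0 : 0 < Q := by rw [hQ]; positivity
  have h1 := norm_bilinear_pow_le (Q := r ^ 8) hs1 (fun j : Fin k => α (j + 1))
  have h2 := vino_mean_value hk2 (X := r ^ 8) (Nat.one_le_pow _ _ (by omega))
  rw [← hs] at h2
  have h3 := prod_zSum_le ht hr hk hs α hα1 hα2
  rw [← hQ] at h3 ⊢
  rw [show ((r ^ 8 : ℕ) : ℝ) = Q by rw [hQ]; push_cast; rfl] at h1 h2
  have h4 : ((Q ^ (2 * (s : ℝ) - (k : ℝ) * (k + 1) / 2 * (1 - exp (-8)))) ^ 2 * Q ^ (8 * s ^ 2 - 4 * s)) *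
      (Q ^ (k * (k + 1)) * ((r : ℝ) ^ (2 * t ^ 2))⁻¹) ≤ Q ^ (8 * s ^ 2) * (r : ℝ) ^ (-(t : ℝ) ^ 2) := by
    have e0 : 4 * s ≤ 8 * s ^ 2 := by nlinarith
    have e1 : Q = (r : ℝ) ^ (8 : ℝ) := by rw [hQ, ← rpow_natCast]; norm_num
    rw [← rpow_natCast _ 2, ← rpow_natCast _ (8 * s ^ 2 - 4 * s), ← rpow_natCast _ (k * (k + 1)),
      ← rpow_natCast _ (2 * t ^ 2), ← rpow_natCast _ (8 * s ^ 2), ← rpow_neg hr0.le, e1]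
    simp only [← rpow_mul hr0.le, ← rpow_add hr0]
    apply rpow_le_rpow_of_exponent_le hr1
    push_cast [Nat.cast_sub e0]
    have e2 := exp_neg_eight_le
    have e3 : (k : ℝ) * (k + 1) ≤ 132 * (t : ℝ) ^ 2 := by nlinarith
    have e4 : (k : ℝ) * (k + 1) * exp (-8) ≤ 132 * (t : ℝ) ^ 2 * (1 / 1056) := by
      gcongr
    nlinarith
  have h5 : exp (256 * (k : ℝ) ^ 4) ^ 2 * (3 * (s : ℝ)) ^ (2 * k) ≤ exp 2 ^ (4 * s ^ 2) := by
    have e1 : (3 * (s : ℝ)) ≤ exp (30 * (k : ℝ) ^ 2) := by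
      rw [hsR]; linarith [add_one_le_exp (30 * (k : ℝ) ^ 2)]
    refine (mul_le_mul_of_nonneg_left (pow_le_pow_left₀ (by positivity) e1 _) (by positivity)).trans ?_
    rw [← exp_nat_mul, ← exp_nat_mul, ← exp_nat_mul, ← exp_add, exp_le_exp]
    push_cast
    rw [hsR]
    have : (k : ℝ) ^ 3 ≤ (k : ℝ) ^ 4 := pow_le_pow_right₀ (by linarith) (by norm_num)
    nlinarith
  have h6 : (r : ℝ) ^ (-(t : ℝ) ^ 2) ≤ ((r : ℝ) ^ (-(1 / (5856400 * (t : ℝ) ^ 2)))) ^ (4 * s ^ 2) := by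
    rw [← rpow_natCast _ (4 * s ^ 2), ← rpow_mul hr0.le]
    apply rpow_le_rpow_of_exponent_le hr1
    push_cast
    rw [hsR, neg_mul, neg_le_neg_iff, one_div_mul_eq_div, div_le_iff₀ (by positivity)]
    have e1 : (k : ℝ) ^ 4 ≤ (11 * t) ^ 4 := by gcongr
    nlinarith
  refine le_of_pow_le_pow_left₀ (n := 4 * s ^ 2) (by positivity) (by positivity) ?_
  refine h1.trans ?_
  rw [mul_pow, mul_pow, ← pow_mul]
  calc _ ≤ Q ^ (8 * s ^ 2 - 4 * s) *
        (exp (256 * (k : ℝ) ^ 4) * Q ^ (2 * (s : ℝ) - (k : ℝ) * (k + 1) / 2 * (1 - exp (-8)))) ^ 2 *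
        ((3 * (s : ℝ)) ^ (2 * k) * Q ^ (k * (k + 1)) * ((r : ℝ) ^ (2 * t ^ 2))⁻¹) := by
        gcongr
        exact Finset.prod_nonneg fun _ _ => zSum_nonneg _ _
    _ = (exp (256 * (k : ℝ) ^ 4) ^ 2 * (3 * (s : ℝ)) ^ (2 * k)) *
        (((Q ^ (2 * (s : ℝ) - (k : ℝ) * (k + 1) / 2 * (1 - exp (-8)))) ^ 2 * Q ^ (8 * s ^ 2 - 4 * s)) *
        (Q ^ (k * (k + 1)) * ((r : ℝ) ^ (2 * t ^ 2))⁻¹)) := by ring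
    _ ≤ exp 2 ^ (4 * s ^ 2) * (Q ^ (8 * s ^ 2) * (r : ℝ) ^ (-(t : ℝ) ^ 2)) := by gcongr
    _ ≤ exp 2 ^ (4 * s ^ 2) * (Q ^ (8 * s ^ 2) *
        ((r : ℝ) ^ (-(1 / (5856400 * (t : ℝ) ^ 2)))) ^ (4 * s ^ 2)) := by gcongr
    _ = _ := by
        rw [show 2 * (4 * s ^ 2) = 8 * s ^ 2 by ring]
        ring

lemma abs_div_add_sub_expansion_le {y n z : ℝ} (hy : 0 ≤ y) (hn : 0 < n) (hz : 0 ≤ z) (k : ℕ) :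
    |y / (n + z) - (y / n + ∑ j : Fin k, (-1) ^ (j + 1 : ℕ) * y / n ^ (j + 1 + 1 : ℕ) *
      z ^ (j + 1 : ℕ))| ≤ y / n * (z / n) ^ (k + 1) := by
  have hnz : 0 < n + z := by linarith
  have e1 : y / n + ∑ j : Fin k, (-1) ^ (j + 1 : ℕ) * y / n ^ (j + 1 + 1 : ℕ) * z ^ (j + 1 : ℕ) =
      y / n * ∑ i ∈ Finset.range (k + 1), (-(z / n)) ^ i := by
    rw [Fin.sum_univ_eq_sum_range (fun j => (-1) ^ (j + 1 : ℕ) * y / n ^ (j + 1 + 1 : ℕ) *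
      z ^ (j + 1 : ℕ)) k, Finset.sum_range_succ', pow_zero, mul_add, mul_one, add_comm,
      Finset.mul_sum]
    congr 1
    apply Finset.sum_congr rfl
    intro j _
    rw [neg_pow (z / n), div_pow]
    field_simp
    ring
  have h1 := geom_sum_mul (-(z / n)) (k + 1)
  have e2 : y / (n + z) - y / n * ∑ i ∈ Finset.range (k + 1), (-(z / n)) ^ i =
      y / n * (-(z / n)) ^ (k + 1) * (n / (n + z)) := by
    have h2 : (-(z / n) - 1) = -((n + z) / n) := by field_simp; ring
    rw [h2] at h1
    have h3 : (-(z / n)) ^ (k + 1) = 1 - (∑ i ∈ Finset.range (k + 1), (-(z / n)) ^ i) * ((n + z) / n) := by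
      linarith
    rw [h3]
    field_simp
  rw [e1, e2, abs_mul, abs_mul, abs_pow, abs_neg, abs_of_nonneg (by positivity : 0 ≤ y / n),
    abs_of_nonneg (by positivity : 0 ≤ z / n), abs_of_nonneg (by positivity : 0 ≤ n / (n + z))]
  refine mul_le_of_le_one_right (by positivity) ?_
  rw [div_le_one hnz]
  linarith

lemma norm_shift_le {N B : ℕ} (hN : 1 ≤ N) (hNB : N ≤ B) (hB : B ≤ 2 * N) (y : ℝ) (z : ℕ) :
    ‖∑ n ∈ Finset.Ioc N B, ((1 / n : ℝ) : ℂ) * ee (y / n) -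
      ∑ n ∈ Finset.Ioc N B, ((1 / n : ℝ) : ℂ) * ee (y / ((n : ℝ) + z))‖ ≤ 3 * z / N := by
  have hNR : (1 : ℝ) ≤ N := by exact_mod_cast hN
  set f : ℕ → ℂ := fun m => ((1 / m : ℝ) : ℂ) * ee (y / m) with hf
  have hfn : ∀ m, N < m → ‖f m‖ ≤ 1 / N := by
    intro m hm
    have : (N : ℝ) ≤ m := by exact_mod_cast hm.le
    rw [hf]
    simp only [norm_mul, norm_ee, mul_one, Complex.norm_real, Real.norm_eq_abs]
    rw [abs_of_nonneg (by positivity)]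
    gcongr
  have htel : ∀ g : ℕ → ℂ, ∑ n ∈ Finset.Ioc N B, g (n + 1) =
      ∑ n ∈ Finset.Ioc N B, g n + (g (B + 1) - g (N + 1)) := by
    intro g
    clear hB
    induction B, hNB using Nat.le_induction with
    | base => simp
    | succ B hB ih2 =>
      rw [← Finset.insert_Ioc_right_eq_Ioc_add_one (by omega), Finset.sum_insert (by simp),
        Finset.sum_insert (by simp), ih2]
      ring
  have h1 : ∀ z : ℕ, ‖∑ n ∈ Finset.Ioc N B, f n - ∑ n ∈ Finset.Ioc N B, f (n + z)‖ ≤ 2 * z / N := by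
    intro z
    induction z with
    | zero => simp
    | succ z ih =>
      have h2 : ∑ n ∈ Finset.Ioc N B, f (n + (z + 1)) =
          ∑ n ∈ Finset.Ioc N B, f (n + z) + (f (B + z + 1) - f (N + z + 1)) := by
        have h3 := htel (fun n => f (n + z))
        simp only [add_right_comm _ 1 z] at h3
        simpa only [add_assoc] using h3
      rw [h2, ← sub_sub]
      refine (norm_sub_le _ _).trans ?_
      have h3 := norm_sub_le (f (B + z + 1)) (f (N + z + 1))
      have h4 := hfn (B + z + 1) (by omega)
      have h5 := hfn (N + z + 1) (by omega)
      have e : 2 * ((z + 1 : ℕ) : ℝ) / N = 2 * z / N + (1 / N + 1 / N) := by push_cast; ring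
      rw [e]
      linarith
  have h2 : ‖∑ n ∈ Finset.Ioc N B, f (n + z) -
      ∑ n ∈ Finset.Ioc N B, ((1 / n : ℝ) : ℂ) * ee (y / ((n : ℝ) + z))‖ ≤ z / N := by
    rw [← Finset.sum_sub_distrib]
    have h3 : ∀ n ∈ Finset.Ioc N B, ‖f (n + z) - ((1 / n : ℝ) : ℂ) * ee (y / ((n : ℝ) + z))‖ ≤
        z / N * (1 / N) := by
      intro n hn
      have hn' : (N : ℝ) ≤ n := by exact_mod_cast (Finset.mem_Ioc.1 hn).1.le
      have hn0 : (0 : ℝ) < n := by linarith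
      rw [hf]
      simp only [Nat.cast_add]
      rw [← sub_mul, norm_mul, norm_ee, mul_one, ← Complex.ofReal_sub, Complex.norm_real,
        Real.norm_eq_abs, abs_sub_comm]
      have e : 1 / (n : ℝ) - 1 / (n + z) = z / (n + z) * (1 / n) := by
        field_simp
        ring
      rw [e, abs_of_nonneg (by positivity)]
      gcongr
      linarith [(Nat.cast_nonneg z : (0 : ℝ) ≤ z)]
    refine (norm_sum_le _ _).trans ((Finset.sum_le_card_nsmul _ _ _ h3).trans ?_)
    rw [Nat.card_Ioc, nsmul_eq_mul]
    have h4 : ((B - N : ℕ) : ℝ) ≤ N := by exact_mod_cast (by omega : B - N ≤ N)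
    calc ((B - N : ℕ) : ℝ) * (z / N * (1 / N)) ≤ N * (z / N * (1 / N)) := by gcongr
      _ = z / N := by field_simp
  have h3 := norm_sub_le_norm_sub_add_norm_sub (∑ n ∈ Finset.Ioc N B, f n)
    (∑ n ∈ Finset.Ioc N B, f (n + z))
    (∑ n ∈ Finset.Ioc N B, ((1 / n : ℝ) : ℂ) * ee (y / ((n : ℝ) + z)))
  have e : 3 * (z : ℝ) / N = 2 * z / N + z / N := by ring
  rw [e]
  linarith [h1 z]

lemma exists_scale {M N : ℕ} (hM : 40 ≤ M) (hN : M ^ 20 ≤ N) :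
    ∃ r : ℕ, M ≤ r ∧ r ^ 20 ≤ N ∧ N ≤ 2 * r ^ 20 := by
  have hex : ∃ m, N < m ^ 20 := ⟨N + 1, (Nat.lt_succ_self N).trans_le (Nat.le_self_pow (by norm_num) _)⟩
  classical
  obtain ⟨m, hm1, hmin⟩ : ∃ m, N < m ^ 20 ∧ ∀ l < m, ¬ N < l ^ 20 :=
    ⟨Nat.find hex, Nat.find_spec hex, fun l hl => Nat.find_min hex hl⟩
  have hm2 : M < m := by
    by_contra h
    exact absurd ((Nat.pow_le_pow_left (not_lt.1 h) 20).trans hN) (not_le.2 hm1)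
  obtain ⟨r, rfl⟩ : ∃ r, m = r + 1 := ⟨m - 1, by omega⟩
  have hm3 : r ^ 20 ≤ N := not_lt.1 (hmin r (by omega))
  refine ⟨r, by omega, hm3, ?_⟩
  have hrR : (40 : ℝ) ≤ r := by exact_mod_cast hM.trans (Nat.lt_succ_iff.1 hm2)
  have h1 : (((r + 1 : ℕ) : ℝ)) ^ 20 ≤ 2 * (r : ℝ) ^ 20 := by
    have h2 : ((r + 1 : ℕ) : ℝ) ≤ (1 + 1 / 40) * r := by push_cast; linarith
    have h3 := pow_le_pow_left₀ (Nat.cast_nonneg _) h2 20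
    rw [mul_pow] at h3
    exact h3.trans (mul_le_mul_of_nonneg_right (by norm_num) (pow_nonneg (Nat.cast_nonneg _) 20))
  have h2 : (r + 1) ^ 20 ≤ 2 * r ^ 20 := by
    rw [← Nat.cast_le (α := ℝ), Nat.cast_pow, Nat.cast_mul, Nat.cast_pow]
    exact h1
  exact hm1.le.trans h2

lemma norm_ee_sub_ee_le (u v : ℝ) : ‖ee u - ee v‖ ≤ 2 * π * |u - v| := by
  have h : ee u - ee v = ee v * (ee (u - v) - 1) := by
    rw [mul_sub, ← ee_add, mul_one, add_sub_cancel]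
  rw [h, norm_mul, norm_ee, one_mul]
  exact norm_ee_sub_one_le _

lemma norm_double_sum_le {t r N n : ℕ} (ht : 1 ≤ t) (hr : 2 ^ 34 ≤ r) (hrN : r ^ 20 ≤ N)
    (hNr : N ≤ 2 * r ^ 20) (hn : N ≤ n) (hn2 : n ≤ 2 * N) {y : ℝ} (hy1 : (N : ℝ) ^ (t + 1) ≤ y)
    (hy2 : y ≤ (N : ℝ) ^ (t + 2)) :
    ‖∑ a ∈ Finset.Ico (0 : ℤ) (r ^ 8 : ℕ), ∑ b ∈ Finset.Ico (0 : ℤ) (r ^ 8 : ℕ),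
      ee (y / ((n : ℝ) + (a : ℝ) * b))‖ ≤
      (exp 2 + 2 * π) * ((r : ℝ) ^ 8) ^ 2 * (r : ℝ) ^ (-(1 / (5856400 * (t : ℝ) ^ 2))) := by
  obtain ⟨k, hk⟩ : ∃ k, k = 6 * t + 5 := ⟨_, rfl⟩
  have hr2 : (2 : ℝ) ≤ r := by
    have : 2 ≤ r := le_trans (by norm_num) hr
    exact_mod_cast this
  have hr0 : (0 : ℝ) < r := by linarith
  have hrNR : (r : ℝ) ^ 20 ≤ N := by exact_mod_cast hrN
  have hNrR : (N : ℝ) ≤ 2 * (r : ℝ) ^ 20 := by exact_mod_cast hNr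
  have hnR : (N : ℝ) ≤ n := by exact_mod_cast hn
  have hn2R : (n : ℝ) ≤ 2 * N := by exact_mod_cast hn2
  have hN0 : (0 : ℝ) < N := lt_of_lt_of_le (by positivity) hrNR
  have hn0 : (0 : ℝ) < n := lt_of_lt_of_le hN0 hnR
  have hy0 : 0 ≤ y := le_trans (by positivity) hy1
  have hyn : y ≤ (n : ℝ) ^ (t + 2) := hy2.trans (by gcongr)
  have habs : ∀ j : ℕ, |(-1) ^ j * y / (n : ℝ) ^ (j + 1)| = y / (n : ℝ) ^ (j + 1) := by
    intro j
    rw [abs_div, abs_mul, abs_pow, abs_neg, abs_one, one_pow, one_mul, abs_of_nonneg hy0,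
      abs_of_nonneg (by positivity)]
  have hmain := norm_bilinear_le ht hr hk (fun j => (-1) ^ j * y / (n : ℝ) ^ (j + 1))
    (fun j hj1 hj2 => ?_) (fun j hj1 hj2 => ?_)
  rotate_left
  · rw [habs]
    have h1 : (r : ℝ) ^ (20 * (j - t - 1)) ≤ (n : ℝ) ^ (j - t - 1) := by
      rw [pow_mul]
      gcongr
      linarith
    calc y / (n : ℝ) ^ (j + 1) * (r : ℝ) ^ (20 * (j - t - 1))
        ≤ (n : ℝ) ^ (t + 2) / (n : ℝ) ^ (j + 1) * (n : ℝ) ^ (j - t - 1) := by gcongr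
      _ = 1 := by
        rw [div_mul_eq_mul_div, ← pow_add, show t + 2 + (j - t - 1) = j + 1 by omega]
        exact div_self (by positivity)
  · rw [habs]
    obtain ⟨i, rfl⟩ : ∃ i, j = t + i := ⟨j - t, by omega⟩
    rw [Nat.add_sub_cancel_left]
    have h1 : (N : ℝ) ^ i ≤ 2 ^ i * (r : ℝ) ^ (20 * i) := by
      rw [pow_mul, ← mul_pow]
      gcongr
    have h2 : (n : ℝ) ^ (t + i + 1) ≤ 2 ^ (t + i + 1) * (N : ℝ) ^ (t + i + 1) := by
      rw [← mul_pow]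
      gcongr
    have h3 : (2 : ℝ) ^ (t + i + 1) * 2 ^ i ≤ 2 ^ (8 * t) := by
      rw [← pow_add]
      exact pow_le_pow_right₀ (by norm_num) (by omega)
    rw [div_mul_eq_mul_div, one_le_div (by positivity)]
    calc (n : ℝ) ^ (t + i + 1) ≤ 2 ^ (t + i + 1) * (N : ℝ) ^ (t + i + 1) := h2
      _ = 2 ^ (t + i + 1) * ((N : ℝ) ^ (t + 1) * (N : ℝ) ^ i) := by
        rw [← pow_add, show t + 1 + i = t + i + 1 by ring]
      _ ≤ 2 ^ (t + i + 1) * (y * (2 ^ i * (r : ℝ) ^ (20 * i))) := by gcongr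
      _ = (2 ^ (t + i + 1) * 2 ^ i) * (y * (r : ℝ) ^ (20 * i)) := by ring
      _ ≤ 2 ^ (8 * t) * (y * (r : ℝ) ^ (20 * i)) := by gcongr
      _ = y * (2 ^ (8 * t) * (r : ℝ) ^ (20 * i)) := by ring
  have hrem : ∀ z : ℝ, 0 ≤ z → z ≤ (r : ℝ) ^ 16 → y / n * (z / n) ^ (k + 1) ≤ 1 / r := by
    intro z hz0 hz
    have h1 : y / n ≤ (2 * (r : ℝ) ^ 20) ^ (t + 1) := by
      rw [div_le_iff₀ hn0]
      calc y ≤ (N : ℝ) ^ (t + 2) := hy2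
        _ = (N : ℝ) ^ (t + 1) * N := pow_succ _ _
        _ ≤ (2 * (r : ℝ) ^ 20) ^ (t + 1) * n := by gcongr
    have h2 : z / n ≤ 1 / (r : ℝ) ^ 4 := by
      rw [div_le_div_iff₀ hn0 (by positivity)]
      calc z * (r : ℝ) ^ 4 ≤ (r : ℝ) ^ 16 * (r : ℝ) ^ 4 := by gcongr
        _ = (r : ℝ) ^ 20 := by ring
        _ ≤ 1 * n := by linarith
    have h3 : 2 * (r : ℝ) ^ 20 * (1 / (r : ℝ) ^ 4) ^ 6 ≤ 1 / r := by
      have e : 2 * (r : ℝ) ^ 20 * (1 / (r : ℝ) ^ 4) ^ 6 = 2 / (r : ℝ) ^ 4 := by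
        field_simp
      rw [e, div_le_div_iff₀ (by positivity) hr0]
      nlinarith [pow_le_pow_left₀ (by norm_num) hr2 3, hr0]
    calc y / n * (z / n) ^ (k + 1)
        ≤ (2 * (r : ℝ) ^ 20) ^ (t + 1) * (1 / (r : ℝ) ^ 4) ^ (k + 1) := by gcongr
      _ = (2 * (r : ℝ) ^ 20 * (1 / (r : ℝ) ^ 4) ^ 6) ^ (t + 1) := by
        rw [mul_pow _ ((1 / (r : ℝ) ^ 4) ^ 6), ← pow_mul (1 / (r : ℝ) ^ 4), hk]
        ring_nf
      _ ≤ (1 / (r : ℝ)) ^ (t + 1) := by gcongr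
      _ ≤ 1 / r := by
        refine pow_le_of_le_one (by positivity) ?_ (by omega)
        rw [div_le_one hr0]
        linarith
  have hpow : 1 / (r : ℝ) ≤ (r : ℝ) ^ (-(1 / (5856400 * (t : ℝ) ^ 2))) := by
    rw [one_div, ← rpow_neg_one]
    apply rpow_le_rpow_of_exponent_le (by linarith)
    have : (1 : ℝ) ≤ t := by exact_mod_cast ht
    rw [neg_le_neg_iff, div_le_one (by positivity)]
    nlinarith
  obtain ⟨E, hE⟩ : ∃ E, E = (r : ℝ) ^ (-(1 / (5856400 * (t : ℝ) ^ 2))) := ⟨_, rfl⟩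
  rw [← hE] at hmain hpow ⊢
  obtain ⟨V, hV⟩ : ∃ V : ℤ → ℤ → ℂ, V = fun a b => ee (∑ j : Fin k,
    (-1) ^ ((j : ℕ) + 1) * y / (n : ℝ) ^ ((j : ℕ) + 1 + 1) *
      (momentCurve k a j * momentCurve k b j)) := ⟨_, rfl⟩
  have hV2 : ‖∑ a ∈ Finset.Ico (0 : ℤ) (r ^ 8 : ℕ), ∑ b ∈ Finset.Ico (0 : ℤ) (r ^ 8 : ℕ),
      V a b‖ ≤ exp 2 * ((r : ℝ) ^ 8) ^ 2 * E := by
    rw [hV]; exact hmain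
  have hcard : ((Finset.Ico (0 : ℤ) (r ^ 8 : ℕ)).card : ℝ) = (r : ℝ) ^ 8 := by
    rw [Int.card_Ico, sub_zero, Int.toNat_natCast, Nat.cast_pow]
  have hterm : ∀ a ∈ Finset.Ico (0 : ℤ) (r ^ 8 : ℕ), ∀ b ∈ Finset.Ico (0 : ℤ) (r ^ 8 : ℕ),
      ‖ee (y / ((n : ℝ) + (a : ℝ) * b)) - ee (y / n) * V a b‖ ≤ 2 * π * E := by
    intro a ha b hb
    rw [Finset.mem_Ico] at ha hb
    have ha0 : (0 : ℝ) ≤ a := by exact_mod_cast ha.1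
    have hb0 : (0 : ℝ) ≤ b := by exact_mod_cast hb.1
    have ha1 : (a : ℝ) ≤ (r : ℝ) ^ 8 := by exact_mod_cast ha.2.le
    have hb1 : (b : ℝ) ≤ (r : ℝ) ^ 8 := by exact_mod_cast hb.2.le
    rw [hV]
    simp only
    rw [← ee_add]
    refine (norm_ee_sub_ee_le _ _).trans ?_
    gcongr
    refine le_trans ?_ ((hrem ((a : ℝ) * b) (by positivity) ?_).trans hpow)
    · have := abs_div_add_sub_expansion_le hy0 hn0 (by positivity : 0 ≤ (a : ℝ) * b) k
      simp only [mul_pow] at this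
      simpa only [momentCurve, Int.cast_pow] using this
    · calc (a : ℝ) * b ≤ (r : ℝ) ^ 8 * (r : ℝ) ^ 8 := by gcongr
        _ = (r : ℝ) ^ 16 := by ring
  have hdiff : ‖∑ a ∈ Finset.Ico (0 : ℤ) (r ^ 8 : ℕ), ∑ b ∈ Finset.Ico (0 : ℤ) (r ^ 8 : ℕ),
      ee (y / ((n : ℝ) + (a : ℝ) * b)) - ee (y / n) *
      ∑ a ∈ Finset.Ico (0 : ℤ) (r ^ 8 : ℕ), ∑ b ∈ Finset.Ico (0 : ℤ) (r ^ 8 : ℕ), V a b‖ ≤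
      ((r : ℝ) ^ 8) ^ 2 * (2 * π * E) := by
    simp_rw [Finset.mul_sum, ← Finset.sum_sub_distrib]
    have h1 : ∀ a ∈ Finset.Ico (0 : ℤ) (r ^ 8 : ℕ), ‖∑ b ∈ Finset.Ico (0 : ℤ) (r ^ 8 : ℕ),
        (ee (y / ((n : ℝ) + (a : ℝ) * b)) - ee (y / n) * V a b)‖ ≤ (r : ℝ) ^ 8 * (2 * π * E) := by
      intro a ha
      refine (norm_sum_le _ _).trans ((Finset.sum_le_card_nsmul _ _ _ (hterm a ha)).trans ?_)
      rw [nsmul_eq_mul, hcard]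
    refine (norm_sum_le _ _).trans ((Finset.sum_le_card_nsmul _ _ _ h1).trans ?_)
    rw [nsmul_eq_mul, hcard]
    apply le_of_eq
    ring
  have h4 := norm_le_norm_sub_add (∑ a ∈ Finset.Ico (0 : ℤ) (r ^ 8 : ℕ),
    ∑ b ∈ Finset.Ico (0 : ℤ) (r ^ 8 : ℕ), ee (y / ((n : ℝ) + (a : ℝ) * b)))
    (ee (y / n) * ∑ a ∈ Finset.Ico (0 : ℤ) (r ^ 8 : ℕ), ∑ b ∈ Finset.Ico (0 : ℤ) (r ^ 8 : ℕ), V a b)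
  rw [norm_mul, norm_ee, one_mul] at h4
  calc _ ≤ _ := h4
    _ ≤ ((r : ℝ) ^ 8) ^ 2 * (2 * π * E) + exp 2 * ((r : ℝ) ^ 8) ^ 2 * E := add_le_add hdiff hV2
    _ = _ := by ring

lemma sum_one_div_Ioc_le {N B : ℕ} (hN : 1 ≤ N) (hB : B ≤ 2 * N) :
    ∑ n ∈ Finset.Ioc N B, 1 / (n : ℝ) ≤ 1 := by
  have hN0 : (0 : ℝ) < N := by exact_mod_cast hN
  have h1 : ∀ n ∈ Finset.Ioc N B, 1 / (n : ℝ) ≤ 1 / N := by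
    intro n hn
    have : (N : ℝ) ≤ n := by exact_mod_cast (Finset.mem_Ioc.1 hn).1.le
    gcongr
  refine (Finset.sum_le_card_nsmul _ _ _ h1).trans ?_
  rw [Nat.card_Ioc, nsmul_eq_mul, mul_one_div, div_le_one hN0]
  exact_mod_cast (by omega : B - N ≤ N)

lemma norm_sum_one_div_mul_le {s : Finset ℕ} {f : ℕ → ℂ} {c : ℝ} (hc : 0 ≤ c)
    (hs : ∑ n ∈ s, 1 / (n : ℝ) ≤ 1) (hf : ∀ n ∈ s, ‖f n‖ ≤ c) :
    ‖∑ n ∈ s, ((1 / n : ℝ) : ℂ) * f n‖ ≤ c := by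
  calc ‖∑ n ∈ s, ((1 / n : ℝ) : ℂ) * f n‖ ≤ ∑ n ∈ s, 1 / (n : ℝ) * c := by
        refine norm_sum_le_of_le _ fun n hn => ?_
        rw [norm_mul, Complex.norm_real, Real.norm_eq_abs, abs_of_nonneg (by positivity)]
        exact mul_le_mul_of_nonneg_left (hf n hn) (by positivity)
    _ = (∑ n ∈ s, 1 / (n : ℝ)) * c := by rw [Finset.sum_mul]
    _ ≤ c := mul_le_of_le_one_left hc hs

lemma norm_block_le_of_scale {t r N B : ℕ} (ht : 1 ≤ t) (hr : 2 ^ 34 ≤ r) (hrN : r ^ 20 ≤ N)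
    (hNr : N ≤ 2 * r ^ 20) (hNB : N ≤ B) (hB : B ≤ 2 * N) {y : ℝ}
    (hy1 : (N : ℝ) ^ (t + 1) ≤ y) (hy2 : y ≤ (N : ℝ) ^ (t + 2)) :
    ‖∑ n ∈ Finset.Ioc N B, ((1 / n : ℝ) : ℂ) * ee (y / n)‖ ≤
      (exp 2 + 2 * π + 3) * (r : ℝ) ^ (-(1 / (5856400 * (t : ℝ) ^ 2))) := by
  have hr2 : (2 : ℝ) ≤ r := by
    have : 2 ≤ r := le_trans (by norm_num) hr
    exact_mod_cast this
  have hr0 : (0 : ℝ) < r := by linarith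
  have hrNR : (r : ℝ) ^ 20 ≤ N := by exact_mod_cast hrN
  have hN1R : (1 : ℝ) ≤ N := (one_le_pow₀ (by linarith)).trans hrNR
  have hN1 : 1 ≤ N := by exact_mod_cast hN1R
  have hdouble : ∀ n ∈ Finset.Ioc N B, _ := fun n hn =>
    norm_double_sum_le ht hr hrN hNr (Finset.mem_Ioc.1 hn).1.le
      ((Finset.mem_Ioc.1 hn).2.trans hB) hy1 hy2
  have hpow : 1 / (r : ℝ) ≤ (r : ℝ) ^ (-(1 / (5856400 * (t : ℝ) ^ 2))) := by
    rw [one_div, ← rpow_neg_one]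
    apply rpow_le_rpow_of_exponent_le (by linarith)
    have : (1 : ℝ) ≤ t := by exact_mod_cast ht
    rw [neg_le_neg_iff, div_le_one (by positivity)]
    nlinarith
  obtain ⟨E, hE⟩ : ∃ E, E = (r : ℝ) ^ (-(1 / (5856400 * (t : ℝ) ^ 2))) := ⟨_, rfl⟩
  rw [← hE] at hpow ⊢
  rw [← hE] at hdouble
  have hE0 : 0 ≤ E := le_trans (by positivity) hpow
  obtain ⟨I, hI⟩ : ∃ I, I = Finset.Ico (0 : ℤ) (r ^ 8 : ℕ) := ⟨_, rfl⟩
  rw [← hI] at hdouble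
  have hcard : (I.card : ℝ) = (r : ℝ) ^ 8 := by
    rw [hI, Int.card_Ico, sub_zero, Int.toNat_natCast, Nat.cast_pow]
  obtain ⟨T, hT⟩ : ∃ T, T = ∑ n ∈ Finset.Ioc N B, ((1 / n : ℝ) : ℂ) * ee (y / n) := ⟨_, rfl⟩
  rw [← hT]
  have h1 : ‖∑ n ∈ Finset.Ioc N B, ((1 / n : ℝ) : ℂ) *
      ∑ a ∈ I, ∑ b ∈ I, ee (y / ((n : ℝ) + (a : ℝ) * b))‖ ≤
      (exp 2 + 2 * π) * ((r : ℝ) ^ 8) ^ 2 * E :=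
    norm_sum_one_div_mul_le (by positivity) (sum_one_div_Ioc_le hN1 hB) hdouble
  have h2 : ∀ a ∈ I, ∀ b ∈ I, ‖T - ∑ n ∈ Finset.Ioc N B, ((1 / n : ℝ) : ℂ) *
      ee (y / ((n : ℝ) + (a : ℝ) * b))‖ ≤ 3 * E := by
    intro a ha b hb
    rw [hI, Finset.mem_Ico] at ha hb
    obtain ⟨a, rfl⟩ := Int.eq_ofNat_of_zero_le ha.1
    obtain ⟨b, rfl⟩ := Int.eq_ofNat_of_zero_le hb.1
    have ha1 : (a : ℝ) ≤ (r : ℝ) ^ 8 := by exact_mod_cast ha.2.le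
    have hb1 : (b : ℝ) ≤ (r : ℝ) ^ 8 := by exact_mod_cast hb.2.le
    have h3 := norm_shift_le hN1 hNB hB y (a * b)
    rw [← hT] at h3
    push_cast at h3 ⊢
    refine h3.trans ?_
    have h4 : (a : ℝ) * b / N ≤ 1 / r := by
      rw [div_le_div_iff₀ (by linarith) hr0]
      calc (a : ℝ) * b * r ≤ (r : ℝ) ^ 8 * (r : ℝ) ^ 8 * r := by gcongr
        _ = (r : ℝ) ^ 17 := by ring
        _ ≤ (r : ℝ) ^ 20 := pow_le_pow_right₀ (by linarith) (by norm_num)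
        _ ≤ 1 * N := by linarith
    rw [mul_div_assoc]
    linarith
  have h3 : ‖∑ a ∈ I, ∑ b ∈ I, (T - ∑ n ∈ Finset.Ioc N B, ((1 / n : ℝ) : ℂ) *
      ee (y / ((n : ℝ) + (a : ℝ) * b)))‖ ≤ ((r : ℝ) ^ 8) ^ 2 * (3 * E) := by
    have h4 : ∀ a ∈ I, ‖∑ b ∈ I, (T - ∑ n ∈ Finset.Ioc N B, ((1 / n : ℝ) : ℂ) *
        ee (y / ((n : ℝ) + (a : ℝ) * b)))‖ ≤ (r : ℝ) ^ 8 * (3 * E) := by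
      intro a ha
      refine (norm_sum_le _ _).trans ((Finset.sum_le_card_nsmul _ _ _ (h2 a ha)).trans ?_)
      rw [nsmul_eq_mul, hcard]
    refine (norm_sum_le _ _).trans ((Finset.sum_le_card_nsmul _ _ _ h4).trans ?_)
    rw [nsmul_eq_mul, hcard]
    apply le_of_eq
    ring
  have h4 : ∑ a ∈ I, ∑ b ∈ I, (T - ∑ n ∈ Finset.Ioc N B, ((1 / n : ℝ) : ℂ) *
      ee (y / ((n : ℝ) + (a : ℝ) * b))) = (((r : ℝ) ^ 8) ^ 2 : ℝ) * T -
      ∑ n ∈ Finset.Ioc N B, ((1 / n : ℝ) : ℂ) *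
        ∑ a ∈ I, ∑ b ∈ I, ee (y / ((n : ℝ) + (a : ℝ) * b)) := by
    simp_rw [Finset.sum_sub_distrib, Finset.mul_sum]
    congr 1
    · rw [← hcard]
      simp only [Finset.sum_const, nsmul_eq_mul]
      push_cast
      ring
    · rw [Finset.sum_comm (s := Finset.Ioc N B)]
      refine Finset.sum_congr rfl fun b _ => ?_
      rw [Finset.sum_comm (s := Finset.Ioc N B)]
  rw [h4] at h3
  have h5 := norm_le_norm_sub_add ((((r : ℝ) ^ 8) ^ 2 : ℝ) * T)
    (∑ n ∈ Finset.Ioc N B, ((1 / n : ℝ) : ℂ) *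
      ∑ a ∈ I, ∑ b ∈ I, ee (y / ((n : ℝ) + (a : ℝ) * b)))
  rw [norm_mul, Complex.norm_real, Real.norm_eq_abs, abs_of_nonneg (by positivity)] at h5
  have hQ : (0 : ℝ) < ((r : ℝ) ^ 8) ^ 2 := by positivity
  refine le_of_mul_le_mul_left ?_ hQ
  calc ((r : ℝ) ^ 8) ^ 2 * ‖T‖ ≤ _ := h5
    _ ≤ ((r : ℝ) ^ 8) ^ 2 * (3 * E) + (exp 2 + 2 * π) * ((r : ℝ) ^ 8) ^ 2 * E := add_le_add h3 h1
    _ = _ := by ring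

lemma exists_norm_block_le : ∃ C c : ℝ, 0 < C ∧ 0 < c ∧ c ≤ 1 ∧ ∀ (t N B : ℕ) (y : ℝ), 1 ≤ t → 1 ≤ N →
    N ≤ B → B ≤ 2 * N → (N : ℝ) ^ (t + 1) ≤ y → y ≤ (N : ℝ) ^ (t + 2) →
    ‖∑ n ∈ Finset.Ioc N B, ((1 / n : ℝ) : ℂ) * ee (y / n)‖ ≤ C * (N : ℝ) ^ (-(c / (t : ℝ) ^ 2)) := by
  obtain ⟨M, hM, hM40⟩ : ∃ M : ℕ, 2 ^ 34 ≤ M ∧ 40 ≤ M := ⟨2 ^ 34, le_rfl, by norm_num⟩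
  obtain ⟨L, hL⟩ : ∃ L : ℕ, L = M ^ 20 := ⟨_, rfl⟩
  refine ⟨exp 2 + 2 * π + 3 + L, 1 / (40 * 5856400), by positivity, by positivity, by norm_num, ?_⟩
  intro t N B y ht hN hNB hB hy1 hy2
  have htR : (1 : ℝ) ≤ t := by exact_mod_cast ht
  have hNR : (1 : ℝ) ≤ N := by exact_mod_cast hN
  rcases le_or_gt L N with h | h
  · obtain ⟨r, hr1, hr2, hr3⟩ := exists_scale hM40 (hL ▸ h)
    refine (norm_block_le_of_scale ht (hM.trans hr1) hr2 hr3 hNB hB hy1 hy2).trans ?_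
    have hr0 : (2 : ℝ) ≤ r := by exact_mod_cast (by omega : 2 ≤ r)
    have hNr : (N : ℝ) ≤ (r : ℝ) ^ (40 : ℝ) := by
      have h3 : (N : ℝ) ≤ 2 * (r : ℝ) ^ 20 := by exact_mod_cast hr3
      have h4 : (2 : ℝ) ≤ (r : ℝ) ^ 20 := hr0.trans (le_self_pow₀ (by linarith) (by norm_num))
      have h5 : (r : ℝ) ^ (40 : ℝ) = (r : ℝ) ^ 20 * (r : ℝ) ^ 20 := by
        rw [← pow_add, ← rpow_natCast _ (20 + 20)]
        norm_num
      rw [h5]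
      nlinarith
    have h3 : (r : ℝ) ^ (-(1 / (5856400 * (t : ℝ) ^ 2))) ≤
        (N : ℝ) ^ (-(1 / (40 * 5856400) / (t : ℝ) ^ 2)) := by
      have e : (r : ℝ) ^ (-(1 / (5856400 * (t : ℝ) ^ 2))) =
          ((r : ℝ) ^ (40 : ℝ)) ^ (-(1 / (40 * 5856400) / (t : ℝ) ^ 2)) := by
        rw [← rpow_mul (by linarith)]
        congr 1
        field_simp
      rw [e]
      exact rpow_le_rpow_of_nonpos (by linarith) hNr (by rw [neg_nonpos]; positivity)
    have hL0 : (0 : ℝ) ≤ L := Nat.cast_nonneg _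
    exact mul_le_mul (by linarith) h3 (by positivity) (by positivity)
  · have h1 : ‖∑ n ∈ Finset.Ioc N B, ((1 / n : ℝ) : ℂ) * ee (y / n)‖ ≤ 1 :=
      norm_sum_one_div_mul_le zero_le_one (sum_one_div_Ioc_le hN hB) fun n _ => (norm_ee _).le
    refine h1.trans ?_
    have h2 : (1 : ℝ) / N ≤ (N : ℝ) ^ (-(1 / (40 * 5856400) / (t : ℝ) ^ 2)) := by
      rw [one_div, ← rpow_neg_one]
      apply rpow_le_rpow_of_exponent_le hNR
      rw [neg_le_neg_iff, div_le_one (by positivity)]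
      nlinarith
    have h3 : (N : ℝ) ≤ L := by exact_mod_cast h.le
    calc (1 : ℝ) = N * (1 / N) := by field_simp
      _ ≤ (exp 2 + 2 * π + 3 + L) * (N : ℝ) ^ (-(1 / (40 * 5856400) / (t : ℝ) ^ 2)) := by
        gcongr
        have : 0 < exp 2 + 2 * π + 3 := by positivity
        linarith

/-- The sawtooth function `{y} - 1/2`. -/
noncomputable def saw (y : ℝ) : ℝ := Int.fract y - 1 / 2

/-- The periodic second Bernoulli function. -/
noncomputable def bern (y : ℝ) : ℝ := Int.fract y ^ 2 - Int.fract y + 1 / 6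

lemma saw_lower {y d : ℝ} (hd : 0 < d) (hd1 : d ≤ 1) :
    (bern (y + d) - bern y) / (2 * d) - d / 2 ≤ saw y := by
  have hf0 := Int.fract_nonneg y
  have hf1 := Int.fract_lt_one y
  have hy := Int.self_sub_fract y
  rw [saw, bern, bern, sub_le_iff_le_add, div_le_iff₀ (by positivity)]
  obtain ⟨f, hf⟩ : ∃ f, f = Int.fract y := ⟨_, rfl⟩
  rw [← hf] at hf0 hf1 hy ⊢
  rcases lt_or_ge (f + d) 1 with h | h
  · have : Int.fract (y + d) = f + d :=
      Int.fract_eq_iff.2 ⟨by linarith, h, ⌊y⌋, by linarith⟩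
    rw [this]
    nlinarith
  · have : Int.fract (y + d) = f + d - 1 :=
      Int.fract_eq_iff.2 ⟨by linarith, by linarith, ⌊y⌋ + 1, by push_cast; linarith⟩
    rw [this]
    nlinarith

lemma saw_upper {y d : ℝ} (hd : 0 < d) (hd1 : d ≤ 1) :
    saw y ≤ (bern y - bern (y + -d)) / (2 * d) + d / 2 := by
  have hf0 := Int.fract_nonneg y
  have hf1 := Int.fract_lt_one y
  have hy := Int.self_sub_fract y
  rw [saw, bern, bern, ← sub_le_iff_le_add, le_div_iff₀ (by positivity)]
  obtain ⟨f, hf⟩ : ∃ f, f = Int.fract y := ⟨_, rfl⟩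
  rw [← hf] at hf0 hf1 hy ⊢
  rcases le_or_gt d f with h | h
  · have : Int.fract (y + -d) = f - d :=
      Int.fract_eq_iff.2 ⟨by linarith, by linarith, ⌊y⌋, by linarith⟩
    rw [this]
    nlinarith
  · have : Int.fract (y + -d) = f - d + 1 :=
      Int.fract_eq_iff.2 ⟨by linarith, by linarith, ⌊y⌋ - 1, by push_cast; linarith⟩
    rw [this]
    nlinarith

lemma hasSum_bern (y : ℝ) :
    HasSum (fun h : ℕ => 1 / (h : ℝ) ^ 2 * cos (2 * π * h * y)) (π ^ 2 * bern y) := by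
  have h1 := hasSum_one_div_nat_pow_mul_cos (k := 1) one_ne_zero
    (x := Int.fract y) ⟨Int.fract_nonneg y, (Int.fract_lt_one y).le⟩
  have e : ∀ h : ℕ, cos (2 * π * h * Int.fract y) = cos (2 * π * h * y) := by
    intro h
    have := Real.cos_sub_int_mul_two_pi (2 * π * h * y) (h * ⌊y⌋)
    rw [← this]
    congr 1
    rw [Int.fract]
    push_cast
    ring
  simp only [e] at h1
  convert h1 using 1
  rw [bern]
  simp [Polynomial.bernoulli, Finset.sum_range_succ, bernoulli, bernoulli'_two]
  ring

lemma abs_sum_bern_le {s : Finset ℕ} {x d A : ℝ}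
    (hA : ∀ h : ℕ, 1 ≤ h → ‖∑ n ∈ s, ((1 / n : ℝ) : ℂ) * ee (h * x / n)‖ ≤ A * (h : ℝ) ^ (1 / 2 : ℝ)) :
    |∑ n ∈ s, 1 / (n : ℝ) * bern (x / n + d)| ≤ A * ∑' h : ℕ, 1 / (h : ℝ) ^ (3 / 2 : ℝ) := by
  have hs : Summable fun h : ℕ => 1 / (h : ℝ) ^ (3 / 2 : ℝ) :=
    Real.summable_one_div_nat_rpow.2 (by norm_num)
  have h1 : HasSum (fun h : ℕ => ∑ n ∈ s, 1 / (n : ℝ) * (1 / (h : ℝ) ^ 2 *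
      cos (2 * π * h * (x / n + d)))) (∑ n ∈ s, 1 / (n : ℝ) * (π ^ 2 * bern (x / n + d))) :=
    hasSum_sum fun n _ => (hasSum_bern (x / n + d)).mul_left _
  have h2 : ∀ h : ℕ, |∑ n ∈ s, 1 / (n : ℝ) * (1 / (h : ℝ) ^ 2 *
      cos (2 * π * h * (x / n + d)))| ≤ A * (1 / (h : ℝ) ^ (3 / 2 : ℝ)) := by
    intro h
    rcases Nat.eq_zero_or_pos h with rfl | hh
    · simp
    have hh0 : (0 : ℝ) < h := by exact_mod_cast hh
    have e : ∑ n ∈ s, 1 / (n : ℝ) * (1 / (h : ℝ) ^ 2 * cos (2 * π * h * (x / n + d))) =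
        1 / (h : ℝ) ^ 2 * (ee (h * d) * ∑ n ∈ s, ((1 / n : ℝ) : ℂ) * ee (h * x / n)).re := by
      rw [Finset.mul_sum, Complex.re_sum, Finset.mul_sum]
      refine Finset.sum_congr rfl fun n _ => ?_
      rw [mul_left_comm, mul_left_comm (ee _), ← ee_add, Complex.re_ofReal_mul, ee,
        Complex.exp_ofReal_mul_I_re]
      rw [show 2 * π * (h * d + h * x / n) = 2 * π * h * (x / n + d) by ring]
    rw [e, abs_mul, abs_of_nonneg (by positivity)]
    have h3 := Complex.abs_re_le_norm (ee (h * d) * ∑ n ∈ s, ((1 / n : ℝ) : ℂ) * ee (h * x / n))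
    rw [norm_mul, norm_ee, one_mul] at h3
    have e2 : (h : ℝ) ^ 2 = (h : ℝ) ^ (3 / 2 : ℝ) * (h : ℝ) ^ (1 / 2 : ℝ) := by
      rw [← rpow_add hh0, ← rpow_natCast]
      norm_num
    calc 1 / (h : ℝ) ^ 2 * |(ee (h * d) * ∑ n ∈ s, ((1 / n : ℝ) : ℂ) * ee (h * x / n)).re|
        ≤ 1 / (h : ℝ) ^ 2 * (A * (h : ℝ) ^ (1 / 2 : ℝ)) := by
          gcongr
          exact h3.trans (hA h hh)
      _ = A * (1 / (h : ℝ) ^ (3 / 2 : ℝ)) := by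
        rw [e2]
        field_simp
  have h3 : |∑ n ∈ s, 1 / (n : ℝ) * (π ^ 2 * bern (x / n + d))| ≤
      A * ∑' h : ℕ, 1 / (h : ℝ) ^ (3 / 2 : ℝ) := by
    rw [← h1.tsum_eq, ← tsum_mul_left]
    rw [← Real.norm_eq_abs]
    exact tsum_of_norm_bounded (hs.mul_left A).hasSum fun h => (Real.norm_eq_abs _).trans_le (h2 h)
  refine le_trans ?_ h3
  have e : ∑ n ∈ s, 1 / (n : ℝ) * (π ^ 2 * bern (x / n + d)) =
      π ^ 2 * ∑ n ∈ s, 1 / (n : ℝ) * bern (x / n + d) := by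
    rw [Finset.mul_sum]
    exact Finset.sum_congr rfl fun n _ => by ring
  rw [e, abs_mul, abs_of_nonneg (by positivity : (0 : ℝ) ≤ π ^ 2)]
  refine le_mul_of_one_le_left (abs_nonneg _) ?_
  nlinarith [Real.pi_gt_three]

lemma abs_sum_saw_le {s : Finset ℕ} {x A d : ℝ} (hs : ∑ n ∈ s, 1 / (n : ℝ) ≤ 1) (hd : 0 < d)
    (hd1 : d ≤ 1) (hA : ∀ d : ℝ, |∑ n ∈ s, 1 / (n : ℝ) * bern (x / n + d)| ≤ A) :
    |∑ n ∈ s, 1 / (n : ℝ) * saw (x / n)| ≤ A / d + d / 2 := by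
  have h0 : |∑ n ∈ s, 1 / (n : ℝ) * bern (x / n)| ≤ A := by simpa using hA 0
  have hsd : (∑ n ∈ s, 1 / (n : ℝ)) * (d / 2) ≤ d / 2 := mul_le_of_le_one_left (by positivity) hs
  have h1 := abs_le.1 h0
  have h2 := abs_le.1 (hA d)
  have h3 := abs_le.1 (hA (-d))
  rw [abs_le]
  constructor
  · have h4 : ∑ n ∈ s, 1 / (n : ℝ) * ((bern (x / n + d) - bern (x / n)) / (2 * d) - d / 2) ≤
        ∑ n ∈ s, 1 / (n : ℝ) * saw (x / n) :=
      Finset.sum_le_sum fun n _ => mul_le_mul_of_nonneg_left (saw_lower hd hd1) (by positivity)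
    have h5 : ∑ n ∈ s, 1 / (n : ℝ) * ((bern (x / n + d) - bern (x / n)) / (2 * d) - d / 2) =
        (∑ n ∈ s, 1 / (n : ℝ) * bern (x / n + d) - ∑ n ∈ s, 1 / (n : ℝ) * bern (x / n)) / (2 * d) -
        (∑ n ∈ s, 1 / (n : ℝ)) * (d / 2) := by
      rw [Finset.sum_mul, ← Finset.sum_sub_distrib, Finset.sum_div, ← Finset.sum_sub_distrib]
      exact Finset.sum_congr rfl fun n _ => by ring
    have h6 : -(A / d) ≤ (∑ n ∈ s, 1 / (n : ℝ) * bern (x / n + d) -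
        ∑ n ∈ s, 1 / (n : ℝ) * bern (x / n)) / (2 * d) := by
      rw [le_div_iff₀ (by positivity)]
      have : -(A / d) * (2 * d) = -(2 * A) := by field_simp
      rw [this]
      linarith
    linarith
  · have h4 : ∑ n ∈ s, 1 / (n : ℝ) * saw (x / n) ≤
        ∑ n ∈ s, 1 / (n : ℝ) * ((bern (x / n) - bern (x / n + -d)) / (2 * d) + d / 2) :=
      Finset.sum_le_sum fun n _ => mul_le_mul_of_nonneg_left (saw_upper hd hd1) (by positivity)
    have h5 : ∑ n ∈ s, 1 / (n : ℝ) * ((bern (x / n) - bern (x / n + -d)) / (2 * d) + d / 2) =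
        (∑ n ∈ s, 1 / (n : ℝ) * bern (x / n) - ∑ n ∈ s, 1 / (n : ℝ) * bern (x / n + -d)) / (2 * d) +
        (∑ n ∈ s, 1 / (n : ℝ)) * (d / 2) := by
      rw [Finset.sum_mul, ← Finset.sum_sub_distrib, Finset.sum_div, ← Finset.sum_add_distrib]
      exact Finset.sum_congr rfl fun n _ => by ring
    have h6 : (∑ n ∈ s, 1 / (n : ℝ) * bern (x / n) -
        ∑ n ∈ s, 1 / (n : ℝ) * bern (x / n + -d)) / (2 * d) ≤ A / d := by
      rw [div_le_iff₀ (by positivity)]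
      have : A / d * (2 * d) = 2 * A := by field_simp
      rw [this]
      linarith
    linarith

lemma exists_exponent {N : ℕ} (hN : 2 ≤ N) {y : ℝ} (hy : (N : ℝ) ^ 2 ≤ y) :
    ∃ t : ℕ, 1 ≤ t ∧ (N : ℝ) ^ (t + 1) ≤ y ∧ y ≤ (N : ℝ) ^ (t + 2) := by
  have hN1 : (1 : ℝ) < N := by exact_mod_cast (by omega : 1 < N)
  obtain ⟨m, hm1, hm2⟩ := exists_nat_pow_near ((one_le_pow₀ hN1.le).trans hy) hN1
  have hm : 2 ≤ m := by
    by_contra h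
    have h1 : (N : ℝ) ^ (m + 1) ≤ (N : ℝ) ^ 2 := pow_le_pow_right₀ hN1.le (by omega)
    linarith
  exact ⟨m - 1, by omega, by rwa [show m - 1 + 1 = m by omega],
    by rw [show m - 1 + 2 = m + 1 by omega]; exact hm2.le⟩

lemma exists_saw_block_le : ∃ C c : ℝ, 0 < C ∧ 0 < c ∧ ∀ (N B : ℕ) (x : ℝ), 2 ≤ N → N ≤ B →
    B ≤ 2 * N → (N : ℝ) ^ 2 ≤ x →
    |∑ n ∈ Finset.Ioc N B, 1 / (n : ℝ) * saw (x / n)| ≤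
      C * exp (-(c * log N ^ 3 / log x ^ 2)) := by
  obtain ⟨C, c, hC, hc, hc1, hblock⟩ := exists_norm_block_le
  obtain ⟨K, hK⟩ : ∃ K : ℝ, K = ∑' h : ℕ, 1 / (h : ℝ) ^ (3 / 2 : ℝ) := ⟨_, rfl⟩
  have hK0 : 0 ≤ K := by
    rw [hK]
    exact tsum_nonneg fun h => by positivity
  refine ⟨(C + 1) * K + 1 / 2, c / 2, by positivity, by positivity, ?_⟩
  intro N B x hN hNB hB hx
  have hN1 : (1 : ℝ) < N := by exact_mod_cast (by omega : 1 < N)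
  have hN0 : (0 : ℝ) < N := by linarith
  have hlN : 0 < log N := log_pos hN1
  have hx0 : 0 < x := lt_of_lt_of_le (by positivity) hx
  have hlx : 2 * log N ≤ log x := by
    have := log_le_log (by positivity) hx
    rwa [log_pow, Nat.cast_ofNat] at this
  have hlx0 : 0 < log x := by linarith
  obtain ⟨e, he⟩ : ∃ e, e = exp (-(c * log N ^ 3 / log x ^ 2)) := ⟨_, rfl⟩
  have he0 : 0 < e := he ▸ exp_pos _
  have hsum := sum_one_div_Ioc_le (by omega : 1 ≤ N) hB
  have heN : (N : ℝ) ^ (-(1 / 2) : ℝ) ≤ e := by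
    rw [he, rpow_def_of_pos hN0]
    apply exp_le_exp.2
    rw [mul_neg, neg_le_neg_iff, div_le_iff₀ (by positivity)]
    have h1 : (2 * log N) ^ 2 ≤ log x ^ 2 := by gcongr
    calc c * log N ^ 3 ≤ 1 * log N ^ 3 := by gcongr
      _ ≤ log N * (1 / 2) * (2 * log N) ^ 2 := by nlinarith [pow_pos hlN 3]
      _ ≤ log N * (1 / 2) * log x ^ 2 := by gcongr
  have hA : ∀ h : ℕ, 1 ≤ h → ‖∑ n ∈ Finset.Ioc N B, ((1 / n : ℝ) : ℂ) * ee (h * x / n)‖ ≤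
      (C + 1) * e * (h : ℝ) ^ (1 / 2 : ℝ) := by
    intro h hh
    have hhR : (1 : ℝ) ≤ h := by exact_mod_cast hh
    rcases le_or_gt h N with hhN | hhN
    · have hhNR : (h : ℝ) ≤ N := by exact_mod_cast hhN
      have hy : (N : ℝ) ^ 2 ≤ h * x := by nlinarith
      obtain ⟨t, ht, ht1, ht2⟩ := exists_exponent hN hy
      have htR : (1 : ℝ) ≤ t := by exact_mod_cast ht
      refine (hblock t N B (h * x) ht (by omega) hNB hB ht1 ht2).trans ?_
      have hlog : (t : ℝ) * log N ≤ log x := by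
        have h1 : (N : ℝ) ^ (t + 1) ≤ N * x := ht1.trans (by gcongr)
        rw [pow_succ, mul_comm (N : ℝ) x] at h1
        have h2 := le_of_mul_le_mul_right h1 hN0
        have h3 := log_le_log (by positivity) h2
        rwa [log_pow] at h3
      have h1 : (N : ℝ) ^ (-(c / (t : ℝ) ^ 2)) ≤ e := by
        rw [he, rpow_def_of_pos hN0]
        apply exp_le_exp.2
        rw [mul_neg, neg_le_neg_iff, mul_div_assoc', div_le_div_iff₀ (by positivity) (by positivity)]
        calc c * log N ^ 3 * (t : ℝ) ^ 2 = log N * c * ((t : ℝ) * log N) ^ 2 := by ring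
          _ ≤ log N * c * log x ^ 2 := by gcongr
      have h2 : (1 : ℝ) ≤ (h : ℝ) ^ (1 / 2 : ℝ) := one_le_rpow hhR (by norm_num)
      calc C * (N : ℝ) ^ (-(c / (t : ℝ) ^ 2)) ≤ (C + 1) * e * 1 := by
            rw [mul_one]
            exact mul_le_mul (by linarith) h1 (by positivity) (by positivity)
        _ ≤ (C + 1) * e * (h : ℝ) ^ (1 / 2 : ℝ) := by gcongr
    · have hhNR : (N : ℝ) ≤ h := by exact_mod_cast hhN.le
      refine (norm_sum_one_div_mul_le zero_le_one hsum fun n _ => (norm_ee _).le).trans ?_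
      calc (1 : ℝ) = 1 * ((N : ℝ) ^ (-(1 / 2) : ℝ) * (N : ℝ) ^ (1 / 2 : ℝ)) := by
            rw [← rpow_add hN0]
            norm_num
        _ ≤ (C + 1) * (e * (h : ℝ) ^ (1 / 2 : ℝ)) := by
          gcongr
          linarith
        _ = (C + 1) * e * (h : ℝ) ^ (1 / 2 : ℝ) := by ring
  have hB2 : ∀ d : ℝ, |∑ n ∈ Finset.Ioc N B, 1 / (n : ℝ) * bern (x / n + d)| ≤
      (C + 1) * e * K := fun d => by
    rw [hK]
    exact abs_sum_bern_le hA
  obtain ⟨d, hd⟩ : ∃ d, d = exp (-(c / 2 * log N ^ 3 / log x ^ 2)) := ⟨_, rfl⟩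
  have hd0 : 0 < d := hd ▸ exp_pos _
  have hde : e = d * d := by
    rw [he, hd, ← exp_add]
    congr 1
    ring
  have hd1 : d ≤ 1 := by
    rw [hd]
    apply exp_le_one_iff.2
    rw [neg_nonpos]
    positivity
  refine (abs_sum_saw_le hsum hd0 hd1 hB2).trans ?_
  rw [← hd, hde]
  apply le_of_eq
  field_simp

lemma abs_saw_le (y : ℝ) : |saw y| ≤ 1 := by
  have h1 := Int.fract_nonneg y
  have h2 := Int.fract_lt_one y
  rw [saw, abs_le]
  constructor <;> linarith

lemma abs_sum_saw_le_one {s : Finset ℕ} {x : ℝ} (hs : ∑ n ∈ s, 1 / (n : ℝ) ≤ 1) :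
    |∑ n ∈ s, 1 / (n : ℝ) * saw (x / n)| ≤ 1 := by
  refine (Finset.abs_sum_le_sum_abs _ _).trans (le_trans ?_ hs)
  refine Finset.sum_le_sum fun n _ => ?_
  rw [abs_mul, abs_of_nonneg (by positivity : 0 ≤ 1 / (n : ℝ))]
  exact mul_le_of_le_one_right (by positivity) (abs_saw_le _)

lemma sum_exp_le {u : ℝ} (hu : 0 < u) (m : ℕ) :
    ∑ i ∈ Finset.range m, exp (-(u * i)) ≤ 1 + 1 / u := by
  have h1 : ∀ i : ℕ, exp (-(u * i)) = exp (-u) ^ i := by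
    intro i
    rw [← exp_nat_mul]
    congr 1
    ring
  simp_rw [h1]
  have hq1 : exp (-u) < 1 := exp_lt_one_iff.2 (by linarith)
  have h2 : (1 + u) * exp (-u) ≤ 1 := by
    rw [exp_neg, ← div_eq_mul_inv, div_le_one (exp_pos _)]
    linarith [add_one_le_exp u]
  have h3 := geom_sum_mul_neg (exp (-u)) m
  have h4 : (0 : ℝ) ≤ exp (-u) ^ m := by positivity
  have h5 : (∑ i ∈ Finset.range m, exp (-u) ^ i) ≤ 1 / (1 - exp (-u)) := by
    rw [le_div_iff₀ (by linarith)]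
    linarith
  refine h5.trans ?_
  rw [div_le_iff₀ (by linarith)]
  have h6 : (1 + 1 / u) * (1 - exp (-u)) = (1 + u) * (1 - exp (-u)) / u := by
    field_simp
    ring
  rw [h6, le_div_iff₀ hu]
  linarith

lemma exists_sum_saw_le : ∃ C : ℝ, 0 < C ∧ ∀ (X : ℕ) (x : ℝ), exp 1 ≤ x → (X : ℝ) ^ 2 ≤ x →
    |∑ n ∈ Finset.Ioc 0 X, 1 / (n : ℝ) * saw (x / n)| ≤ C * log x ^ (2 / 3 : ℝ) := by
  obtain ⟨C, c, hC, hc, hblock⟩ := exists_saw_block_le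
  obtain ⟨b, hb⟩ : ∃ b, b = c * log 2 ^ 3 := ⟨_, rfl⟩
  have hb0 : 0 < b := by
    rw [hb]
    have := log_pos (by norm_num : (1 : ℝ) < 2)
    positivity
  refine ⟨2 + C * exp b * (1 + 1 / b), by positivity, ?_⟩
  intro X x hx hX
  have hx0 : 0 < x := (exp_pos 1).trans_le hx
  have hL : 1 ≤ log x := by rwa [le_log_iff_exp_le hx0]
  obtain ⟨T, hT⟩ : ∃ T, T = log x ^ (2 / 3 : ℝ) := ⟨_, rfl⟩
  rw [← hT]
  have hT1 : 1 ≤ T := hT ▸ one_le_rpow hL (by norm_num)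
  have hT3 : T ^ 3 = log x ^ 2 := by
    rw [hT, ← rpow_natCast, ← rpow_mul (by linarith), ← rpow_natCast]
    norm_num
  obtain ⟨F, hF⟩ : ∃ F : ℕ → ℝ, F = fun m => ∑ n ∈ Finset.Ioc 0 (min (2 ^ m) X),
    1 / (n : ℝ) * saw (x / n) := ⟨_, rfl⟩
  have hstep : ∀ i, |F (i + 1) - F i| ≤
      (if i = 0 then 1 else 0) + C * exp b * exp (-(b / T * i)) := by
    intro i
    have hle : min (2 ^ i) X ≤ min (2 ^ (i + 1)) X :=
      min_le_min_right _ (Nat.pow_le_pow_right (by norm_num) (by omega))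
    have e1 : F (i + 1) - F i = ∑ n ∈ Finset.Ioc (min (2 ^ i) X) (min (2 ^ (i + 1)) X),
        1 / (n : ℝ) * saw (x / n) := by
      rw [hF, sub_eq_iff_eq_add', Finset.sum_Ioc_consecutive _ (Nat.zero_le _) hle]
    have hpos : 0 ≤ C * exp b * exp (-(b / T * i)) := by positivity
    rw [e1]
    rcases le_or_gt X (2 ^ i) with h | h
    · rw [min_eq_right h, min_eq_right (h.trans (Nat.pow_le_pow_right (by norm_num) (by omega))),
        Finset.Ioc_self, Finset.sum_empty, abs_zero]
      split_ifs <;> linarith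
    · rw [min_eq_left h.le] at hle ⊢
      have hB : min (2 ^ (i + 1)) X ≤ 2 * 2 ^ i := (min_le_left _ _).trans_eq (pow_succ' _ _)
      rcases Nat.eq_zero_or_pos i with rfl | hi
      · rw [if_pos rfl]
        have := abs_sum_saw_le_one (x := x) (sum_one_div_Ioc_le (by norm_num) hB)
        linarith
      · rw [if_neg (by omega), zero_add]
        have hN : 2 ≤ 2 ^ i := Nat.le_self_pow (by omega) 2
        have hNX : ((2 ^ i : ℕ) : ℝ) ^ 2 ≤ x := by
          refine le_trans ?_ hX
          have : ((2 ^ i : ℕ) : ℝ) ≤ X := by exact_mod_cast h.le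
          gcongr
        refine (hblock _ _ x hN hle hB hNX).trans ?_
        rw [mul_assoc C, ← exp_add]
        refine mul_le_mul_of_nonneg_left (exp_le_exp.2 ?_) hC.le
        obtain ⟨v, hv⟩ : ∃ v, v = (i : ℝ) / T := ⟨_, rfl⟩
        have hv0 : 0 ≤ v := by rw [hv]; positivity
        have e2 : c * log ((2 ^ i : ℕ) : ℝ) ^ 3 / log x ^ 2 = b * v ^ 3 := by
          rw [Nat.cast_pow, Nat.cast_ofNat, log_pow, hb, hv, ← hT3]
          field_simp
        have e3 : b / T * i = b * v := by
          rw [hv]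
          field_simp
        rw [e2, e3]
        have : v - 1 ≤ v ^ 3 := by
          nlinarith [sq_nonneg (v - 1), mul_nonneg hv0 (sq_nonneg (v - 1)), sq_nonneg v]
        nlinarith
  have hF0 : |F 0| ≤ 1 := by
    rw [hF]
    apply abs_sum_saw_le_one
    refine (Finset.sum_le_sum_of_subset_of_nonneg
      (Finset.Ioc_subset_Ioc_right (min_le_left _ _)) fun _ _ _ => by positivity).trans ?_
    rw [pow_zero, show Finset.Ioc 0 1 = {1} from rfl]
    simp
  have hFm : ∀ m, |F m| ≤ 1 + ∑ i ∈ Finset.range m,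
      ((if i = 0 then 1 else 0) + C * exp b * exp (-(b / T * i))) := by
    intro m
    induction m with
    | zero => simpa using hF0
    | succ m ih =>
      rw [Finset.sum_range_succ]
      have h1 := abs_sub_abs_le_abs_sub (F (m + 1)) (F m)
      have h2 := hstep m
      linarith
  have h1 := hFm X
  have h2 : ∑ i ∈ Finset.range X, (if i = 0 then (1 : ℝ) else 0) ≤ 1 := by
    rw [Finset.sum_ite_eq']
    split_ifs <;> norm_num
  have h3 := sum_exp_le (div_pos hb0 (by linarith : 0 < T)) X
  rw [Finset.sum_add_distrib, ← Finset.mul_sum] at h1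
  have e : F X = ∑ n ∈ Finset.Ioc 0 X, 1 / (n : ℝ) * saw (x / n) := by
    rw [hF]
    simp only
    rw [min_eq_right (Nat.lt_two_pow_self).le]
  rw [← e]
  calc |F X| ≤ _ := h1
    _ ≤ 1 + (1 + C * exp b * (1 + 1 / (b / T))) := by gcongr
    _ = 2 * 1 + C * exp b * (1 * 1 + 1 / b * T) := by
      field_simp
      ring
    _ ≤ 2 * T + C * exp b * (1 * T + 1 / b * T) := by gcongr
    _ = _ := by ring

/-- The summatory function of the sum of divisors. -/
def divisorSum (M : ℕ) : ℕ := ∑ n ∈ Finset.Ioc 0 M, ∑ d ∈ n.divisors, d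

lemma divisorSum_eq (M : ℕ) :
    divisorSum M = ∑ b ∈ Finset.Ioc 0 M, ∑ a ∈ Finset.Ioc 0 (M / b), a := by
  have h := ArithmeticFunction.sum_Ioc_mul_eq_sum_sum
    ArithmeticFunction.zeta ArithmeticFunction.id M
  rw [divisorSum]
  trans ∑ n ∈ Finset.Ioc 0 M, (ArithmeticFunction.zeta * ArithmeticFunction.id) n
  · refine Finset.sum_congr rfl fun n _ => ?_
    rw [ArithmeticFunction.zeta_mul_apply]
    rfl
  · rw [h]
    refine Finset.sum_congr rfl fun b hb => ?_
    rw [ArithmeticFunction.zeta_apply_ne (by rw [Finset.mem_Ioc] at hb; omega), one_mul]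
    rfl

lemma divisorSum_eq_hyperbola {M X : ℕ} (hX : X ^ 2 ≤ M) (hM : M < (X + 1) ^ 2) :
    divisorSum M = ∑ b ∈ Finset.Ioc 0 X, ∑ a ∈ Finset.Ioc 0 (M / b), a +
      ∑ a ∈ Finset.Ioc 0 X, a * (M / a - X) := by
  have hXM : X ≤ M := (Nat.le_self_pow two_ne_zero X).trans hX
  rw [divisorSum_eq, ← Finset.sum_Ioc_consecutive _ (Nat.zero_le X) hXM]
  congr 1
  rw [Finset.sum_comm' (t' := Finset.Ioc 0 X) (s' := fun a => Finset.Ioc X (M / a))]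
  · refine Finset.sum_congr rfl fun a _ => ?_
    rw [Finset.sum_const, Nat.card_Ioc, smul_eq_mul, mul_comm]
  · intro b a
    simp only [Finset.mem_Ioc]
    constructor
    · rintro ⟨⟨h1, h2⟩, h3, h4⟩
      rw [Nat.le_div_iff_mul_le (by omega)] at h4
      refine ⟨⟨h1, ?_⟩, h3, ?_⟩
      swap
      · by_contra h
        have : (X + 1) * (X + 1) ≤ a * b := Nat.mul_le_mul (by omega) (by omega)
        nlinarith
      · rw [Nat.le_div_iff_mul_le h3]
        linarith
    · rintro ⟨⟨h1, h2⟩, h3, h4⟩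
      rw [Nat.le_div_iff_mul_le h3] at h2
      refine ⟨⟨h1, (Nat.le_mul_of_pos_right b h3).trans h2⟩, h3, ?_⟩
      rw [Nat.le_div_iff_mul_le (by omega)]
      linarith

lemma tendsto_sum_one_div_sq :
    Tendsto (fun X : ℕ => ∑ b ∈ Finset.Ioc 0 X, 1 / (b : ℝ) ^ 2) atTop (nhds (π ^ 2 / 6)) := by
  have h := (hasSum_zeta_two.tendsto_sum_nat).comp (tendsto_add_atTop_nat 1)
  refine h.congr fun X => ?_
  simp only [Function.comp]
  rw [← Nat.Ico_zero_eq_range, Finset.sum_eq_sum_Ico_succ_bot (by omega)]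
  simp only [Nat.cast_zero, ne_eq, OfNat.ofNat_ne_zero, not_false_eq_true, zero_pow, div_zero,
    zero_add]
  rfl

lemma sum_one_div_sq_bounds {X : ℕ} (hX : 1 ≤ X) :
    π ^ 2 / 6 - 1 / X ≤ ∑ b ∈ Finset.Ioc 0 X, 1 / (b : ℝ) ^ 2 ∧
      ∑ b ∈ Finset.Ioc 0 X, 1 / (b : ℝ) ^ 2 ≤ π ^ 2 / 6 - 1 / (X + 1) := by
  obtain ⟨F, hF⟩ : ∃ F : ℕ → ℝ, F = fun X : ℕ => ∑ b ∈ Finset.Ioc 0 X, 1 / (b : ℝ) ^ 2 := ⟨_, rfl⟩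
  have hlim : Tendsto F atTop (nhds (π ^ 2 / 6)) := hF ▸ tendsto_sum_one_div_sq
  have hs : ∀ m, F (m + 1) = F m + 1 / ((m : ℝ) + 1) ^ 2 := by
    intro m
    rw [hF]
    simp only
    rw [← Finset.insert_Ioc_right_eq_Ioc_add_one (by omega), Finset.sum_insert (by simp), add_comm]
    push_cast
    rfl
  have hup : ∀ m, X ≤ m → F m + 1 / m ≤ F X + 1 / X := by
    intro m hm
    induction m, hm using Nat.le_induction with
    | base => exact le_rfl
    | succ m hm ih =>
      refine le_trans ?_ ih
      have hm0 : (0 : ℝ) < m := by exact_mod_cast (by omega : 0 < m)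
      rw [hs]
      push_cast
      have : 1 / ((m : ℝ) + 1) ^ 2 + 1 / (m + 1) ≤ 1 / m := by
        rw [div_add_div _ _ (by positivity) (by positivity), div_le_div_iff₀ (by positivity) hm0]
        nlinarith
      linarith
  have hlo : ∀ m, X ≤ m → F X + 1 / (X + 1) ≤ F m + 1 / (m + 1) := by
    intro m hm
    induction m, hm using Nat.le_induction with
    | base => exact le_rfl
    | succ m hm ih =>
      refine ih.trans ?_
      have hm0 : (0 : ℝ) < m := by exact_mod_cast (by omega : 0 < m)
      rw [hs]
      push_cast
      have : 1 / ((m : ℝ) + 1) ≤ 1 / ((m : ℝ) + 1) ^ 2 + 1 / (m + 1 + 1) := by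
        rw [div_add_div _ _ (by positivity) (by positivity),
          div_le_div_iff₀ (by positivity) (by positivity)]
        nlinarith
      linarith
  have e : ∑ b ∈ Finset.Ioc 0 X, 1 / (b : ℝ) ^ 2 = F X := by rw [hF]
  rw [e]
  constructor
  · have h1 : Tendsto (fun m : ℕ => F m + 1 / (m : ℝ)) atTop (nhds (π ^ 2 / 6 + 0)) :=
      hlim.add tendsto_one_div_atTop_nhds_zero_nat
    have h2 := le_of_tendsto h1 (eventually_atTop.2 ⟨X, hup⟩)
    linarith
  · have h1 : Tendsto (fun m : ℕ => F m + 1 / ((m : ℝ) + 1)) atTop (nhds (π ^ 2 / 6 + 0)) :=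
      hlim.add tendsto_one_div_add_atTop_nhds_zero_nat
    have h2 := ge_of_tendsto h1 (eventually_atTop.2 ⟨X, hlo⟩)
    linarith

lemma natCast_div_eq_sub_saw (M b : ℕ) :
    ((M / b : ℕ) : ℝ) = (M : ℝ) / b - saw ((M : ℝ) / b) - 1 / 2 := by
  rw [saw, Int.fract, ← natCast_floor_eq_intCast_floor (by positivity), Nat.floor_div_eq_div]
  ring

lemma sum_Ioc_id (q : ℕ) : ∑ a ∈ Finset.Ioc 0 q, (a : ℝ) = q * (q + 1) / 2 := by
  induction q with
  | zero => simp
  | succ q ih =>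
    rw [← Finset.insert_Ioc_right_eq_Ioc_add_one (by omega), Finset.sum_insert (by simp), ih]
    push_cast
    ring

lemma abs_divisorSum_add_le {M X : ℕ} (hX1 : 1 ≤ X) (hX : X ^ 2 ≤ M) (hM : M < (X + 1) ^ 2) :
    |(divisorSum M : ℝ) - π ^ 2 / 12 * (M : ℝ) ^ 2 +
      M * ∑ n ∈ Finset.Ioc 0 X, 1 / (n : ℝ) * saw ((M : ℝ) / n)| ≤ 6 * (M : ℝ) := by
  obtain ⟨s, hs⟩ : ∃ s : ℕ → ℝ, s = fun n : ℕ => saw ((M : ℝ) / n) := ⟨_, rfl⟩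
  have hs1 : ∀ n, |s n| ≤ 1 := fun n => hs ▸ abs_saw_le _
  have hX1R : (1 : ℝ) ≤ X := by exact_mod_cast hX1
  have hXR : (X : ℝ) ^ 2 ≤ M := by exact_mod_cast hX
  have hMR : (M : ℝ) ≤ X ^ 2 + 2 * X := by
    have : M ≤ X ^ 2 + 2 * X := by nlinarith
    exact_mod_cast this
  have hfirst : ∑ b ∈ Finset.Ioc 0 X, ∑ a ∈ Finset.Ioc 0 (M / b), (a : ℝ) =
      (M : ℝ) ^ 2 / 2 * ∑ b ∈ Finset.Ioc 0 X, 1 / (b : ℝ) ^ 2 -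
      M * ∑ b ∈ Finset.Ioc 0 X, 1 / (b : ℝ) * s b +
      ∑ b ∈ Finset.Ioc 0 X, (s b ^ 2 - 1 / 4) / 2 := by
    rw [Finset.mul_sum, Finset.mul_sum, ← Finset.sum_sub_distrib, ← Finset.sum_add_distrib]
    refine Finset.sum_congr rfl fun b _ => ?_
    rw [sum_Ioc_id, natCast_div_eq_sub_saw, hs]
    ring
  have hsecond : ∑ a ∈ Finset.Ioc 0 X, (a : ℝ) * ((M / a - X : ℕ) : ℝ) =
      X * M - (X + 1 / 2) * (X * (X + 1) / 2) - ∑ a ∈ Finset.Ioc 0 X, a * s a := by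
    rw [← sum_Ioc_id, Finset.mul_sum]
    have e : (X : ℝ) * M = ∑ a ∈ Finset.Ioc 0 X, (M : ℝ) := by simp
    rw [e, ← Finset.sum_sub_distrib, ← Finset.sum_sub_distrib]
    refine Finset.sum_congr rfl fun a ha => ?_
    rw [Finset.mem_Ioc] at ha
    have ha0 : (0 : ℝ) < a := by exact_mod_cast ha.1
    have h1 : X ≤ M / a := by
      rw [Nat.le_div_iff_mul_le ha.1]
      nlinarith
    rw [Nat.cast_sub h1, natCast_div_eq_sub_saw, hs]
    field_simp
    ring
  have herr1 : |∑ b ∈ Finset.Ioc 0 X, (s b ^ 2 - 1 / 4) / 2| ≤ (X : ℝ) * (1 / 2) := by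
    refine (Finset.abs_sum_le_sum_abs _ _).trans ((Finset.sum_le_card_nsmul _ _ (1 / 2)
      fun b _ => ?_).trans ?_)
    · have := abs_le.1 (hs1 b)
      rw [abs_le]
      constructor <;> nlinarith
    · simp
  have herr2 : |∑ a ∈ Finset.Ioc 0 X, a * s a| ≤ (X : ℝ) * X := by
    refine (Finset.abs_sum_le_sum_abs _ _).trans ((Finset.sum_le_card_nsmul _ _ (X : ℝ)
      fun a ha => ?_).trans ?_)
    · rw [abs_mul, Nat.abs_cast]
      have h1 : (a : ℝ) ≤ X := by exact_mod_cast (Finset.mem_Ioc.1 ha).2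
      nlinarith [hs1 a, abs_nonneg (s a), (Nat.cast_nonneg a : (0 : ℝ) ≤ a)]
    · simp
  have hD : (divisorSum M : ℝ) = ∑ b ∈ Finset.Ioc 0 X, ∑ a ∈ Finset.Ioc 0 (M / b), (a : ℝ) +
      ∑ a ∈ Finset.Ioc 0 X, (a : ℝ) * ((M / a - X : ℕ) : ℝ) := by
    rw [divisorSum_eq_hyperbola hX hM]
    push_cast
    rfl
  obtain ⟨hz1, hz2⟩ := sum_one_div_sq_bounds hX1
  have eS : ∑ n ∈ Finset.Ioc 0 X, 1 / (n : ℝ) * saw ((M : ℝ) / n) =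
      ∑ n ∈ Finset.Ioc 0 X, 1 / (n : ℝ) * s n := by rw [hs]
  rw [hD, hfirst, hsecond, eS]
  obtain ⟨Z, hZ⟩ : ∃ Z, Z = ∑ b ∈ Finset.Ioc 0 X, 1 / (b : ℝ) ^ 2 := ⟨_, rfl⟩
  rw [← hZ] at hz1 hz2 ⊢
  obtain ⟨δ, hδ⟩ : ∃ δ, δ = Z - (π ^ 2 / 6 - 1 / X) := ⟨_, rfl⟩
  have hδ0 : 0 ≤ δ := by linarith
  have hδ1 : δ ≤ 1 / (X * (X + 1)) := by
    have : 1 / ((X : ℝ) * (X + 1)) = 1 / X - 1 / (X + 1) := by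
      field_simp
      ring
    rw [this]
    linarith
  have hMδ : (M : ℝ) ^ 2 / 2 * δ ≤ (M : ℝ) := by
    calc (M : ℝ) ^ 2 / 2 * δ ≤ (M : ℝ) ^ 2 / 2 * (1 / ((X : ℝ) * (X + 1))) := by gcongr
      _ = (M : ℝ) * (M / (2 * ((X : ℝ) * (X + 1)))) := by field_simp
      _ ≤ (M : ℝ) * 1 := by
        gcongr
        rw [div_le_one (by positivity)]
        nlinarith
      _ = (M : ℝ) := mul_one _
  have hmain : (M : ℝ) ^ 2 / 2 * Z = π ^ 2 / 12 * (M : ℝ) ^ 2 - (M : ℝ) ^ 2 / (2 * X) +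
      (M : ℝ) ^ 2 / 2 * δ := by
    rw [hδ]
    field_simp
    ring
  have hsq : (M : ℝ) ^ 2 / (2 * X) = X * M - X ^ 3 / 2 + (M - X ^ 2) ^ 2 / (2 * X) := by
    field_simp
    ring
  have hsq2 : ((M : ℝ) - X ^ 2) ^ 2 / (2 * X) ≤ 2 * X := by
    rw [div_le_iff₀ (by positivity)]
    nlinarith
  have hsq3 : 0 ≤ ((M : ℝ) - X ^ 2) ^ 2 / (2 * X) := by positivity
  have hMδ0 : 0 ≤ (M : ℝ) ^ 2 / 2 * δ := by positivity
  have h1 := abs_le.1 herr1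
  have h2 := abs_le.1 herr2
  have hXX : (X : ℝ) ≤ X ^ 2 := by nlinarith
  rw [hmain, hsq, abs_le]
  constructor <;> linarith

lemma exists_divisorSum_le : ∃ C : ℝ, 0 < C ∧ ∀ M : ℕ, exp 1 ≤ M →
    |(divisorSum M : ℝ) - π ^ 2 / 12 * (M : ℝ) ^ 2| ≤ C * (M * log M ^ (2 / 3 : ℝ)) := by
  obtain ⟨C, hC, h⟩ := exists_sum_saw_le
  refine ⟨C + 6, by positivity, ?_⟩
  intro M hM
  have hM1 : (1 : ℝ) ≤ M := le_trans (by linarith [add_one_le_exp (1 : ℝ)]) hM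
  have hX : Nat.sqrt M ^ 2 ≤ M := Nat.sqrt_le' M
  have hX2 : M < (Nat.sqrt M + 1) ^ 2 := Nat.lt_succ_sqrt' M
  have hX1 : 1 ≤ Nat.sqrt M := Nat.sqrt_pos.2 (by exact_mod_cast hM1)
  have h1 := h (Nat.sqrt M) M hM (by exact_mod_cast hX)
  have h2 := abs_divisorSum_add_le hX1 hX hX2
  obtain ⟨S, hS⟩ : ∃ S, S = ∑ n ∈ Finset.Ioc 0 (Nat.sqrt M), 1 / (n : ℝ) * saw ((M : ℝ) / n) :=
    ⟨_, rfl⟩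
  rw [← hS] at h1 h2
  have hL : 1 ≤ log M ^ (2 / 3 : ℝ) :=
    one_le_rpow ((le_log_iff_exp_le (by linarith)).2 hM) (by norm_num)
  have h3 : (M : ℝ) * |S| ≤ M * (C * log M ^ (2 / 3 : ℝ)) := by gcongr
  have h4 := abs_sub (((divisorSum M : ℝ) - π ^ 2 / 12 * (M : ℝ) ^ 2) + M * S) (M * S)
  rw [add_sub_cancel_right, abs_mul, Nat.abs_cast] at h4
  nlinarith

/-- The integer points on the circle of radius `√n`. -/
noncomputable def circlePoints (n : ℕ) : Finset (ℤ × ℤ) :=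
  {p ∈ Finset.Icc (-n : ℤ) n ×ˢ Finset.Icc (-n : ℤ) n | p.1 ^ 2 + p.2 ^ 2 = n}

lemma abs_le_of_sq_le {a : ℤ} {n : ℕ} (h : a ^ 2 ≤ n) : -(n : ℤ) ≤ a ∧ a ≤ n := by
  constructor
  · by_contra hc
    nlinarith
  · by_contra hc
    nlinarith

lemma mem_circlePoints {n : ℕ} {p : ℤ × ℤ} : p ∈ circlePoints n ↔ p.1 ^ 2 + p.2 ^ 2 = n := by
  rw [circlePoints, Finset.mem_filter, Finset.mem_product, Finset.mem_Icc, Finset.mem_Icc]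
  refine ⟨fun h => h.2, fun h => ⟨⟨abs_le_of_sq_le ?_, abs_le_of_sq_le ?_⟩, h⟩⟩
  · nlinarith [sq_nonneg p.2]
  · nlinarith [sq_nonneg p.1]

lemma card_circlePoints_two_mul (n : ℕ) :
    (circlePoints (2 * n)).card = (circlePoints n).card := by
  symm
  refine Finset.card_nbij' (fun p => (p.1 - p.2, p.1 + p.2))
    (fun p => ((p.1 + p.2) / 2, (p.2 - p.1) / 2)) ?_ ?_ ?_ ?_
  · intro p hp
    simp only [Finset.mem_coe, mem_circlePoints] at hp ⊢
    push_cast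
    linarith
  · intro p hp
    simp only [Finset.mem_coe, mem_circlePoints] at hp ⊢
    have h1 : (2 : ℤ) ∣ p.1 + p.2 := by
      have h2 : (2 : ℤ) ∣ (p.1 + p.2) ^ 2 := ⟨n + p.1 * p.2, by push_cast at hp; linarith⟩
      exact Int.prime_two.dvd_of_dvd_pow h2
    obtain ⟨c, hc⟩ := h1
    have e1 : (p.1 + p.2) / 2 = c := by omega
    have e2 : (p.2 - p.1) / 2 = p.2 - c := by omega
    rw [e1, e2]
    have : p.1 = 2 * c - p.2 := by omega
    rw [this] at hp
    push_cast at hp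
    linarith
  · intro p _
    ext <;> simp only <;> omega
  · intro p hp
    simp only [Finset.mem_coe, mem_circlePoints] at hp
    have h1 : (2 : ℤ) ∣ p.1 + p.2 := by
      have h2 : (2 : ℤ) ∣ (p.1 + p.2) ^ 2 := ⟨n + p.1 * p.2, by push_cast at hp; linarith⟩
      exact Int.prime_two.dvd_of_dvd_pow h2
    ext <;> simp only <;> omega

/-- The number of points on the circle of radius `√(n / p)`, read as zero when `p` does not
divide `n`. -/
noncomputable def circleCountDiv (n p : ℕ) : ℕ := if p ∣ n then (circlePoints (n / p)).card else 0

lemma card_filter_dvd_circlePoints {n p : ℕ} (hp : 0 < p) :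
    ({z ∈ circlePoints (p * n) | (p : ℤ) ∣ z.1 ∧ (p : ℤ) ∣ z.2}).card = circleCountDiv n p := by
  have hp0 : (0 : ℤ) < p := by exact_mod_cast hp
  rw [circleCountDiv]
  split_ifs with h
  · obtain ⟨m, rfl⟩ := h
    rw [Nat.mul_div_cancel_left _ hp]
    symm
    refine Finset.card_nbij' (fun z => (p * z.1, p * z.2)) (fun z => (z.1 / p, z.2 / p))
      ?_ ?_ ?_ ?_
    · intro z hz
      simp only [Finset.mem_coe, Finset.mem_filter, mem_circlePoints] at hz ⊢
      refine ⟨?_, Dvd.intro _ rfl, Dvd.intro _ rfl⟩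
      push_cast
      rw [← hz]
      ring
    · intro z hz
      simp only [Finset.mem_coe, Finset.mem_filter, mem_circlePoints] at hz ⊢
      obtain ⟨h1, ⟨c, hc⟩, ⟨d, hd⟩⟩ := hz
      rw [hc, hd] at h1 ⊢
      rw [Int.mul_ediv_cancel_left _ hp0.ne', Int.mul_ediv_cancel_left _ hp0.ne']
      push_cast at h1
      have h2 : (p : ℤ) * p ≠ 0 := by positivity
      apply mul_left_cancel₀ h2
      linarith
    · intro z _
      simp only [Int.mul_ediv_cancel_left _ hp0.ne']
    · intro z hz
      simp only [Finset.mem_coe, Finset.mem_filter, mem_circlePoints] at hz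
      ext
      · exact Int.mul_ediv_cancel' hz.2.1
      · exact Int.mul_ediv_cancel' hz.2.2
  · rw [Finset.card_eq_zero, Finset.filter_eq_empty_iff]
    rintro z hz ⟨⟨c, hc⟩, ⟨d, hd⟩⟩
    rw [mem_circlePoints, hc, hd] at hz
    apply h
    rw [← Int.natCast_dvd_natCast]
    push_cast at hz
    refine ⟨c ^ 2 + d ^ 2, ?_⟩
    apply mul_left_cancel₀ hp0.ne'
    linarith

lemma card_circlePoints_mul_of_three_mod_four {n p : ℕ} (hp : p.Prime) (hp4 : p % 4 = 3) :
    (circlePoints (p * n)).card = circleCountDiv n p := by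
  rw [← card_filter_dvd_circlePoints hp.pos, Finset.filter_true_of_mem]
  intro z hz
  rw [mem_circlePoints] at hz
  have : Fact p.Prime := ⟨hp⟩
  have hpz : Prime (p : ℤ) := Nat.prime_iff_prime_int.1 hp
  have key : ∀ a b : ℤ, a ^ 2 + b ^ 2 = ((p * n : ℕ) : ℤ) → (p : ℤ) ∣ a := by
    intro a b hab
    by_contra ha
    have ha' : (a : ZMod p) ≠ 0 := by rwa [Ne, ZMod.intCast_zmod_eq_zero_iff_dvd]
    have h1 : (b : ZMod p) ^ 2 = -(a : ZMod p) ^ 2 := by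
      have h2 := congrArg (Int.cast : ℤ → ZMod p) hab
      push_cast at h2
      rw [ZMod.natCast_self, zero_mul] at h2
      linear_combination h2
    exact ZMod.mod_four_ne_three_of_sq_eq_neg_sq' ha' h1 hp4
  exact ⟨key _ _ hz, key z.2 z.1 (by rw [← hz, add_comm])⟩

lemma card_filter_dvd_add {n p : ℕ} (hp : p.Prime) {u v : ℤ} (huv : u ^ 2 + v ^ 2 = p) :
    ({z ∈ circlePoints (p * n) | (p : ℤ) ∣ z.1 * u + z.2 * v}).card = (circlePoints n).card := by
  have hp0 : (p : ℤ) ≠ 0 := by exact_mod_cast hp.ne_zero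
  have hpz : Prime (p : ℤ) := Nat.prime_iff_prime_int.1 hp
  have hsec : ∀ z : ℤ × ℤ, z.1 ^ 2 + z.2 ^ 2 = ((p * n : ℕ) : ℤ) → (p : ℤ) ∣ z.1 * u + z.2 * v →
      (p : ℤ) ∣ z.2 * u - z.1 * v := by
    rintro z hz ⟨c, hc⟩
    apply hpz.dvd_of_dvd_pow (n := 2)
    refine ⟨p * n - p * c ^ 2, ?_⟩
    have : (z.2 * u - z.1 * v) ^ 2 = (z.1 ^ 2 + z.2 ^ 2) * (u ^ 2 + v ^ 2) -
      (z.1 * u + z.2 * v) ^ 2 := by ring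
    rw [this, hz, huv, hc]
    push_cast
    ring
  symm
  refine Finset.card_nbij' (fun z => (u * z.1 - v * z.2, u * z.2 + v * z.1))
    (fun z => ((z.1 * u + z.2 * v) / p, (z.2 * u - z.1 * v) / p)) ?_ ?_ ?_ ?_
  · intro z hz
    simp only [Finset.mem_coe, Finset.mem_filter, mem_circlePoints] at hz ⊢
    constructor
    · push_cast
      rw [← hz, ← huv]
      ring
    · exact ⟨z.1, by rw [← huv]; ring⟩
  · intro z hz
    simp only [Finset.mem_coe, Finset.mem_filter, mem_circlePoints] at hz ⊢
    obtain ⟨h1, h2⟩ := hz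
    obtain ⟨d, hd⟩ := hsec z h1 h2
    obtain ⟨c, hc⟩ := h2
    rw [hc, hd, Int.mul_ediv_cancel_left _ hp0, Int.mul_ediv_cancel_left _ hp0]
    have : (z.1 * u + z.2 * v) ^ 2 + (z.2 * u - z.1 * v) ^ 2 =
      (z.1 ^ 2 + z.2 ^ 2) * (u ^ 2 + v ^ 2) := by ring
    rw [h1, huv, hc, hd] at this
    push_cast at this
    apply mul_left_cancel₀ (mul_ne_zero hp0 hp0)
    linarith
  · intro z _
    have e1 : (u * z.1 - v * z.2) * u + (u * z.2 + v * z.1) * v = p * z.1 := by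
      rw [← huv]; ring
    have e2 : (u * z.2 + v * z.1) * u - (u * z.1 - v * z.2) * v = p * z.2 := by
      rw [← huv]; ring
    simp only
    rw [e1, e2, Int.mul_ediv_cancel_left _ hp0, Int.mul_ediv_cancel_left _ hp0]
  · intro z hz
    simp only [Finset.mem_coe, Finset.mem_filter, mem_circlePoints] at hz
    obtain ⟨h1, h2⟩ := hz
    obtain ⟨d, hd⟩ := hsec z h1 h2
    obtain ⟨c, hc⟩ := h2
    simp only
    rw [hc, hd, Int.mul_ediv_cancel_left _ hp0, Int.mul_ediv_cancel_left _ hp0]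
    ext
    · apply mul_left_cancel₀ hp0
      simp only
      linear_combination (-u) * hc + v * hd + z.1 * huv
    · apply mul_left_cancel₀ hp0
      simp only
      linear_combination (-u) * hd - v * hc + z.2 * huv

lemma card_circlePoints_mul_of_one_mod_four {n p : ℕ} (hp : p.Prime) (hp4 : p % 4 = 1) :
    (circlePoints (p * n)).card + circleCountDiv n p = 2 * (circlePoints n).card := by
  have : Fact p.Prime := ⟨hp⟩
  have hpz : Prime (p : ℤ) := Nat.prime_iff_prime_int.1 hp
  obtain ⟨a, b, hab⟩ := Nat.Prime.sq_add_sq (p := p) (by omega)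
  obtain ⟨u, hu⟩ : ∃ u : ℤ, u = a := ⟨_, rfl⟩
  obtain ⟨v, hv⟩ : ∃ v : ℤ, v = b := ⟨_, rfl⟩
  have huv : u ^ 2 + v ^ 2 = p := by
    rw [hu, hv]
    exact_mod_cast hab
  have hndvd : ∀ c : ℤ, 0 ≤ c → c ^ 2 ≤ p → (p : ℤ) ∣ c → c = 0 := by
    intro c hc0 hc hd
    by_contra h
    have h1 := Int.le_of_dvd (by omega) hd
    have h2 : (2 : ℤ) ≤ p := by exact_mod_cast hp.two_le
    nlinarith
  have hpu : ¬ (p : ℤ) ∣ u := by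
    intro h
    have h1 := hndvd u (by omega) (by nlinarith [sq_nonneg v]) h
    rw [h1] at huv
    have h2 : (p : ℤ) ∣ v := hpz.dvd_of_dvd_pow (n := 2) ⟨1, by linarith⟩
    have h3 := hndvd v (by omega) (by linarith) h2
    rw [h3] at huv
    exact hpz.ne_zero (by linarith)
  have hpv : ¬ (p : ℤ) ∣ v := by
    intro h
    have h1 := hndvd v (by omega) (by nlinarith [sq_nonneg u]) h
    rw [h1] at huv
    exact hpu (hpz.dvd_of_dvd_pow (n := 2) ⟨1, by linarith⟩)
  have hp2 : ¬ (p : ℤ) ∣ 2 := by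
    intro h
    have h1 := Int.le_of_dvd (by norm_num) h
    have h2 := hp.two_le
    omega
  have h1 := card_filter_dvd_add (n := n) hp huv
  have h2 := card_filter_dvd_add (n := n) hp (u := u) (v := -v) (by rw [neg_sq]; exact huv)
  have h3 := Finset.card_union_add_card_inter
    {z ∈ circlePoints (p * n) | (p : ℤ) ∣ z.1 * u + z.2 * v}
    {z ∈ circlePoints (p * n) | (p : ℤ) ∣ z.1 * u + z.2 * -v}
  rw [h1, h2, ← Finset.filter_or, ← Finset.filter_and, Finset.filter_true_of_mem,
    ← two_mul] at h3
  · rw [← h3, ← card_filter_dvd_circlePoints hp.pos]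
    congr 2
    apply Finset.filter_congr
    intro z _
    constructor
    · rintro ⟨h4, h5⟩
      exact ⟨(h4.mul_right u).add (h5.mul_right v), (h4.mul_right u).add (h5.mul_right _)⟩
    · rintro ⟨h4, h5⟩
      have h6 : (p : ℤ) ∣ 2 * u * z.1 := by
        have := h4.add h5
        ring_nf at this ⊢
        exact this
      have h7 : (p : ℤ) ∣ 2 * v * z.2 := by
        have := h4.sub h5
        ring_nf at this ⊢
        exact this
      constructor
      · rcases hpz.dvd_or_dvd h6 with h | h
        · rcases hpz.dvd_or_dvd h with h | h
          · exact absurd h hp2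
          · exact absurd h hpu
        · exact h
      · rcases hpz.dvd_or_dvd h7 with h | h
        · rcases hpz.dvd_or_dvd h with h | h
          · exact absurd h hp2
          · exact absurd h hpv
        · exact h
  · intro z hz
    rw [mem_circlePoints] at hz
    apply hpz.dvd_or_dvd
    refine ⟨n * u ^ 2 - z.2 ^ 2, ?_⟩
    push_cast at hz
    linear_combination u ^ 2 * hz - z.2 ^ 2 * huv

/-- The sum of the nontrivial character modulo four over the divisors of `n`. -/
def charDivisorSum (n : ℕ) : ℤ := ∑ d ∈ n.divisors, ZMod.χ₄ d

lemma sum_filter_dvd_char {n p : ℕ} (hn : n ≠ 0) (hp : 0 < p) :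
    ∑ d ∈ n.divisors with p ∣ d, ZMod.χ₄ d =
      if p ∣ n then ZMod.χ₄ p * charDivisorSum (n / p) else 0 := by
  split_ifs with h
  · obtain ⟨m, rfl⟩ := h
    rw [Nat.mul_div_cancel_left _ hp, charDivisorSum, Finset.mul_sum]
    have hm : m ≠ 0 := by rintro rfl; simp at hn
    symm
    refine Finset.sum_nbij' (fun d => p * d) (fun d => d / p) ?_ ?_ ?_ ?_ ?_
    · intro d hd
      rw [Nat.mem_divisors] at hd
      rw [Finset.mem_filter, Nat.mem_divisors]
      exact ⟨⟨mul_dvd_mul_left p hd.1, hn⟩, dvd_mul_right p d⟩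
    · intro d hd
      rw [Finset.mem_filter, Nat.mem_divisors] at hd
      obtain ⟨⟨h1, -⟩, ⟨c, rfl⟩⟩ := hd
      rw [Nat.mul_div_cancel_left _ hp, Nat.mem_divisors]
      exact ⟨(Nat.mul_dvd_mul_iff_left hp).1 h1, hm⟩
    · intro d _
      exact Nat.mul_div_cancel_left _ hp
    · intro d hd
      rw [Finset.mem_filter] at hd
      exact Nat.mul_div_cancel' hd.2
    · intro d _
      push_cast
      rw [map_mul]
  · rw [Finset.filter_false_of_mem, Finset.sum_empty]
    intro d hd hpd
    exact h (hpd.trans (Nat.dvd_of_mem_divisors hd))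

lemma charDivisorSum_prime_mul {n p : ℕ} (hn : n ≠ 0) (hp : p.Prime) :
    charDivisorSum (p * n) = charDivisorSum n + ZMod.χ₄ p * charDivisorSum n -
      if p ∣ n then ZMod.χ₄ p * charDivisorSum (n / p) else 0 := by
  have hpn : p * n ≠ 0 := mul_ne_zero hp.ne_zero hn
  rw [← sum_filter_dvd_char hn hp.pos]
  have h1 := sum_filter_dvd_char hpn hp.pos
  rw [if_pos (dvd_mul_right p n), Nat.mul_div_cancel_left _ hp.pos] at h1
  rw [← h1]
  have h2 := Finset.sum_filter_add_sum_filter_not (p * n).divisors (fun d => p ∣ d)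
    (fun d => ZMod.χ₄ d)
  have h3 := Finset.sum_filter_add_sum_filter_not n.divisors (fun d => p ∣ d)
    (fun d => ZMod.χ₄ d)
  have h4 : ({d ∈ (p * n).divisors | ¬ p ∣ d} : Finset ℕ) = {d ∈ n.divisors | ¬ p ∣ d} := by
    ext d
    simp only [Finset.mem_filter, Nat.mem_divisors]
    constructor
    · rintro ⟨⟨h, -⟩, hd⟩
      exact ⟨⟨(Nat.Coprime.symm ((Nat.Prime.coprime_iff_not_dvd hp).2 hd)).dvd_of_dvd_mul_left h,
        hn⟩, hd⟩
    · rintro ⟨⟨h, -⟩, hd⟩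
      exact ⟨⟨h.mul_left p, hpn⟩, hd⟩
  rw [h4] at h2
  rw [charDivisorSum, charDivisorSum, ← h2, ← h3]
  ring

lemma charDivisorSum_one : charDivisorSum 1 = 1 := by
  simp [charDivisorSum]

lemma card_circlePoints_one : (circlePoints 1).card = 4 := by
  rw [circlePoints]
  decide

/-- The number of points on a circle in terms of the divisors of its squared radius. -/
theorem card_circlePoints_eq (n : ℕ) (hn : n ≠ 0) :
    ((circlePoints n).card : ℤ) = 4 * charDivisorSum n := by
  induction n using Nat.strong_induction_on with
  | _ n ih =>
    by_cases h1 : n = 1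
    · rw [h1, card_circlePoints_one, charDivisorSum_one]
      norm_num
    obtain ⟨p, hp, m, rfl⟩ := Nat.exists_prime_and_dvd h1
    have hm : m ≠ 0 := by rintro rfl; simp at hn
    have hlt : m < p * m := by
      have := hp.two_le
      have := Nat.pos_of_ne_zero hm
      nlinarith
    have ihm := ih m hlt hm
    have ihd : ((circleCountDiv m p : ℕ) : ℤ) =
        4 * (if p ∣ m then charDivisorSum (m / p) else 0) := by
      rw [circleCountDiv]
      split_ifs with h
      · refine ih _ ((Nat.div_le_self m p).trans_lt hlt) ?_
        exact (Nat.div_pos (Nat.le_of_dvd (Nat.pos_of_ne_zero hm) h) hp.pos).ne'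
      · rfl
    rw [charDivisorSum_prime_mul hm hp]
    rcases hp.eq_two_or_odd with rfl | hodd
    · rw [card_circlePoints_two_mul, ihm, show ZMod.χ₄ ((2 : ℕ) : ZMod 4) = 0 by decide]
      simp
    · have h4 : p % 4 = 1 ∨ p % 4 = 3 := by omega
      rcases h4 with h4 | h4
      · have h5 := card_circlePoints_mul_of_one_mod_four (n := m) hp h4
        have h6 : ((circlePoints (p * m)).card : ℤ) + (circleCountDiv m p : ℕ) =
          2 * (circlePoints m).card := by exact_mod_cast h5
        rw [ZMod.χ₄_nat_one_mod_four h4, one_mul, one_mul]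
        linarith
      · rw [card_circlePoints_mul_of_three_mod_four hp h4, ihd, ZMod.χ₄_nat_three_mod_four h4]
        split_ifs <;> ring

lemma card_circlePoints_zero : (circlePoints 0).card = 1 := by
  rw [circlePoints]
  decide

/-- The quadruples `((a, x), (b, y))` of positive integers with `a * x + b * y = n`. -/
noncomputable def twoProducts (n : ℕ) : Finset ((ℕ × ℕ) × (ℕ × ℕ)) :=
  {q ∈ (Finset.Ioc 0 n ×ˢ Finset.Ioc 0 n) ×ˢ (Finset.Ioc 0 n ×ˢ Finset.Ioc 0 n) |
    q.1.1 * q.1.2 + q.2.1 * q.2.2 = n}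

lemma mem_twoProducts {n : ℕ} {q : (ℕ × ℕ) × (ℕ × ℕ)} :
    q ∈ twoProducts n ↔ 0 < q.1.1 ∧ 0 < q.1.2 ∧ 0 < q.2.1 ∧ 0 < q.2.2 ∧
      q.1.1 * q.1.2 + q.2.1 * q.2.2 = n := by
  simp only [twoProducts, Finset.mem_filter, Finset.mem_product, Finset.mem_Ioc]
  constructor
  · rintro ⟨⟨⟨⟨h1, -⟩, h2, -⟩, ⟨h3, -⟩, h4, -⟩, h⟩
    exact ⟨h1, h2, h3, h4, h⟩
  · rintro ⟨h1, h2, h3, h4, h⟩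
    refine ⟨⟨⟨⟨h1, ?_⟩, h2, ?_⟩, ⟨h3, ?_⟩, h4, ?_⟩, h⟩ <;> nlinarith

/-- The indicator of the multiples of four. -/
def fourInd (k : ℤ) : ℤ := if 4 ∣ k then 1 else 0

lemma char_mul_char (a b : ℕ) :
    ZMod.χ₄ a * ZMod.χ₄ b = fourInd ((a : ℤ) - b) - fourInd ((a : ℤ) + b) := by
  rw [ZMod.χ₄_nat_eq_if_mod_four, ZMod.χ₄_nat_eq_if_mod_four, fourInd, fourInd]
  split_ifs <;> omega

lemma sum_antidiagonal_charDivisorSum (n : ℕ) :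
    ∑ p ∈ Finset.HasAntidiagonal.antidiagonal n, charDivisorSum p.1 * charDivisorSum p.2 =
      ∑ q ∈ twoProducts n, ZMod.χ₄ q.1.1 * ZMod.χ₄ q.2.1 := by
  rw [← Finset.sum_fiberwise_of_maps_to (s := twoProducts n) (t := Finset.HasAntidiagonal.antidiagonal n)
    (g := fun q => (q.1.1 * q.1.2, q.2.1 * q.2.2))]
  · refine Finset.sum_congr rfl fun p hp => ?_
    have h : ({q ∈ twoProducts n | (q.1.1 * q.1.2, q.2.1 * q.2.2) = p} : Finset _) =
        p.1.divisorsAntidiagonal ×ˢ p.2.divisorsAntidiagonal := by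
      ext ⟨⟨a, x⟩, ⟨b, y⟩⟩
      obtain ⟨l, m⟩ := p
      simp only [Finset.mem_filter, mem_twoProducts, Finset.mem_product,
        Nat.mem_divisorsAntidiagonal, Prod.mk.injEq, Finset.HasAntidiagonal.mem_antidiagonal] at hp ⊢
      constructor
      · rintro ⟨⟨h1, h2, h3, h4, h5⟩, rfl, rfl⟩
        exact ⟨⟨rfl, (Nat.mul_pos h1 h2).ne'⟩, rfl, (Nat.mul_pos h3 h4).ne'⟩
      · rintro ⟨⟨rfl, h1⟩, rfl, h2⟩
        rw [Nat.mul_ne_zero_iff] at h1 h2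
        exact ⟨⟨Nat.pos_of_ne_zero h1.1, Nat.pos_of_ne_zero h1.2, Nat.pos_of_ne_zero h2.1,
          Nat.pos_of_ne_zero h2.2, hp⟩, rfl, rfl⟩
    rw [h, Finset.sum_product, charDivisorSum, charDivisorSum,
      ← Nat.sum_divisorsAntidiagonal (fun d _ => ZMod.χ₄ d),
      ← Nat.sum_divisorsAntidiagonal (fun d _ => ZMod.χ₄ d), Finset.sum_mul_sum]
  · intro q hq
    exact Finset.HasAntidiagonal.mem_antidiagonal.2 (mem_twoProducts.1 hq).2.2.2.2

lemma sum_twoProducts_swap (n : ℕ) (f : (ℕ × ℕ) × (ℕ × ℕ) → ℤ) :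
    ∑ q ∈ twoProducts n, f q = ∑ q ∈ twoProducts n, f (q.2, q.1) := by
  refine Finset.sum_nbij' Prod.swap Prod.swap ?_ ?_ ?_ ?_ ?_
  · intro q hq
    rw [mem_twoProducts] at hq ⊢
    simp only [Prod.fst_swap, Prod.snd_swap]
    exact ⟨hq.2.2.1, hq.2.2.2.1, hq.1, hq.2.1, by linarith [hq.2.2.2.2]⟩
  · intro q hq
    rw [mem_twoProducts] at hq ⊢
    simp only [Prod.fst_swap, Prod.snd_swap]
    exact ⟨hq.2.2.1, hq.2.2.2.1, hq.1, hq.2.1, by linarith [hq.2.2.2.2]⟩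
  · intro q _
    rfl
  · intro q _
    rfl
  · intro q _
    rfl

lemma sum_twoProducts_transpose (n : ℕ) (f : (ℕ × ℕ) × (ℕ × ℕ) → ℤ) :
    ∑ q ∈ twoProducts n, f q = ∑ q ∈ twoProducts n, f (q.1.swap, q.2.swap) := by
  refine Finset.sum_nbij' (fun q => (q.1.swap, q.2.swap)) (fun q => (q.1.swap, q.2.swap))
    ?_ ?_ ?_ ?_ ?_
  · intro q hq
    rw [mem_twoProducts] at hq ⊢
    simp only [Prod.fst_swap, Prod.snd_swap]
    exact ⟨hq.2.1, hq.1, hq.2.2.2.1, hq.2.2.1, by linarith [hq.2.2.2.2]⟩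
  · intro q hq
    rw [mem_twoProducts] at hq ⊢
    simp only [Prod.fst_swap, Prod.snd_swap]
    exact ⟨hq.2.1, hq.1, hq.2.2.2.1, hq.2.2.1, by linarith [hq.2.2.2.2]⟩
  · intro q _
    rfl
  · intro q _
    rfl
  · intro q _
    rfl

lemma sum_twoProducts_split (n : ℕ) (f : (ℕ × ℕ) × (ℕ × ℕ) → ℤ)
    (u v : (ℕ × ℕ) × (ℕ × ℕ) → ℕ) :
    ∑ q ∈ twoProducts n, f q = ∑ q ∈ twoProducts n with u q = v q, f q +
      ∑ q ∈ twoProducts n with v q < u q, f q + ∑ q ∈ twoProducts n with u q < v q, f q := by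
  rw [Finset.sum_filter, Finset.sum_filter, Finset.sum_filter, ← Finset.sum_add_distrib,
    ← Finset.sum_add_distrib]
  refine Finset.sum_congr rfl fun q _ => ?_
  rcases lt_trichotomy (u q) (v q) with h | h | h
  · rw [if_neg h.ne, if_neg h.not_gt, if_pos h]; ring
  · rw [if_pos h, if_neg h.ge.not_gt, if_neg h.le.not_gt]; ring
  · rw [if_neg h.ne', if_pos h, if_neg h.not_gt]; ring

lemma sum_twoProducts_lt_symm (n : ℕ) (f : (ℕ × ℕ) × (ℕ × ℕ) → ℤ)
    (hf : ∀ q, f (q.2, q.1) = f q) (u : ℕ × ℕ → ℕ) :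
    ∑ q ∈ twoProducts n with u q.1 < u q.2, f q =
      ∑ q ∈ twoProducts n with u q.2 < u q.1, f q := by
  rw [Finset.sum_filter, Finset.sum_filter, sum_twoProducts_swap]
  simp only [hf]

/-- The elementary change of variables `a = c + b` in `a * x + b * y = n`. -/
lemma sum_twoProducts_shear (n : ℕ) (f g : (ℕ × ℕ) × (ℕ × ℕ) → ℤ)
    (h : ∀ c x b y, f ((c + b, x), (b, y)) = g ((c, x), (b, x + y))) :
    ∑ q ∈ twoProducts n with q.2.1 < q.1.1, f q =
      ∑ q ∈ twoProducts n with q.1.2 < q.2.2, g q := by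
  refine Finset.sum_nbij' (fun q => ((q.1.1 - q.2.1, q.1.2), (q.2.1, q.1.2 + q.2.2)))
    (fun q => ((q.1.1 + q.2.1, q.1.2), (q.2.1, q.2.2 - q.1.2))) ?_ ?_ ?_ ?_ ?_
  · rintro ⟨⟨a, x⟩, ⟨b, y⟩⟩ hq
    simp only [Finset.mem_filter, mem_twoProducts] at hq ⊢
    obtain ⟨⟨h1, h2, h3, h4, h5⟩, h6⟩ := hq
    obtain ⟨c, rfl⟩ := Nat.exists_eq_add_of_lt h6
    refine ⟨⟨by omega, h2, h3, by omega, ?_⟩, by omega⟩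
    rw [show b + c + 1 - b = c + 1 by omega, ← h5]
    ring
  · rintro ⟨⟨a, x⟩, ⟨b, y⟩⟩ hq
    simp only [Finset.mem_filter, mem_twoProducts] at hq ⊢
    obtain ⟨⟨h1, h2, h3, h4, h5⟩, h6⟩ := hq
    obtain ⟨c, rfl⟩ := Nat.exists_eq_add_of_lt h6
    refine ⟨⟨by omega, h2, h3, by omega, ?_⟩, by omega⟩
    rw [show x + c + 1 - x = c + 1 by omega, ← h5]
    ring
  · rintro ⟨⟨a, x⟩, ⟨b, y⟩⟩ hq
    simp only [Finset.mem_filter] at hq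
    simp only [Prod.mk.injEq, and_true, true_and]
    omega
  · rintro ⟨⟨a, x⟩, ⟨b, y⟩⟩ hq
    simp only [Finset.mem_filter] at hq
    simp only [Prod.mk.injEq, and_true, true_and]
    omega
  · rintro ⟨⟨a, x⟩, ⟨b, y⟩⟩ hq
    simp only [Finset.mem_filter] at hq
    rw [← h]
    congr 3
    simp only
    omega

lemma sum_twoProducts_diag (n : ℕ) (H : ℕ → ℕ → ℕ → ℤ) :
    ∑ q ∈ twoProducts n with q.1.2 = q.2.2, H q.1.1 q.1.2 q.2.1 =
      ∑ d ∈ n.divisors, ∑ a ∈ Finset.Ico 1 d, H a (n / d) (d - a) := by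
  rw [Finset.sum_sigma']
  refine Finset.sum_nbij' (fun q => ⟨q.1.1 + q.2.1, q.1.1⟩)
    (fun s => ((s.2, n / s.1), (s.1 - s.2, n / s.1))) ?_ ?_ ?_ ?_ ?_
  · rintro ⟨⟨a, x⟩, ⟨b, y⟩⟩ hq
    simp only [Finset.mem_filter, mem_twoProducts, Finset.mem_sigma, Nat.mem_divisors,
      Finset.mem_Ico] at hq ⊢
    obtain ⟨⟨h1, h2, h3, h4, rfl⟩, rfl⟩ := hq
    exact ⟨⟨⟨x, by ring⟩, by positivity⟩, h1, by omega⟩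
  · rintro ⟨d, a⟩ hq
    simp only [Finset.mem_filter, mem_twoProducts, Finset.mem_sigma, Nat.mem_divisors,
      Finset.mem_Ico] at hq ⊢
    obtain ⟨⟨⟨c, rfl⟩, h1⟩, h2, h3⟩ := hq
    rw [Nat.mul_ne_zero_iff] at h1
    rw [Nat.mul_div_cancel_left _ (Nat.pos_of_ne_zero h1.1)]
    refine ⟨⟨by omega, by omega, by omega, by omega, ?_⟩, trivial⟩
    rw [← add_mul]
    congr 1
    omega
  · rintro ⟨⟨a, x⟩, ⟨b, y⟩⟩ hq
    simp only [Finset.mem_filter, mem_twoProducts] at hq ⊢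
    obtain ⟨⟨h1, h2, h3, h4, rfl⟩, rfl⟩ := hq
    rw [← add_mul, Nat.mul_div_cancel_left _ (by omega), Nat.add_sub_cancel_left]
  · rintro ⟨d, a⟩ hq
    simp only [Finset.mem_sigma, Finset.mem_Ico] at hq
    simp only [Sigma.mk.injEq, heq_eq_eq, and_true]
    omega
  · rintro ⟨⟨a, x⟩, ⟨b, y⟩⟩ hq
    simp only [Finset.mem_filter, mem_twoProducts] at hq ⊢
    obtain ⟨⟨h1, h2, h3, h4, rfl⟩, rfl⟩ := hq
    rw [← add_mul, Nat.mul_div_cancel_left _ (by omega), Nat.add_sub_cancel_left]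

lemma sum_Ico_fourInd (d : ℕ) : ∑ a ∈ Finset.Ico 1 d, fourInd a = ((d - 1) / 4 : ℕ) := by
  induction d with
  | zero => simp
  | succ k ih =>
    rcases Nat.eq_zero_or_pos k with rfl | hk
    · simp
    · rw [Finset.sum_Ico_succ_top hk, ih, fourInd]
      split_ifs <;> omega

lemma sum_fourInd_div (n : ℕ) :
    ∑ d ∈ n.divisors, fourInd d * ((n / d : ℕ) : ℤ) =
      ∑ d ∈ n.divisors, fourInd d * ((d / 4 : ℕ) : ℤ) := by
  by_cases hn : n = 0
  · simp [hn]
  by_cases h : 4 ∣ n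
  · obtain ⟨m, rfl⟩ := h
    have hm : m ≠ 0 := by omega
    have key : ∀ f : ℕ → ℤ, ∑ d ∈ (4 * m).divisors, fourInd d * f d =
        ∑ e ∈ m.divisors, f (4 * e) := by
      intro f
      simp only [fourInd, ite_mul, one_mul, zero_mul]
      rw [← Finset.sum_filter]
      refine Finset.sum_nbij' (fun d => d / 4) (fun e => 4 * e) ?_ ?_ ?_ ?_ ?_
      · intro d hd
        rw [Finset.mem_filter, Nat.mem_divisors] at hd
        obtain ⟨⟨h1, -⟩, h2⟩ := hd
        obtain ⟨c, rfl⟩ : 4 ∣ d := by omega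
        rw [Nat.mul_div_cancel_left _ (by norm_num), Nat.mem_divisors]
        exact ⟨(Nat.mul_dvd_mul_iff_left (by norm_num)).1 h1, hm⟩
      · intro e he
        rw [Nat.mem_divisors] at he
        rw [Finset.mem_filter, Nat.mem_divisors]
        exact ⟨⟨mul_dvd_mul_left 4 he.1, hn⟩, by omega⟩
      · intro d hd
        rw [Finset.mem_filter] at hd
        omega
      · intro e _
        omega
      · intro d hd
        rw [Finset.mem_filter] at hd
        congr 1
        omega
    rw [key (fun d => ((4 * m / d : ℕ) : ℤ)), key (fun d => ((d / 4 : ℕ) : ℤ))]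
    rw [← Nat.sum_div_divisors m fun e => ((4 * e / 4 : ℕ) : ℤ)]
    refine Finset.sum_congr rfl fun e _ => ?_
    rw [Nat.mul_div_mul_left _ _ (by norm_num), Nat.mul_div_cancel_left _ (by norm_num)]
  · have h0 : ∀ d ∈ n.divisors, fourInd (d : ℤ) = 0 := by
      intro d hd
      rw [fourInd, if_neg]
      intro h4
      exact h ((show 4 ∣ d by omega).trans (Nat.dvd_of_mem_divisors hd))
    rw [Finset.sum_eq_zero, Finset.sum_eq_zero]
    · intro d hd
      rw [h0 d hd, zero_mul]
    · intro d hd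
      rw [h0 d hd, zero_mul]

/-- Liouville's identity for the correlation of the character. -/
lemma two_mul_sum_twoProducts_char (n : ℕ) :
    2 * ∑ q ∈ twoProducts n, ZMod.χ₄ q.1.1 * ZMod.χ₄ q.2.1 + charDivisorSum n =
      ∑ d ∈ n.divisors with ¬ 4 ∣ d, (d : ℤ) := by
  have e1 : ∑ q ∈ twoProducts n, ZMod.χ₄ q.1.1 * ZMod.χ₄ q.2.1 =
      ∑ q ∈ twoProducts n, fourInd ((q.1.1 : ℤ) - q.2.1) -
        ∑ q ∈ twoProducts n, fourInd ((q.1.1 : ℤ) + q.2.1) := by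
    rw [← Finset.sum_sub_distrib]
    exact Finset.sum_congr rfl fun q _ => char_mul_char _ _
  have e2 := sum_twoProducts_split n (fun q => fourInd ((q.1.1 : ℤ) - q.2.1))
    (fun q => q.1.1) (fun q => q.2.1)
  rw [sum_twoProducts_lt_symm n (fun q => fourInd ((q.1.1 : ℤ) - q.2.1)) (by
      intro q
      simp only [fourInd]
      split_ifs <;> omega) Prod.fst,
    sum_twoProducts_shear n (fun q => fourInd ((q.1.1 : ℤ) - q.2.1)) (fun q => fourInd q.1.1) (by
      intro c x b y
      simp)] at e2
  have e3 := sum_twoProducts_split n (fun q => fourInd ((q.1.1 : ℤ) + q.2.1))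
    (fun q => q.1.2) (fun q => q.2.2)
  have e4 : ∑ q ∈ twoProducts n with q.1.2 < q.2.2, fourInd ((q.1.1 : ℤ) + q.2.1) =
      ∑ q ∈ twoProducts n with q.2.1 < q.1.1, fourInd q.1.1 := by
    symm
    refine sum_twoProducts_shear n _ _ ?_
    intro c x b y
    push_cast
    rfl
  rw [← sum_twoProducts_lt_symm n (fun q => fourInd ((q.1.1 : ℤ) + q.2.1)) (by
      intro q
      simp only [add_comm]) Prod.snd, e4] at e3
  have e5 := sum_twoProducts_split n (fun q => fourInd q.1.1) (fun q => q.1.1) (fun q => q.2.1)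
  have e6 := sum_twoProducts_split n (fun q => fourInd q.1.1) (fun q => q.1.2) (fun q => q.2.2)
  have e7 : ∑ q ∈ twoProducts n with q.1.1 < q.2.1, fourInd q.1.1 =
      ∑ q ∈ twoProducts n with q.2.2 < q.1.2, fourInd q.1.1 := by
    rw [Finset.sum_filter, sum_twoProducts_swap, ← Finset.sum_filter]
    rw [Finset.sum_filter (fun q : (ℕ × ℕ) × (ℕ × ℕ) => q.2.2 < q.1.2), sum_twoProducts_swap,
      ← Finset.sum_filter]
    exact sum_twoProducts_shear n _ _ fun c x b y => rfl
  have f1 : ∑ q ∈ twoProducts n with q.1.1 = q.2.1, fourInd ((q.1.1 : ℤ) - q.2.1) =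
      ∑ d ∈ n.divisors, ((d - 1 : ℕ) : ℤ) := by
    rw [Finset.sum_filter, sum_twoProducts_transpose, ← Finset.sum_filter]
    simp only [Prod.fst_swap]
    rw [Finset.sum_congr rfl (g := fun _ => (1 : ℤ)), sum_twoProducts_diag n fun _ _ _ => 1]
    · simp
    · intro q hq
      rw [Finset.mem_filter] at hq
      simp [hq.2, fourInd]
  have f2 : ∑ q ∈ twoProducts n with q.1.2 = q.2.2, fourInd ((q.1.1 : ℤ) + q.2.1) =
      ∑ d ∈ n.divisors, ((d - 1 : ℕ) : ℤ) * fourInd d := by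
    rw [sum_twoProducts_diag n fun a _ b => fourInd ((a : ℤ) + b)]
    refine Finset.sum_congr rfl fun d _ => ?_
    rw [Finset.sum_congr rfl (g := fun _ => fourInd (d : ℤ))]
    · simp
    · intro a ha
      rw [Finset.mem_Ico] at ha
      congr 1
      omega
  have f3 : ∑ q ∈ twoProducts n with q.1.1 = q.2.1, fourInd q.1.1 =
      ∑ d ∈ n.divisors, fourInd d * ((n / d - 1 : ℕ) : ℤ) := by
    rw [Finset.sum_filter, sum_twoProducts_transpose, ← Finset.sum_filter]
    simp only [Prod.fst_swap]
    rw [sum_twoProducts_diag n fun _ x _ => fourInd x, ← Nat.sum_div_divisors]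
    refine Finset.sum_congr rfl fun d hd => ?_
    rw [Nat.mem_divisors] at hd
    rw [Nat.div_div_self hd.1 hd.2]
    simp [mul_comm]
  have f4 : ∑ q ∈ twoProducts n with q.1.2 = q.2.2, fourInd q.1.1 =
      ∑ d ∈ n.divisors, (((d - 1) / 4 : ℕ) : ℤ) := by
    rw [sum_twoProducts_diag n fun a _ _ => fourInd a]
    exact Finset.sum_congr rfl fun d _ => sum_Ico_fourInd d
  have f5 : ∑ d ∈ n.divisors, fourInd d * ((n / d - 1 : ℕ) : ℤ) =
      ∑ d ∈ n.divisors, fourInd d * ((d / 4 : ℕ) : ℤ) - ∑ d ∈ n.divisors, fourInd d := by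
    rw [← sum_fourInd_div, ← Finset.sum_sub_distrib]
    refine Finset.sum_congr rfl fun d hd => ?_
    have h1 : 1 ≤ n / d := Nat.div_pos (Nat.divisor_le hd) (Nat.pos_of_mem_divisors hd)
    rw [Nat.cast_sub h1]
    push_cast
    ring
  have total : 2 * (∑ d ∈ n.divisors, ((d - 1 : ℕ) : ℤ) -
      ∑ d ∈ n.divisors, ((d - 1 : ℕ) : ℤ) * fourInd d +
      2 * (∑ d ∈ n.divisors, fourInd d * ((d / 4 : ℕ) : ℤ) - ∑ d ∈ n.divisors, fourInd d -
        ∑ d ∈ n.divisors, (((d - 1) / 4 : ℕ) : ℤ))) + charDivisorSum n =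
      ∑ d ∈ n.divisors with ¬ 4 ∣ d, (d : ℤ) := by
    rw [charDivisorSum, Finset.sum_filter]
    simp only [← Finset.sum_sub_distrib, Finset.mul_sum, ← Finset.sum_add_distrib]
    refine Finset.sum_congr rfl fun d hd => ?_
    have hd0 := Nat.pos_of_mem_divisors hd
    rw [ZMod.χ₄_nat_eq_if_mod_four, fourInd]
    split_ifs <;> omega
  rw [← total, e1]
  linarith

/-- Jacobi's four squares theorem. -/
theorem sum_antidiagonal_card_circlePoints {n : ℕ} (hn : n ≠ 0) :
    ∑ p ∈ Finset.HasAntidiagonal.antidiagonal n, ((circlePoints p.1).card : ℤ) * (circlePoints p.2).card =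
      8 * ∑ d ∈ n.divisors with ¬ 4 ∣ d, (d : ℤ) := by
  have h0 : ∀ m : ℕ, ((circlePoints m).card : ℤ) =
      (if m = 0 then 1 else 0) + 4 * charDivisorSum m := by
    intro m
    split_ifs with h
    · rw [h, card_circlePoints_zero]
      simp [charDivisorSum]
    · rw [card_circlePoints_eq m h, zero_add]
  rw [← two_mul_sum_twoProducts_char, ← sum_antidiagonal_charDivisorSum]
  have h1 : ∑ p ∈ Finset.HasAntidiagonal.antidiagonal n, (if p.1 = 0 then 1 else 0) * charDivisorSum p.2 =
      charDivisorSum n := by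
    rw [Finset.sum_eq_single (0, n)]
    · simp
    · rintro ⟨a, b⟩ h2 h3
      rw [Finset.HasAntidiagonal.mem_antidiagonal] at h2
      have : a ≠ 0 := by
        rintro rfl
        apply h3
        simpa using h2
      simp [this]
    · simp
  have h2 : ∑ p ∈ Finset.HasAntidiagonal.antidiagonal n, charDivisorSum p.1 * (if p.2 = 0 then 1 else 0) =
      charDivisorSum n := by
    rw [← Finset.Nat.sum_antidiagonal_swap, ← h1]
    refine Finset.sum_congr rfl fun p _ => ?_
    rw [mul_comm]
    rfl
  have h3 : ∀ p ∈ Finset.HasAntidiagonal.antidiagonal n,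
      ((circlePoints p.1).card : ℤ) * (circlePoints p.2).card =
      4 * ((if p.1 = 0 then 1 else 0) * charDivisorSum p.2) +
      4 * (charDivisorSum p.1 * (if p.2 = 0 then 1 else 0)) +
      16 * (charDivisorSum p.1 * charDivisorSum p.2) := by
    intro p hp
    rw [Finset.HasAntidiagonal.mem_antidiagonal] at hp
    rw [h0, h0]
    have : ((if p.1 = 0 then 1 else 0) : ℤ) * (if p.2 = 0 then 1 else 0) = 0 := by
      split_ifs <;> omega
    linear_combination this
  rw [Finset.sum_congr rfl h3, Finset.sum_add_distrib, Finset.sum_add_distrib,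
    ← Finset.mul_sum, ← Finset.mul_sum, ← Finset.mul_sum, h1, h2]
  ring

lemma latticeA4_eq_sum {x : ℝ} (hx : 0 ≤ x) :
    latticeA4 x = ∑ n ∈ Finset.range (⌊x⌋₊ + 1), ∑ p ∈ Finset.HasAntidiagonal.antidiagonal n,
      (circlePoints p.1).card * (circlePoints p.2).card := by
  obtain ⟨T, hT⟩ : ∃ T, T = (Finset.range (⌊x⌋₊ + 1)).sigma fun n =>
    (Finset.HasAntidiagonal.antidiagonal n).sigma fun p =>
      circlePoints p.1 ×ˢ circlePoints p.2 := ⟨_, rfl⟩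
  have hset : {v : Fin 4 → ℤ | ∑ i, ((v i : ℝ)) ^ 2 ≤ x} =
      (fun s : (Σ _ : ℕ, Σ _ : ℕ × ℕ, (ℤ × ℤ) × (ℤ × ℤ)) =>
        (![s.2.2.1.1, s.2.2.1.2, s.2.2.2.1, s.2.2.2.2] : Fin 4 → ℤ)) '' (T : Set _) := by
    ext v
    rw [Set.mem_ofPred_eq, Set.mem_image]
    simp only [hT, Finset.mem_coe, Finset.mem_sigma, Finset.mem_product, mem_circlePoints,
      Finset.mem_range, Finset.HasAntidiagonal.mem_antidiagonal]
    constructor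
    · intro h
      refine ⟨⟨((v 0).natAbs ^ 2 + (v 1).natAbs ^ 2) + ((v 2).natAbs ^ 2 + (v 3).natAbs ^ 2),
        ((v 0).natAbs ^ 2 + (v 1).natAbs ^ 2, (v 2).natAbs ^ 2 + (v 3).natAbs ^ 2),
        ((v 0, v 1), (v 2, v 3))⟩, ⟨?_, rfl, ?_, ?_⟩, ?_⟩
      · rw [Nat.lt_succ_iff]
        apply Nat.le_floor
        rw [Fin.sum_univ_four] at h
        push_cast
        simp only [Nat.cast_natAbs, Int.cast_abs, sq_abs]
        linarith
      · simp
      · simp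
      · ext i
        fin_cases i <;> rfl
    · rintro ⟨⟨n, ⟨l, m⟩, ⟨⟨a, b⟩, ⟨c, d⟩⟩⟩, ⟨h1, h2, h3, h4⟩, rfl⟩
      simp only at h1 h2 h3 h4
      have h5 : (n : ℝ) ≤ x := (Nat.le_floor_iff hx).1 (Nat.lt_succ_iff.1 h1)
      have h6 : a ^ 2 + b ^ 2 + (c ^ 2 + d ^ 2) = (n : ℤ) := by
        rw [h3, h4, ← h2]
        push_cast
        rfl
      have h7 : (a : ℝ) ^ 2 + (b : ℝ) ^ 2 + ((c : ℝ) ^ 2 + (d : ℝ) ^ 2) = n := by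
        exact_mod_cast h6
      rw [Fin.sum_univ_four]
      simp
      linarith
  rw [latticeA4, hset, Set.InjOn.ncard_image, Set.ncard_coe_finset, hT, Finset.card_sigma]
  · refine Finset.sum_congr rfl fun n _ => ?_
    rw [Finset.card_sigma]
    exact Finset.sum_congr rfl fun p _ => Finset.card_product _ _
  · rintro ⟨n, ⟨l, m⟩, ⟨⟨a, b⟩, ⟨c, d⟩⟩⟩ hs ⟨n', ⟨l', m'⟩, ⟨⟨a', b'⟩, ⟨c', d'⟩⟩⟩ hs' h
    simp only [hT, Finset.mem_coe, Finset.mem_sigma, Finset.mem_product, mem_circlePoints,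
      Finset.mem_range, Finset.HasAntidiagonal.mem_antidiagonal] at hs hs'
    have e0 : a = a' := congrFun h 0
    have e1 : b = b' := congrFun h 1
    have e2 : c = c' := congrFun h 2
    have e3 : d = d' := congrFun h 3
    subst e0 e1 e2 e3
    have e4 : l = l' := by exact_mod_cast hs.2.2.1.symm.trans hs'.2.2.1
    have e5 : m = m' := by exact_mod_cast hs.2.2.2.symm.trans hs'.2.2.2
    subst e4 e5
    have e6 : n = n' := hs.2.1.symm.trans hs'.2.1
    subst e6
    rfl

lemma sum_divisors_four_dvd (M : ℕ) :
    ∑ n ∈ Finset.Ioc 0 M, ∑ d ∈ n.divisors with 4 ∣ d, d = 4 * divisorSum (M / 4) := by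
  rw [divisorSum, Finset.mul_sum]
  simp only [Finset.mul_sum]
  rw [Finset.sum_sigma', Finset.sum_sigma']
  refine Finset.sum_nbij' (fun s => ⟨s.1 / 4, s.2 / 4⟩) (fun s => ⟨4 * s.1, 4 * s.2⟩)
    ?_ ?_ ?_ ?_ ?_
  · rintro ⟨n, d⟩ h
    simp only [Finset.mem_sigma, Finset.mem_Ioc, Finset.mem_filter, Nat.mem_divisors] at h ⊢
    obtain ⟨h1, ⟨⟨c, rfl⟩, h2⟩, ⟨e, rfl⟩⟩ := h
    rw [mul_assoc] at h1 ⊢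
    rw [Nat.mul_div_cancel_left _ (by norm_num), Nat.mul_div_cancel_left _ (by norm_num)]
    exact ⟨⟨by omega, by omega⟩, ⟨c, rfl⟩, by omega⟩
  · rintro ⟨n, d⟩ h
    simp only [Finset.mem_sigma, Finset.mem_Ioc, Finset.mem_filter, Nat.mem_divisors] at h ⊢
    obtain ⟨h1, h2, h3⟩ := h
    exact ⟨⟨by omega, by omega⟩, ⟨mul_dvd_mul_left 4 h2, by omega⟩, by omega⟩
  · rintro ⟨n, d⟩ h
    simp only [Finset.mem_sigma, Finset.mem_Ioc, Finset.mem_filter, Nat.mem_divisors] at h ⊢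
    have h4 : 4 ∣ n := h.2.2.trans h.2.1.1
    rw [Nat.mul_div_cancel' h4, Nat.mul_div_cancel' h.2.2]
  · rintro ⟨n, d⟩ _
    simp only
    rw [Nat.mul_div_cancel_left _ (by norm_num), Nat.mul_div_cancel_left _ (by norm_num)]
  · rintro ⟨n, d⟩ h
    simp only [Finset.mem_sigma, Finset.mem_filter] at h
    exact (Nat.mul_div_cancel' h.2.2).symm

/-- The number of lattice points in the four-dimensional ball in terms of divisor sums. -/
lemma latticeA4_eq_divisorSum {x : ℝ} (hx : 0 ≤ x) :
    (latticeA4 x : ℝ) = 1 + 8 * divisorSum ⌊x⌋₊ - 32 * divisorSum (⌊x⌋₊ / 4) := by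
  obtain ⟨M, hM⟩ : ∃ M, M = ⌊x⌋₊ := ⟨_, rfl⟩
  have h1 : (latticeA4 x : ℤ) = 1 + ∑ n ∈ Finset.Ioc 0 M,
      8 * ∑ d ∈ n.divisors with ¬ 4 ∣ d, (d : ℤ) := by
    rw [latticeA4_eq_sum hx, ← hM, Finset.sum_range_eq_add_Ico _ (Nat.succ_pos M)]
    push_cast
    congr 1
    refine Finset.sum_congr (by ext n; simp only [Finset.mem_Ico, Finset.mem_Ioc]; omega)
      fun n hn => ?_
    rw [Finset.mem_Ioc] at hn
    exact sum_antidiagonal_card_circlePoints (by omega)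
  have h2 : ∑ n ∈ Finset.Ioc 0 M, ∑ d ∈ n.divisors with 4 ∣ d, d +
      ∑ n ∈ Finset.Ioc 0 M, ∑ d ∈ n.divisors with ¬ 4 ∣ d, d = divisorSum M := by
    rw [← Finset.sum_add_distrib, divisorSum]
    exact Finset.sum_congr rfl fun n _ => Finset.sum_filter_add_sum_filter_not _ _ _
  rw [sum_divisors_four_dvd] at h2
  have h3 : 4 * (divisorSum (M / 4) : ℤ) + ∑ n ∈ Finset.Ioc 0 M,
      ∑ d ∈ n.divisors with ¬ 4 ∣ d, (d : ℤ) = divisorSum M := by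
    rw [← h2]
    push_cast
    rfl
  rw [← Finset.mul_sum] at h1
  have h4 : (latticeA4 x : ℤ) = 1 + 8 * divisorSum M - 32 * divisorSum (M / 4) := by linarith
  rw [← hM]
  exact_mod_cast h4

lemma abs_latticeP4_le {C x : ℝ} (hC : 0 < C)
    (h : ∀ M : ℕ, exp 1 ≤ M → |(divisorSum M : ℝ) - π ^ 2 / 12 * (M : ℝ) ^ 2| ≤
      C * (M * log M ^ (2 / 3 : ℝ))) (hx : 32 ≤ x) :
    |latticeP4 x| ≤ (1 + 40 * C + 8 / 3 * π ^ 2) * (x * log x ^ (2 / 3 : ℝ)) := by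
  have he : exp 1 < 3 := lt_trans exp_one_lt_d9 (by norm_num)
  obtain ⟨M, hM⟩ : ∃ M, M = ⌊x⌋₊ := ⟨_, rfl⟩
  have hMx : (M : ℝ) ≤ x := hM ▸ Nat.floor_le (by linarith)
  have hxM : x < M + 1 := hM ▸ Nat.lt_floor_add_one x
  obtain ⟨N, hN⟩ : ∃ N, N = M / 4 := ⟨_, rfl⟩
  have hN1 : 4 * (N : ℝ) ≤ M := by
    exact_mod_cast (show 4 * N ≤ M by omega)
  have hN2 : (M : ℝ) ≤ 4 * N + 3 := by
    exact_mod_cast (show M ≤ 4 * N + 3 by omega)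
  have hlog : 1 ≤ log x := by
    rw [le_log_iff_exp_le (by linarith)]
    linarith
  have hL : 1 ≤ log x ^ (2 / 3 : ℝ) := one_le_rpow hlog (by norm_num)
  have hD : ∀ K : ℕ, exp 1 ≤ K → (K : ℝ) ≤ x →
      |(divisorSum K : ℝ) - π ^ 2 / 12 * (K : ℝ) ^ 2| ≤ C * (x * log x ^ (2 / 3 : ℝ)) := by
    intro K hK hKx
    refine (h K hK).trans ?_
    have hK0 : (0 : ℝ) < K := (exp_pos 1).trans_le hK
    have h1 : 0 ≤ log K := log_nonneg (by linarith [add_one_le_exp (1 : ℝ)])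
    gcongr
  have h1 := abs_le.1 (hD M (by linarith) hMx)
  have h2 := abs_le.1 (hD N (by linarith) (by linarith))
  obtain ⟨E, hE⟩ : ∃ E, E = x * log x ^ (2 / 3 : ℝ) := ⟨_, rfl⟩
  have hxE : x ≤ E := by
    rw [hE]
    exact le_mul_of_one_le_right (by linarith) hL
  rw [← hE] at h1 h2 ⊢
  have hp : 0 ≤ π ^ 2 / 12 := by positivity
  obtain ⟨c, hc⟩ : ∃ c, c = π ^ 2 / 12 := ⟨_, rfl⟩
  rw [latticeP4, latticeA4_eq_divisorSum (by linarith), ← hM, ← hN,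
    show π ^ 2 / 2 = 6 * c by rw [hc]; ring, show 8 / 3 * π ^ 2 = 32 * c by rw [hc]; ring]
  rw [← hc] at h1 h2 hp
  have m1 : (M : ℝ) ^ 2 ≤ x ^ 2 := by gcongr
  have m2 : x ^ 2 - 2 * x ≤ (M : ℝ) ^ 2 := by nlinarith
  have n1 : 16 * (N : ℝ) ^ 2 ≤ x ^ 2 := by nlinarith
  have n2 : x ^ 2 - 8 * x ≤ 16 * (N : ℝ) ^ 2 := by nlinarith
  have a1 := mul_le_mul_of_nonneg_left m1 hp
  have a2 := mul_le_mul_of_nonneg_left m2 hp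
  have a3 := mul_le_mul_of_nonneg_left n1 hp
  have a4 := mul_le_mul_of_nonneg_left n2 hp
  have a5 := mul_le_mul_of_nonneg_left hxE hp
  rw [abs_le]
  constructor <;> linarith

end Walfisz

theorem walfisz_four_dimensional_bound :
    (fun x : ℝ => latticeP4 x) =O[atTop]
      (fun x : ℝ => x * Real.log x ^ ((2 : ℝ) / 3)) := by
  obtain ⟨C, hC, h⟩ := Walfisz.exists_divisorSum_le
  refine IsBigO.of_bound (1 + 40 * C + 8 / 3 * π ^ 2) ?_
  filter_upwards [eventually_ge_atTop 32] with x hx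
  rw [norm_eq_abs, norm_eq_abs]
  refine (Walfisz.abs_latticeP4_le hC h hx).trans ?_
  gcongr
  exact le_abs_self _
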